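/- Let B = B(0,1) ⊂ ℝ^d, let A₀ be a constant real d×d matrix satisfying λ|ξ|² ≤ A₀ξ·ξ for all ξ ∈ ℝ^d and |A₀| ≤ Λ for some λ, Λ > 0, and let f : ℝ^d → ℝ^d be smooth. Suppose u is continuously differentiable on the closed ball B̄, u = 0 on ∂B, and ∫_B (A₀∇u)·∇φ = ∫_B f·∇φ for every φ ∈ C_c^∞(B). Then for every α > 0, the Lebesgue measure of {x ∈ B : |∇u(x)| > α} is at most (C/α) ∫_B |f| dx, where C depends only on d, λ, Λ. -/

import Mathlib

open MeasureTheory Metric Matrix Set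

/-- The gradient of `u`, as a vector in `ℝ^d`. -/
noncomputable def grad {d : ℕ} (u : EuclideanSpace ℝ (Fin d) → ℝ)
    (x : EuclideanSpace ℝ (Fin d)) : Fin d → ℝ :=
  fun i => fderiv ℝ u x (EuclideanSpace.single i 1)

/-- The Euclidean space `ℝ^d`. -/
abbrev Euc (d : ℕ) := EuclideanSpace ℝ (Fin d)

/-- The open unit ball of `ℝ^d`. -/
abbrev uball (d : ℕ) : Set (Euc d) := ball (0 : Euc d) 1

section Scaling

variable {d : ℕ}

lemma integrable_add_norm_rpow_neg {s t : ℝ} (hs : (d : ℝ) < s) (ht : 0 < t) :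
    Integrable (fun z : Euc d => (t + ‖z‖) ^ (-s)) := by
  have h := integrable_one_add_norm (E := Euc d) (μ := volume) (r := s) (by simpa using hs)
  have h2 := (h.comp_smul (inv_ne_zero ht.ne')).const_mul (t ^ (-s))
  refine h2.congr (Filter.Eventually.of_forall fun z => ?_)
  simp only
  rw [← Real.mul_rpow ht.le (by positivity), norm_smul, norm_inv, Real.norm_of_nonneg ht.le]
  congr 1; field_simp

lemma integral_add_norm_rpow_neg {s t : ℝ} (ht : 0 < t) :
    ∫ z : Euc d, (t + ‖z‖) ^ (-s) = t ^ ((d : ℝ) - s) * ∫ z : Euc d, (1 + ‖z‖) ^ (-s) := by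
  have h := Measure.integral_comp_smul (volume : Measure (Euc d))
    (fun z => (t + ‖z‖) ^ (-s)) t
  have h3 : ∀ z : Euc d, (t + ‖t • z‖) ^ (-s) = t ^ (-s) * (1 + ‖z‖) ^ (-s) := by
    intro z
    rw [← Real.mul_rpow ht.le (by positivity), norm_smul, Real.norm_of_nonneg ht.le]
    congr 1; ring
  simp only [h3, integral_const_mul, finrank_euclideanSpace, Fintype.card_fin, smul_eq_mul] at h
  rw [abs_of_nonneg (by positivity)] at h
  have : t ^ ((d : ℝ) - s) = t ^ d * t ^ (-s) := by
    rw [sub_eq_add_neg, Real.rpow_add ht, Real.rpow_natCast]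
  rw [this, mul_assoc, h]
  field_simp

lemma integral_one_add_norm_rpow_neg_nonneg (s : ℝ) :
    0 ≤ ∫ z : Euc d, (1 + ‖z‖) ^ (-s) := integral_nonneg fun z => by positivity

end Scaling

section BadBalls

variable {d : ℕ}

lemma volume_real_ball (x : Euc d) {r : ℝ} (hr : 0 < r) :
    volume.real (ball x r) = r ^ d * volume.real (uball d) := by
  rw [Measure.real, Measure.addHaar_ball_of_pos _ _ hr, ENNReal.toReal_mul,
    ENNReal.toReal_ofReal (by positivity), finrank_euclideanSpace, Fintype.card_fin, Measure.real]

lemma volume_real_uball_pos : 0 < volume.real (uball d) :=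
  ENNReal.toReal_pos (measure_ball_pos _ _ one_pos).ne' measure_ball_lt_top.ne

lemma ball_shrink_subset {b : Euc d} {r : ℝ} (hb : b ∈ uball d) (hr : 0 < r) (hr1 : r < 1) :
    ball ((1 - r / 4) • b) (r / 4) ⊆ ball b r ∩ uball d := by
  intro y hy
  have hb' : ‖b‖ < 1 := by simpa using hb
  rw [mem_ball, dist_eq_norm] at hy
  constructor
  · rw [mem_ball, dist_eq_norm]
    have : y - b = (y - (1 - r / 4) • b) - (r / 4) • b := by module
    rw [this]
    refine (norm_sub_le _ _).trans_lt ?_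
    rw [norm_smul, Real.norm_of_nonneg (by positivity)]
    nlinarith
  · rw [mem_ball, dist_zero_right]
    have : y = (y - (1 - r / 4) • b) + (1 - r / 4) • b := by module
    rw [this]
    refine (norm_add_le _ _).trans_lt ?_
    rw [norm_smul, Real.norm_of_nonneg (by linarith)]
    nlinarith

/-- A radius whose ball at `x` carries too much mass of `f`. -/
def badRadius (f : Euc d → ℝ) (α : ℝ) (x : Euc d) (r : ℝ) : Prop :=
  0 < r ∧ α * r ^ d < ∫ y in ball x r ∩ uball d, |f y|

lemma badRadius.lt_one [NeZero d] {f : Euc d → ℝ} {α : ℝ} {x : Euc d} {r : ℝ}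
    (hf : IntegrableOn f (uball d)) (hI : ∫ y in uball d, |f y| < α)
    (h : badRadius f α x r) : r < 1 := by
  by_contra hr
  push Not at hr
  have h1 : ∫ y in ball x r ∩ uball d, |f y| ≤ ∫ y in uball d, |f y| :=
    setIntegral_mono_set hf.abs (Filter.Eventually.of_forall fun _ => abs_nonneg _)
      (Filter.Eventually.of_forall inter_subset_right)
  have h0 : 0 ≤ ∫ y in uball d, |f y| := integral_nonneg fun _ => abs_nonneg _
  have : 1 ≤ r ^ d := one_le_pow₀ hr
  have h2 := h.2
  nlinarith

lemma exists_badRadius_maximal [NeZero d] {f : Euc d → ℝ} {α : ℝ} {x : Euc d} {r₀ : ℝ}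
    (hf : IntegrableOn f (uball d)) (hI : ∫ y in uball d, |f y| < α)
    (h : badRadius f α x r₀) : ∃ r, badRadius f α x r ∧ ¬ badRadius f α x (10 * r) := by
  have hbdd : BddAbove {r | badRadius f α x r} := ⟨1, fun r hr => (hr.lt_one hf hI).le⟩
  have hpos : 0 < sSup {r | badRadius f α x r} := h.1.trans_le (le_csSup hbdd h)
  obtain ⟨r, hr, hr2⟩ := exists_lt_of_lt_csSup ⟨r₀, h⟩ (half_lt_self hpos)
  refine ⟨r, hr, fun h10 => ?_⟩
  have := le_csSup hbdd h10
  linarith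

lemma abs_le_of_forall_not_badRadius {f : Euc d → ℝ} {α : ℝ} {x : Euc d}
    (hf : IntegrableOn f (uball d)) (hc : ContinuousOn f (uball d))
    (hx : x ∈ uball d) (h : ∀ r, ¬ badRadius f α x r) :
    |f x| ≤ α / volume.real (uball d) := by
  by_contra hlt
  push Not at hlt
  obtain ⟨c, hc1, hc2⟩ := exists_between hlt
  have hcf : ContinuousAt (fun y => |f y|) x :=
    (hc.continuousAt (isOpen_ball.mem_nhds hx)).abs
  obtain ⟨r, hr, hball⟩ := Metric.mem_nhds_iff.1
    (Filter.inter_mem (hcf.eventually (lt_mem_nhds hc2)) (isOpen_ball.mem_nhds hx))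
  have hsub : ball x r ∩ uball d = ball x r :=
    inter_eq_left.2 fun y hy => (hball hy).2
  refine h r ⟨hr, ?_⟩
  rw [hsub]
  have h1 : c * volume.real (ball x r) ≤ ∫ y in ball x r, |f y| := by
    have := setIntegral_mono_on (μ := volume) (f := fun _ => c) (g := fun y => |f y|)
      (s := ball x r) (integrableOn_const measure_ball_lt_top.ne)
      (IntegrableOn.mono_set hf.abs fun y hy => (hball hy).2) measurableSet_ball
      (fun y hy => (hball hy).1.le)
    simpa [mul_comm] using this
  refine lt_of_lt_of_le ?_ h1
  rw [volume_real_ball x hr]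
  rw [div_lt_iff₀ volume_real_uball_pos] at hc1
  have : 0 < r ^ d := by positivity
  nlinarith

lemma sum_bad_le {f : Euc d → ℝ} {α : ℝ} {r : Euc d → ℝ} (F : Finset (Euc d))
    (hf : IntegrableOn f (uball d))
    (hbad : ∀ b ∈ F, badRadius f α b (r b))
    (hdisj : (F : Set (Euc d)).PairwiseDisjoint fun b => ball b (r b)) :
    ∑ b ∈ F, α * r b ^ d ≤ ∫ y in uball d, |f y| := by
  calc ∑ b ∈ F, α * r b ^ d ≤ ∑ b ∈ F, ∫ y in ball b (r b) ∩ uball d, |f y| :=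
        Finset.sum_le_sum fun b hb => (hbad b hb).2.le
    _ = ∫ y in ⋃ b ∈ F, (ball b (r b) ∩ uball d), |f y| := by
        rw [integral_biUnion_finset F (fun b _ => measurableSet_ball.inter measurableSet_ball)
          (fun b hb c hc hbc => (hdisj hb hc hbc).mono inter_subset_left inter_subset_left)
          (fun b _ => IntegrableOn.mono_set hf.abs inter_subset_right)]
    _ ≤ _ := by
        refine setIntegral_mono_set hf.abs (Filter.Eventually.of_forall fun _ => abs_nonneg _)
          (Filter.Eventually.of_forall ?_)
        exact iUnion₂_subset fun b _ => inter_subset_right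

lemma exists_selection [NeZero d] {f : Euc d → ℝ} {α η : ℝ} (hη : 0 < η) (hα : 0 < α)
    (hf : IntegrableOn f (uball d)) (hc : ContinuousOn f (uball d))
    (hI : ∫ y in uball d, |f y| < α) :
    ∃ (F : Finset (Euc d)) (r : Euc d → ℝ) (L : Set (Euc d)),
      (∀ b ∈ F, b ∈ uball d ∧ badRadius f α b (r b) ∧ ¬ badRadius f α b (10 * r b)) ∧
      ((F : Set (Euc d)).PairwiseDisjoint fun b => ball b (r b)) ∧
      MeasurableSet L ∧ volume L ≤ ENNReal.ofReal η ∧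
      ∀ y ∈ uball d, y ∉ L → (∀ b ∈ F, y ∉ closedBall b (5 * r b)) →
        |f y| ≤ α / volume.real (uball d) := by
  set t : Set (Euc d) := {x ∈ uball d | ∃ r, badRadius f α x r} with ht
  have hsel : ∀ x : Euc d, ∃ r : ℝ, x ∈ t → badRadius f α x r ∧ ¬ badRadius f α x (10 * r) := by
    intro x
    by_cases hx : x ∈ t
    · obtain ⟨r₀, hr₀⟩ := hx.2
      obtain ⟨r, hr⟩ := exists_badRadius_maximal hf hI hr₀
      exact ⟨r, fun _ => hr⟩
    · exact ⟨0, fun h => absurd h hx⟩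
  choose r hr using hsel
  obtain ⟨u, hut, hdisj, hcov⟩ :=
    Vitali.exists_disjoint_subfamily_covering_enlargement_closedBall t (fun x => x) r 1
      (fun x hx => ((hr x hx).1.lt_one hf hI).le) 5 (by norm_num)
  have hdisj' : u.PairwiseDisjoint fun b => ball b (r b) :=
    hdisj.mono fun b => ball_subset_closedBall
  have hcount : u.Countable :=
    hdisj'.countable_of_isOpen (fun _ _ => isOpen_ball)
      fun b hb => ⟨b, mem_ball_self (hr b (hut hb)).1.1⟩
  have hsum : ∑' b : u, volume (closedBall (b : Euc d) (5 * r b)) ≠ ⊤ := by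
    have hb1 : ∀ b : u, volume (closedBall (b : Euc d) (5 * r b)) =
        ENNReal.ofReal ((5 ^ d * volume.real (uball d) / α) * (α * r b ^ d)) := by
      intro b
      have hpos := (hr b (hut b.2)).1.1
      rw [Measure.addHaar_closedBall _ _ (by positivity), finrank_euclideanSpace,
        Fintype.card_fin, ← ENNReal.ofReal_toReal (a := volume (ball (0 : Euc d) 1))
          measure_ball_lt_top.ne, ← ENNReal.ofReal_mul (by positivity)]
      congr 1
      change _ * volume.real (uball d) = _
      field_simp
      ring
    have hle : ∑' b : u, volume (closedBall (b : Euc d) (5 * r b)) ≤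
        ENNReal.ofReal ((5 ^ d * volume.real (uball d) / α) * ∫ y in uball d, |f y|) := by
      rw [ENNReal.tsum_eq_iSup_sum]
      refine iSup_le fun s => ?_
      simp only [hb1]
      have hpos : ∀ b : u, 0 < r b := fun b => (hr b (hut b.2)).1.1
      rw [← ENNReal.ofReal_sum_of_nonneg (fun b _ => by have := hpos b; positivity),
        ← Finset.mul_sum]
      refine ENNReal.ofReal_le_ofReal (mul_le_mul_of_nonneg_left ?_ (by positivity))
      have := sum_bad_le (α := α) (r := r) (s.map (Function.Embedding.subtype _)) hf
        (by intro b hb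
            simp only [Finset.mem_map, Function.Embedding.subtype_apply] at hb
            obtain ⟨a, _, rfl⟩ := hb
            exact (hr a (hut a.2)).1)
        (hdisj'.subset (by
            intro b hb
            simp only [Finset.coe_map, Function.Embedding.subtype_apply, mem_image] at hb
            obtain ⟨a, _, rfl⟩ := hb
            exact a.2))
      simpa using this
    exact ne_top_of_le_ne_top ENNReal.ofReal_ne_top hle
  have hlim := ENNReal.tendsto_tsum_compl_atTop_zero hsum
  have hev := hlim.eventually (ge_mem_nhds (ENNReal.ofReal_pos.2 hη))
  obtain ⟨s, hs⟩ := hev.exists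
  have hcu : Countable u := hcount.to_subtype
  refine ⟨s.map (Function.Embedding.subtype _), r,
    ⋃ b : {x // x ∉ s}, closedBall ((b : u) : Euc d) (5 * r (b : u)), ?_, ?_, ?_, ?_, ?_⟩
  · intro b hb
    simp only [Finset.mem_map, Function.Embedding.subtype_apply] at hb
    obtain ⟨a, _, rfl⟩ := hb
    exact ⟨(hut a.2).1, hr a (hut a.2)⟩
  · refine hdisj'.subset ?_
    intro b hb
    simp only [Finset.coe_map, Function.Embedding.subtype_apply, mem_image] at hb
    obtain ⟨a, _, rfl⟩ := hb
    exact a.2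
  · exact MeasurableSet.iUnion fun _ => isClosed_closedBall.measurableSet
  · exact (measure_iUnion_le _).trans hs
  · intro y hy hyL hyF
    refine abs_le_of_forall_not_badRadius hf hc hy fun ρ hρ => ?_
    have hyt : y ∈ t := ⟨hy, ρ, hρ⟩
    obtain ⟨b, hbu, hb⟩ := hcov y hyt
    have hyb : y ∈ closedBall b (5 * r b) := hb (mem_closedBall_self (hr y hyt).1.1.le)
    by_cases hbs : (⟨b, hbu⟩ : u) ∈ s
    · exact hyF b (Finset.mem_map.2 ⟨⟨b, hbu⟩, hbs, rfl⟩) hyb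
    · exact hyL (mem_iUnion.2 ⟨⟨⟨b, hbu⟩, hbs⟩, hyb⟩)

end BadBalls

section BddMeas

variable {d : ℕ}

instance isFiniteMeasure_restrict_uball :
    IsFiniteMeasure ((volume : Measure (Euc d)).restrict (uball d)) :=
  ⟨by rw [Measure.restrict_apply_univ]; exact measure_ball_lt_top⟩

/-- Bounded measurable functions. -/
def BddMeas (g : Euc d → ℝ) : Prop := Measurable g ∧ ∃ M, ∀ y, |g y| ≤ M

lemma BddMeas.integrableOn {g : Euc d → ℝ} (hg : BddMeas g) {s : Set (Euc d)}
    (hs : volume s ≠ ⊤) : IntegrableOn g s := by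
  obtain ⟨M, hM⟩ := hg.2
  exact Measure.integrableOn_of_bounded (M := M) hs hg.1.aestronglyMeasurable
    (Filter.Eventually.of_forall hM)

lemma BddMeas.integrable_uball {g : Euc d → ℝ} (hg : BddMeas g) : IntegrableOn g (uball d) :=
  hg.integrableOn measure_ball_lt_top.ne

lemma BddMeas.abs {g : Euc d → ℝ} (hg : BddMeas g) : BddMeas fun y => |g y| :=
  ⟨hg.1.abs, hg.2.imp fun M h y => by simpa using h y⟩

lemma BddMeas.add {g h : Euc d → ℝ} (hg : BddMeas g) (hh : BddMeas h) :
    BddMeas fun y => g y + h y := by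
  obtain ⟨M, hM⟩ := hg.2
  obtain ⟨N, hN⟩ := hh.2
  exact ⟨hg.1.add hh.1, M + N, fun y => (abs_add_le _ _).trans (add_le_add (hM y) (hN y))⟩

lemma BddMeas.mul {g h : Euc d → ℝ} (hg : BddMeas g) (hh : BddMeas h) :
    BddMeas fun y => g y * h y := by
  obtain ⟨M, hM⟩ := hg.2
  obtain ⟨N, hN⟩ := hh.2
  refine ⟨hg.1.mul hh.1, M * N, fun y => ?_⟩
  rw [abs_mul]
  exact mul_le_mul (hM y) (hN y) (abs_nonneg _) ((abs_nonneg _).trans (hM y))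

lemma BddMeas.const (c : ℝ) : BddMeas fun _ : Euc d => c := ⟨measurable_const, |c|, fun _ => le_rfl⟩

lemma BddMeas.sub {g h : Euc d → ℝ} (hg : BddMeas g) (hh : BddMeas h) :
    BddMeas fun y => g y - h y := by
  have := hg.add ((BddMeas.const (-1)).mul hh)
  simpa [sub_eq_add_neg] using this

lemma BddMeas.sum {ι : Type*} {g : ι → Euc d → ℝ} (F : Finset ι)
    (hg : ∀ i ∈ F, BddMeas (g i)) : BddMeas fun y => ∑ i ∈ F, g i y := by
  classical
  induction F using Finset.induction_on with
  | empty => simpa using BddMeas.const 0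
  | insert a s ha ih =>
    simp only [Finset.sum_insert ha]
    exact (hg a (Finset.mem_insert_self _ _)).add
      (ih fun i hi => hg i (Finset.mem_insert_of_mem hi))

lemma BddMeas.indicator {g : Euc d → ℝ} (hg : BddMeas g) {s : Set (Euc d)}
    (hs : MeasurableSet s) : BddMeas (s.indicator g) := by
  obtain ⟨M, hM⟩ := hg.2
  refine ⟨hg.1.indicator hs, M, fun y => ?_⟩
  by_cases hy : y ∈ s
  · simpa [hy] using hM y
  · simpa [hy] using (abs_nonneg _).trans (hM y)

lemma measure_setOf_lt_le_of_integrableOn {g : Euc d → ℝ} (hg : IntegrableOn g (uball d))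
    (h0 : ∀ x, 0 ≤ g x) {a : ℝ} (ha : 0 < a) :
    volume {x ∈ uball d | a < g x} ≤ ENNReal.ofReal ((∫ x in uball d, g x) / a) := by
  have h := mul_meas_ge_le_integral_of_nonneg (μ := volume.restrict (uball d))
    (Filter.Eventually.of_forall h0) hg a
  have h1 : volume {x ∈ uball d | a < g x} ≤ (volume.restrict (uball d)) {x | a ≤ g x} := by
    rw [Measure.restrict_apply' measurableSet_ball]
    exact measure_mono fun x hx => ⟨hx.2.le, hx.1⟩
  refine h1.trans ?_
  rw [← ENNReal.ofReal_toReal (a := (volume.restrict (uball d)) {x | a ≤ g x})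
    (measure_ne_top _ _)]
  refine ENNReal.ofReal_le_ofReal ?_
  rw [le_div_iff₀ ha, mul_comm]
  exact h

end BddMeas

section BadFunction

variable {d : ℕ}

/-- The bad function attached to a ball has mean zero, so the operator is small away from it. -/
lemma abs_integral_bad_le {K : Euc d → Euc d → ℝ} {A : ℝ} (hA : 0 < A)
    (hK : ∀ x, BddMeas (K x))
    (hH : ∀ x ∈ uball d, ∀ y ∈ uball d, ∀ y' ∈ uball d, 2 * ‖y - y'‖ ≤ ‖x - y‖ →
      |K x y - K x y'| ≤ A * ‖y - y'‖ / ‖x - y‖ ^ (d + 1))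
    {b : Euc d} {r : ℝ} (hb : b ∈ uball d) (hr : 0 < r) (hr1 : r < 1) {φ : Euc d → ℝ}
    (hφ : BddMeas φ) (hφs : ∀ y, y ∉ closedBall b (5 * r) ∩ uball d → φ y = 0)
    {x : Euc d} (hx : x ∈ uball d) (hxb : x ∉ ball b (20 * r)) :
    |∫ y in uball d, K x y * (φ y - (∫ z in uball d, φ z) / ((r / 4) ^ d * volume.real (uball d))
        * (ball ((1 - r / 4) • b) (r / 4)).indicator (fun _ => 1) y)|
      ≤ (10 * A * 2 ^ (d + 1)) * (r * (r + ‖x - b‖) ^ (-((d : ℝ) + 1))) *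
        ∫ y in uball d, |φ y| := by
  set U := ball ((1 - r / 4) • b) (r / 4) with hU
  set v := (r / 4) ^ d * volume.real (uball d) with hv
  set c := (∫ z in uball d, φ z) / v with hc
  have hvpos : 0 < v := by have := volume_real_uball_pos (d := d); positivity
  have hUs := ball_shrink_subset hb hr hr1
  have hUv : volume.real U = v := volume_real_ball _ (by positivity)
  have h1 : BddMeas (U.indicator (fun _ => (1 : ℝ))) :=
    (BddMeas.const 1).indicator measurableSet_ball
  have hh : BddMeas fun y => φ y - c * U.indicator (fun _ => 1) y :=
    hφ.sub ((BddMeas.const c).mul h1)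
  have hU1 : ∫ y in uball d, U.indicator (fun _ => (1 : ℝ)) y = v := by
    rw [setIntegral_indicator measurableSet_ball, inter_eq_right.2 (hUs.trans inter_subset_right)]
    simpa using hUv
  have hmean : ∫ y in uball d, (φ y - c * U.indicator (fun _ => 1) y) = 0 := by
    rw [integral_sub hφ.integrable_uball ((BddMeas.const c).mul h1).integrable_uball,
      integral_const_mul, hU1, hc]
    field_simp
    simp
  have hcabs : |c| * v ≤ ∫ y in uball d, |φ y| := by
    rw [hc, abs_div, abs_of_pos hvpos, div_mul_cancel₀ _ hvpos.ne']
    exact abs_integral_le_integral_abs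
  have hL1 : ∫ y in uball d, |φ y - c * U.indicator (fun _ => 1) y| ≤
      2 * ∫ y in uball d, |φ y| := by
    calc ∫ y in uball d, |φ y - c * U.indicator (fun _ => 1) y|
        ≤ ∫ y in uball d, (|φ y| + |c| * U.indicator (fun _ => 1) y) := by
          refine integral_mono hh.abs.integrable_uball
            (hφ.abs.add ((BddMeas.const _).mul h1)).integrable_uball fun y => ?_
          refine (abs_sub _ _).trans (add_le_add le_rfl ?_)
          rw [abs_mul]
          refine mul_le_mul_of_nonneg_left ?_ (abs_nonneg _)
          by_cases hy : y ∈ U <;> simp [hy]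
      _ = (∫ y in uball d, |φ y|) + |c| * v := by
          rw [integral_add hφ.abs.integrable_uball ((BddMeas.const _).mul h1).integrable_uball,
            integral_const_mul, hU1]
      _ ≤ _ := by linarith
  have hdist : 20 * r ≤ ‖x - b‖ := by simpa [dist_eq_norm] using hxb
  have heq : ∫ y in uball d, K x y * (φ y - c * U.indicator (fun _ => 1) y) =
      ∫ y in uball d, (K x y - K x b) * (φ y - c * U.indicator (fun _ => 1) y) := by
    simp only [sub_mul (K x _)]
    rw [integral_sub ((hK x).mul hh).integrable_uball
      ((BddMeas.const (K x b)).mul hh).integrable_uball, integral_const_mul, hmean]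
    simp
  rw [heq]
  set w := A * (5 * r) / ‖x - b‖ ^ (d + 1) with hw
  have hw0 : 0 ≤ w := by positivity
  have hpt : ∀ y ∈ uball d, |(K x y - K x b) * (φ y - c * U.indicator (fun _ => 1) y)| ≤
      w * |φ y - c * U.indicator (fun _ => 1) y| := by
    intro y hy
    rw [abs_mul]
    by_cases hyb : y ∈ closedBall b (5 * r)
    · refine mul_le_mul_of_nonneg_right ?_ (abs_nonneg _)
      have hyb' : ‖b - y‖ ≤ 5 * r := by
        rw [norm_sub_rev]; simpa [dist_eq_norm] using hyb
      rw [abs_sub_comm]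
      refine (hH x hx b hb y hy (by linarith)).trans ?_
      rw [hw]
      gcongr
    · have h1 : φ y = 0 := hφs y fun h => hyb h.1
      have h2 : y ∉ U := fun h => hyb
        (closedBall_subset_closedBall (by linarith) (ball_subset_closedBall (hUs h).1))
      simp [h1, h2]
  calc |∫ y in uball d, (K x y - K x b) * (φ y - c * U.indicator (fun _ => 1) y)|
      ≤ ∫ y in uball d, |(K x y - K x b) * (φ y - c * U.indicator (fun _ => 1) y)| :=
        abs_integral_le_integral_abs
    _ ≤ ∫ y in uball d, w * |φ y - c * U.indicator (fun _ => 1) y| :=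
        setIntegral_mono_on (((hK x).sub (BddMeas.const _)).mul hh).abs.integrable_uball
          ((BddMeas.const w).mul hh.abs).integrable_uball measurableSet_ball hpt
    _ ≤ w * (2 * ∫ y in uball d, |φ y|) := by
        rw [integral_const_mul]; exact mul_le_mul_of_nonneg_left hL1 hw0
    _ ≤ _ := by
        rw [← mul_assoc]
        refine mul_le_mul_of_nonneg_right ?_ (integral_nonneg fun _ => abs_nonneg _)
        have hn : 0 < ‖x - b‖ := by linarith
        have e1 : (r + ‖x - b‖) ^ (-((d : ℝ) + 1)) = 1 / (r + ‖x - b‖) ^ (d + 1) := by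
          rw [Real.rpow_neg (by positivity), one_div]
          congr 1
          exact_mod_cast Real.rpow_natCast _ _
        rw [e1, hw]
        have e2 : (r + ‖x - b‖) ^ (d + 1) ≤ 2 ^ (d + 1) * ‖x - b‖ ^ (d + 1) := by
          rw [← mul_pow]; gcongr; linarith
        rw [div_mul_eq_mul_div, div_le_iff₀ (by positivity)]
        have e3 : 1 ≤ 2 ^ (d + 1) * ‖x - b‖ ^ (d + 1) / (r + ‖x - b‖) ^ (d + 1) := by
          rwa [one_le_div (by positivity)]
        calc A * (5 * r) * 2 = (10 * A * r) * 1 := by ring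
          _ ≤ (10 * A * r) * (2 ^ (d + 1) * ‖x - b‖ ^ (d + 1) / (r + ‖x - b‖) ^ (d + 1)) := by
              gcongr
          _ = _ := by ring

lemma integrable_tail_weight (b : Euc d) {r : ℝ} (hr : 0 < r) :
    Integrable (fun x : Euc d => r * (r + ‖x - b‖) ^ (-((d : ℝ) + 1))) :=
  ((integrable_add_norm_rpow_neg (by linarith) hr).comp_sub_right b).const_mul r

lemma integral_tail_weight_le (b : Euc d) {r : ℝ} (hr : 0 < r) :
    ∫ x in uball d, r * (r + ‖x - b‖) ^ (-((d : ℝ) + 1)) ≤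
      ∫ z : Euc d, (1 + ‖z‖) ^ (-((d : ℝ) + 1)) := by
  refine (setIntegral_le_integral (integrable_tail_weight b hr)
    (Filter.Eventually.of_forall fun x => by positivity)).trans ?_
  rw [integral_const_mul,
    integral_sub_right_eq_self (fun x : Euc d => (r + ‖x‖) ^ (-((d : ℝ) + 1))),
    integral_add_norm_rpow_neg hr]
  rw [← mul_assoc, show (d : ℝ) - (d + 1) = -1 by ring, Real.rpow_neg_one, mul_inv_cancel₀ hr.ne',
    one_mul]

end BadFunction

section WeakType

variable {d : ℕ}

lemma abs_sum_indicator_le {F : Finset (Euc d)} {U : Euc d → Set (Euc d)} {c : Euc d → ℝ} {M : ℝ}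
    (hM : 0 ≤ M) (hc : ∀ b ∈ F, |c b| ≤ M) (hU : (F : Set (Euc d)).PairwiseDisjoint U) (y : Euc d) :
    |∑ b ∈ F, c b * (U b).indicator (fun _ => (1 : ℝ)) y| ≤ M := by
  by_cases h : ∃ b ∈ F, y ∈ U b
  · obtain ⟨b, hb, hy⟩ := h
    rw [Finset.sum_eq_single_of_mem b hb]
    · simpa [hy] using hc b hb
    · intro a ha hab
      have : y ∉ U a := fun h => Set.disjoint_left.1 (hU ha hb hab) h hy
      simp [this]
  · push Not at h
    rw [Finset.sum_eq_zero]
    · simpa using hM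
    · intro a ha
      simp [h a ha]

open Classical in
/-- The piece of `f` carried by the ball of centre `b`, for a covering family `W` indexed by `F`. -/
noncomputable def czPiece (F : Finset (Euc d)) (W : Euc d → Set (Euc d)) (f : Euc d → ℝ)
    (b y : Euc d) : ℝ :=
  (W b ∩ uball d).indicator (fun y => f y / ∑ j ∈ F, (W j).indicator (fun _ => (1 : ℝ)) y) y

lemma one_le_sum_indicator {F : Finset (Euc d)} {W : Euc d → Set (Euc d)} {b y : Euc d}
    (hb : b ∈ F) (hy : y ∈ W b) : 1 ≤ ∑ j ∈ F, (W j).indicator (fun _ => (1 : ℝ)) y := by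
  have := Finset.single_le_sum (f := fun j => (W j).indicator (fun _ => (1 : ℝ)) y)
    (fun j _ => indicator_nonneg (fun _ _ => zero_le_one) y) hb
  simpa [hy] using this

lemma abs_czPiece_le {F : Finset (Euc d)} {W : Euc d → Set (Euc d)} {f : Euc d → ℝ}
    {b : Euc d} (hb : b ∈ F) (y : Euc d) : |czPiece F W f b y| ≤ |f y| := by
  unfold czPiece
  by_cases hy : y ∈ W b ∩ uball d
  · rw [indicator_of_mem hy, abs_div]
    exact div_le_self (abs_nonneg _) ((one_le_sum_indicator hb hy.1).trans (le_abs_self _))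
  · simp [hy]

lemma bddMeas_czPiece {F : Finset (Euc d)} {W : Euc d → Set (Euc d)} {f : Euc d → ℝ}
    (hW : ∀ b, MeasurableSet (W b)) (hf : BddMeas f) {b : Euc d} (hb : b ∈ F) :
    BddMeas (czPiece F W f b) := by
  obtain ⟨M, hM⟩ := hf.2
  refine ⟨?_, M, fun y => (abs_czPiece_le hb y).trans (hM y)⟩
  exact (hf.1.div (Finset.measurable_sum _ fun j _ =>
    measurable_const.indicator (hW j))).indicator ((hW b).inter measurableSet_ball)

lemma sum_czPiece_of_mem {F : Finset (Euc d)} {W : Euc d → Set (Euc d)} {f : Euc d → ℝ}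
    {y : Euc d} (hy : y ∈ uball d) (h : ∃ b ∈ F, y ∈ W b) :
    ∑ b ∈ F, czPiece F W f b y = f y := by
  obtain ⟨b, hb, hyb⟩ := h
  have h1 := one_le_sum_indicator hb hyb
  have h2 : ∀ b ∈ F, czPiece F W f b y =
      (f y / ∑ j ∈ F, (W j).indicator (fun _ => (1 : ℝ)) y) *
        (W b).indicator (fun _ => (1 : ℝ)) y := by
    intro b _
    unfold czPiece
    by_cases hyb : y ∈ W b
    · simp [hyb, hy]
    · simp [hyb]
  rw [Finset.sum_congr rfl h2, ← Finset.mul_sum, div_mul_cancel₀]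
  linarith

lemma sum_czPiece_of_notMem {F : Finset (Euc d)} {W : Euc d → Set (Euc d)} {f : Euc d → ℝ}
    {y : Euc d} (h : ∀ b ∈ F, y ∉ W b) : ∑ b ∈ F, czPiece F W f b y = 0 :=
  Finset.sum_eq_zero fun b hb => by simp [czPiece, h b hb]

lemma abs_czPiece (F : Finset (Euc d)) (W : Euc d → Set (Euc d)) (f : Euc d → ℝ) (b y : Euc d) :
    |czPiece F W f b y| = czPiece F W (fun y => |f y|) b y := by
  unfold czPiece
  by_cases hy : y ∈ W b ∩ uball d
  · rw [indicator_of_mem hy, indicator_of_mem hy, abs_div,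
      abs_of_nonneg (a := ∑ j ∈ F, (W j).indicator (fun _ => (1 : ℝ)) y)
        (Finset.sum_nonneg fun j _ => indicator_nonneg (fun _ _ => zero_le_one) y)]
  · simp [hy]

lemma sum_integral_abs_czPiece_le {F : Finset (Euc d)} {W : Euc d → Set (Euc d)} {f : Euc d → ℝ}
    (hW : ∀ b, MeasurableSet (W b)) (hf : BddMeas f) :
    ∑ b ∈ F, ∫ y in uball d, |czPiece F W f b y| ≤ ∫ y in uball d, |f y| := by
  rw [← integral_finsetSum F fun b hb => (bddMeas_czPiece hW hf hb).abs.integrable_uball]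
  refine setIntegral_mono_on
    (BddMeas.sum F fun b hb => (bddMeas_czPiece hW hf hb).abs).integrable_uball
    hf.abs.integrable_uball measurableSet_ball fun y hy => ?_
  simp only [abs_czPiece]
  by_cases h : ∃ b ∈ F, y ∈ W b
  · rw [sum_czPiece_of_mem hy h]
  · push Not at h
    rw [sum_czPiece_of_notMem h]
    exact abs_nonneg _

lemma integral_abs_czPiece_le {F : Finset (Euc d)} {W : Euc d → Set (Euc d)} {f : Euc d → ℝ}
    (hW : ∀ b, MeasurableSet (W b)) (hf : BddMeas f) {b : Euc d} (hb : b ∈ F)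
    {V : Set (Euc d)} (hV : MeasurableSet V) (hWV : W b ⊆ V) :
    ∫ y in uball d, |czPiece F W f b y| ≤ ∫ y in V ∩ uball d, |f y| := by
  rw [inter_comm, ← setIntegral_indicator hV]
  refine integral_mono (bddMeas_czPiece hW hf hb).abs.integrable_uball
    (hf.abs.indicator hV).integrable_uball fun y => ?_
  by_cases hy : y ∈ W b
  · simpa [indicator_of_mem (hWV hy)] using abs_czPiece_le hb y
  · simp only [czPiece, mem_inter_iff, hy, false_and, not_false_eq_true, indicator_of_notMem,
      abs_zero]
    exact indicator_nonneg (fun _ _ => abs_nonneg _) y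

/-- Calderón–Zygmund weak type `(1,1)` bound for kernels on the unit ball. -/
theorem weak_type_one_one [NeZero d] {A : ℝ} (hA : 0 < A) : ∃ C : ℝ, 0 < C ∧
    ∀ K : Euc d → Euc d → ℝ, Measurable (Function.uncurry K) → (∃ M, ∀ x y, |K x y| ≤ M) →
    (∀ g, BddMeas g → ∫ x in uball d, (∫ y in uball d, K x y * g y) ^ 2 ≤
      A * ∫ y in uball d, g y ^ 2) →
    (∀ x ∈ uball d, ∀ y ∈ uball d, ∀ y' ∈ uball d, 2 * ‖y - y'‖ ≤ ‖x - y‖ →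
      |K x y - K x y'| ≤ A * ‖y - y'‖ / ‖x - y‖ ^ (d + 1)) →
    ∀ f, BddMeas f → ContinuousOn f (uball d) → ∀ α, 0 < α →
      volume {x ∈ uball d | α < |∫ y in uball d, K x y * f y|} ≤
        ENNReal.ofReal (C / α * ∫ y in uball d, |f y|) := by
  set ω := volume.real (uball d) with hω
  have hω0 : 0 < ω := volume_real_uball_pos
  set Ct := ∫ z : Euc d, (1 + ‖z‖) ^ (-((d : ℝ) + 1)) with hCt
  have hCt0 : 0 ≤ Ct := integral_one_add_norm_rpow_neg_nonneg _
  set C1 := 18 * A * (1 + 40 ^ d) / ω with hC1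
  set C2 := 20 ^ d * ω with hC2
  set C3 := 3 * (10 * A * 2 ^ (d + 1)) * Ct with hC3
  have hC10 : 0 ≤ C1 := by positivity
  have hC20 : 0 ≤ C2 := by positivity
  have hC30 : 0 ≤ C3 := by positivity
  refine ⟨C1 + C2 + C3 + ω, by positivity, ?_⟩
  intro K hKm ⟨Mk, hMk⟩ hL2 hH f hf hfc α hα
  set I := ∫ y in uball d, |f y| with hI
  have hI0 : 0 ≤ I := integral_nonneg fun _ => abs_nonneg _
  have hK : ∀ x, BddMeas (K x) := fun x =>
    ⟨hKm.comp measurable_prodMk_left, Mk, hMk x⟩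
  have hMk0 : 0 ≤ Mk := (abs_nonneg _).trans (hMk 0 0)
  obtain ⟨Mf, hMf⟩ := hf.2
  have hMf0 : 0 ≤ Mf := (abs_nonneg _).trans (hMf 0)
  by_cases hIα : α ≤ I
  · calc volume {x ∈ uball d | α < |∫ y in uball d, K x y * f y|} ≤ volume (uball d) :=
          measure_mono fun x hx => hx.1
      _ = ENNReal.ofReal ω := (ENNReal.ofReal_toReal measure_ball_lt_top.ne).symm
      _ ≤ _ := by
          refine ENNReal.ofReal_le_ofReal ?_
          rw [div_mul_eq_mul_div, le_div_iff₀ hα]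
          nlinarith [mul_nonneg hC10 hI0, mul_nonneg hC20 hI0, mul_nonneg hC30 hI0]
  push Not at hIα
  set η := α / (3 * (Mk * Mf + 1)) with hη
  have hη0 : 0 < η := by positivity
  obtain ⟨F, r, L, hF, hdisj, hLm, hLv, hgood⟩ :=
    exists_selection hη0 hα hf.integrable_uball hfc hIα
  have hr0 : ∀ b ∈ F, 0 < r b := fun b hb => (hF b hb).2.1.1
  have hr1 : ∀ b ∈ F, r b < 1 := fun b hb => (hF b hb).2.1.lt_one hf.integrable_uball hIα
  set W : Euc d → Set (Euc d) := fun b => closedBall b (5 * r b) with hW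
  have hWm : ∀ b, MeasurableSet (W b) := fun b => isClosed_closedBall.measurableSet
  set U : Euc d → Set (Euc d) := fun b => ball ((1 - r b / 4) • b) (r b / 4) with hU
  have hUm : ∀ b, MeasurableSet (U b) := fun b => measurableSet_ball
  have hUs : ∀ b ∈ F, U b ⊆ ball b (r b) ∩ uball d := fun b hb =>
    ball_shrink_subset (hF b hb).1 (hr0 b hb) (hr1 b hb)
  have hUdisj : (F : Set (Euc d)).PairwiseDisjoint U := fun a ha b hb hab =>
    (hdisj ha hb hab).mono ((hUs a ha).trans inter_subset_left)
      ((hUs b hb).trans inter_subset_left)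
  set v : Euc d → ℝ := fun b => (r b / 4) ^ d * ω with hv
  have hv0 : ∀ b ∈ F, 0 < v b := fun b hb => by have := hr0 b hb; positivity
  set φ : Euc d → Euc d → ℝ := czPiece F W f with hφ
  have hφm : ∀ b ∈ F, BddMeas (φ b) := fun b hb => bddMeas_czPiece hWm hf hb
  set c : Euc d → ℝ := fun b => (∫ z in uball d, φ b z) / v b with hc
  have hcv : ∀ b ∈ F, |c b| * v b ≤ ∫ y in uball d, |φ b y| := by
    intro b hb
    rw [hc]; simp only
    rw [abs_div, abs_of_pos (hv0 b hb), div_mul_cancel₀ _ (hv0 b hb).ne']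
    exact abs_integral_le_integral_abs
  have hcb : ∀ b ∈ F, |c b| ≤ 40 ^ d * α / ω := by
    intro b hb
    have hrb := hr0 b hb
    have h1 : ∫ y in uball d, |φ b y| ≤ α * (10 * r b) ^ d := by
      refine (integral_abs_czPiece_le hWm hf hb (V := ball b (10 * r b)) measurableSet_ball
        (closedBall_subset_ball (by linarith))).trans ?_
      have h := (hF b hb).2.2
      unfold badRadius at h
      push Not at h
      exact h (by positivity)
    have h2 := (hcv b hb).trans h1
    rw [le_div_iff₀ hω0]
    have h3 : (10 * r b) ^ d = 40 ^ d * (r b / 4) ^ d := by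
      rw [← mul_pow]; congr 1; ring
    have h4 : 0 < (r b / 4) ^ d := by positivity
    rw [h3] at h2
    refine le_of_mul_le_mul_right ?_ h4
    calc |c b| * ω * (r b / 4) ^ d = |c b| * v b := by rw [hv]; ring
      _ ≤ _ := h2
      _ = _ := by ring
  set S : Set (Euc d) := L ∪ ⋃ b ∈ F, W b with hS
  have hSm : MeasurableSet S := hLm.union (F.measurableSet_biUnion fun b _ => hWm b)
  set f0 : Euc d → ℝ := (uball d \ S).indicator f with hf0
  set f1 : Euc d → ℝ := (L \ ⋃ b ∈ F, W b).indicator f with hf1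
  set f2 : Euc d → ℝ := fun y => ∑ b ∈ F, c b * (U b).indicator (fun _ => (1 : ℝ)) y with hf2
  have hf0m : BddMeas f0 := hf.indicator (measurableSet_ball.diff hSm)
  have hf1m : BddMeas f1 := hf.indicator (hLm.diff (F.measurableSet_biUnion fun b _ => hWm b))
  have hUi : ∀ b, BddMeas ((U b).indicator (fun _ => (1 : ℝ))) := fun b =>
    (BddMeas.const 1).indicator (hUm b)
  have hf2m : BddMeas f2 := BddMeas.sum F fun b _ => (BddMeas.const _).mul (hUi b)
  set g : Euc d → ℝ := fun y => f0 y + f2 y with hg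
  have hgm : BddMeas g := hf0m.add hf2m
  set G := (1 + 40 ^ d) * α / ω with hG
  have hgb : ∀ y, |g y| ≤ G := by
    intro y
    have h1 : |f0 y| ≤ α / ω := by
      by_cases hy : y ∈ (uball d) \ S
      · rw [hf0, indicator_of_mem hy]
        refine hgood y hy.1 (fun h => hy.2 (Or.inl h)) fun b hb h => hy.2 (Or.inr ?_)
        exact mem_iUnion₂.2 ⟨b, hb, h⟩
      · rw [hf0, indicator_of_notMem hy, abs_zero]; positivity
    have h2 : |f2 y| ≤ 40 ^ d * α / ω := abs_sum_indicator_le (by positivity) hcb hUdisj y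
    calc |g y| ≤ |f0 y| + |f2 y| := abs_add_le _ _
      _ ≤ α / ω + 40 ^ d * α / ω := add_le_add h1 h2
      _ = G := by rw [hG]; ring
  have hG0 : 0 ≤ G := by positivity
  have hsumφ : ∑ b ∈ F, ∫ y in (uball d), |φ b y| ≤ I := sum_integral_abs_czPiece_le hWm hf
  have hUint : ∀ b ∈ F, ∫ y in (uball d), (U b).indicator (fun _ => (1 : ℝ)) y = v b := by
    intro b hb
    have h := volume_real_ball (d := d) ((1 - r b / 4) • b) (r := r b / 4)
      (by have := hr0 b hb; positivity)
    rw [setIntegral_indicator (hUm b), inter_eq_right.2 ((hUs b hb).trans inter_subset_right)]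
    simpa using h
  have hg1 : ∫ y in (uball d), |g y| ≤ 2 * I := by
    have h1 : ∫ y in (uball d), |f0 y| ≤ I := by
      refine integral_mono hf0m.abs.integrable_uball hf.abs.integrable_uball fun y => ?_
      by_cases hy : y ∈ (uball d) \ S
      · simp [hf0, indicator_of_mem hy]
      · simp [hf0, indicator_of_notMem hy]
    have h2 : ∫ y in (uball d), |f2 y| ≤ I := by
      calc ∫ y in (uball d), |f2 y|
          ≤ ∫ y in (uball d), ∑ b ∈ F, |c b| * (U b).indicator (fun _ => (1 : ℝ)) y := by
            refine integral_mono hf2m.abs.integrable_uball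
              (BddMeas.sum F fun b _ => (BddMeas.const _).mul (hUi b)).integrable_uball
              fun y => ?_
            refine (Finset.abs_sum_le_sum_abs _ _).trans (Finset.sum_le_sum fun b _ => ?_)
            rw [abs_mul, abs_of_nonneg (indicator_nonneg (fun _ _ => zero_le_one) y)]
        _ = ∑ b ∈ F, |c b| * v b := by
            rw [integral_finsetSum F fun b _ =>
              ((BddMeas.const _).mul (hUi b)).integrable_uball]
            refine Finset.sum_congr rfl fun b hb => ?_
            rw [integral_const_mul, hUint b hb]
        _ ≤ ∑ b ∈ F, ∫ y in (uball d), |φ b y| := Finset.sum_le_sum hcv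
        _ ≤ I := hsumφ
    calc ∫ y in (uball d), |g y| ≤ ∫ y in (uball d), (|f0 y| + |f2 y|) :=
          integral_mono hgm.abs.integrable_uball (hf0m.abs.add hf2m.abs).integrable_uball
            fun y => abs_add_le _ _
      _ = (∫ y in (uball d), |f0 y|) + ∫ y in (uball d), |f2 y| :=
          integral_add hf0m.abs.integrable_uball hf2m.abs.integrable_uball
      _ ≤ 2 * I := by linarith
  have hg2 : ∫ y in (uball d), g y ^ 2 ≤ G * (2 * I) := by
    calc ∫ y in (uball d), g y ^ 2 ≤ ∫ y in (uball d), G * |g y| := by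
          refine integral_mono
            (by simpa only [sq, IntegrableOn] using (hgm.mul hgm).integrable_uball)
            ((BddMeas.const G).mul hgm.abs).integrable_uball fun y => ?_
          simp only
          rw [← sq_abs, sq]
          exact mul_le_mul_of_nonneg_right (hgb y) (abs_nonneg _)
      _ = G * ∫ y in (uball d), |g y| := integral_const_mul _ _
      _ ≤ _ := mul_le_mul_of_nonneg_left hg1 hG0
  set h : Euc d → Euc d → ℝ := fun b y => φ b y - c b * (U b).indicator (fun _ => (1 : ℝ)) y
    with hh
  have hhm : ∀ b ∈ F, BddMeas (h b) := fun b hb => (hφm b hb).sub ((BddMeas.const _).mul (hUi b))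
  have hdec : ∀ y ∈ (uball d), f y = g y + f1 y + ∑ b ∈ F, h b y := by
    intro y hy
    simp only [hh, Finset.sum_sub_distrib, hg]
    change f y = f0 y + f2 y + f1 y + (∑ b ∈ F, φ b y - f2 y)
    by_cases hyW : y ∈ ⋃ b ∈ F, W b
    · have hyS : y ∉ (uball d) \ S := fun h => h.2 (Or.inr hyW)
      have hyL : y ∉ L \ ⋃ b ∈ F, W b := fun h => h.2 hyW
      have : ∑ b ∈ F, φ b y = f y := sum_czPiece_of_mem hy (by simpa using hyW)
      rw [this, hf0, hf1, indicator_of_notMem hyS, indicator_of_notMem hyL]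
      ring
    · have : ∑ b ∈ F, φ b y = 0 := sum_czPiece_of_notMem (by simpa using hyW)
      rw [this, hf0, hf1]
      by_cases hyL : y ∈ L
      · rw [indicator_of_notMem (show y ∉ uball d \ S from fun h => h.2 (Or.inl hyL)),
          indicator_of_mem (show y ∈ L \ ⋃ b ∈ F, W b from ⟨hyL, hyW⟩)]
        ring
      · rw [indicator_of_mem (show y ∈ uball d \ S from ⟨hy, fun h => h.elim hyL hyW⟩),
          indicator_of_notMem (show y ∉ L \ ⋃ b ∈ F, W b from fun h => hyL h.1)]
        ring
  have hT : ∀ x, ∫ y in (uball d), K x y * f y = (∫ y in (uball d), K x y * g y) +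
      (∫ y in (uball d), K x y * f1 y) + ∑ b ∈ F, ∫ y in (uball d), K x y * h b y := by
    intro x
    rw [← integral_finsetSum F fun b hb => ((hK x).mul (hhm b hb)).integrable_uball,
      ← integral_add ((hK x).mul hgm).integrable_uball ((hK x).mul hf1m).integrable_uball,
      ← integral_add (((hK x).mul hgm).add ((hK x).mul hf1m)).integrable_uball
        (BddMeas.sum F fun b hb => (hK x).mul (hhm b hb)).integrable_uball]
    refine setIntegral_congr_fun measurableSet_ball fun y hy => ?_
    change K x y * f y = K x y * g y + K x y * f1 y + ∑ b ∈ F, K x y * h b y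
    rw [hdec y hy, mul_add, mul_add, Finset.mul_sum]
  have hT1 : ∀ x, |∫ y in (uball d), K x y * f1 y| ≤ α / 3 := by
    intro x
    have h1 : ∫ y in (uball d), |K x y * f1 y| ≤
        ∫ y in (uball d), L.indicator (fun _ => Mk * Mf) y := by
      refine integral_mono ((hK x).mul hf1m).abs.integrable_uball
        ((BddMeas.const _).indicator hLm).integrable_uball fun y => ?_
      by_cases hy : y ∈ L
      · rw [indicator_of_mem hy, abs_mul]
        refine mul_le_mul (hMk x y) ?_ (abs_nonneg _) hMk0
        by_cases hy2 : y ∈ L \ ⋃ b ∈ F, W b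
        · rw [hf1, indicator_of_mem hy2]; exact hMf y
        · rw [hf1, indicator_of_notMem hy2, abs_zero]; exact hMf0
      · have : y ∉ L \ ⋃ b ∈ F, W b := fun h => hy h.1
        simp [hf1, this, hy]
    have h2 : ∫ y in (uball d), L.indicator (fun _ => Mk * Mf) y ≤ Mk * Mf * η := by
      rw [setIntegral_indicator hLm, setIntegral_const, smul_eq_mul, mul_comm]
      refine mul_le_mul_of_nonneg_left ?_ (by positivity)
      refine ENNReal.toReal_le_of_le_ofReal hη0.le ?_
      exact (measure_mono inter_subset_right).trans hLv
    refine abs_integral_le_integral_abs.trans (h1.trans (h2.trans ?_))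
    rw [hη]
    rw [mul_div_assoc', div_le_div_iff₀ (by positivity) (by norm_num)]
    nlinarith [mul_nonneg hMk0 hMf0]
  set Z : Euc d → ℝ := fun x => ∑ b ∈ F, (10 * A * 2 ^ (d + 1)) *
    (r b * (r b + ‖x - b‖) ^ (-((d : ℝ) + 1))) * ∫ y in (uball d), |φ b y| with hZ
  set S1 : Set (Euc d) :=
    {x ∈ (uball d) | (α / 3) ^ 2 < (∫ y in (uball d), K x y * g y) ^ 2} with hS1
  set S2 : Set (Euc d) := ⋃ b ∈ F, ball b (20 * r b) with hS2
  set S3 : Set (Euc d) := {x ∈ (uball d) | α / 3 < Z x} with hS3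
  have hsub : {x ∈ (uball d) | α < |∫ y in (uball d), K x y * f y|} ⊆ S1 ∪ S2 ∪ S3 := by
    rintro x ⟨hxB, hx⟩
    by_contra hcon
    simp only [mem_union, not_or] at hcon
    obtain ⟨⟨hx1, hx2⟩, hx3⟩ := hcon
    have h1 : |∫ y in (uball d), K x y * g y| ≤ α / 3 := by
      have : (∫ y in (uball d), K x y * g y) ^ 2 ≤ (α / 3) ^ 2 := by
        by_contra hh; exact hx1 ⟨hxB, not_le.1 hh⟩
      exact abs_le_of_sq_le_sq this (by positivity)
    have h3 : |∑ b ∈ F, ∫ y in (uball d), K x y * h b y| ≤ α / 3 := by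
      have hZx : Z x ≤ α / 3 := by
        by_contra hh; exact hx3 ⟨hxB, not_le.1 hh⟩
      refine le_trans ?_ hZx
      refine (Finset.abs_sum_le_sum_abs _ _).trans (Finset.sum_le_sum fun b hb => ?_)
      refine abs_integral_bad_le hA hK hH (hF b hb).1 (hr0 b hb) (hr1 b hb) (hφm b hb) ?_ hxB ?_
      · intro y hy
        simp only [hφ, czPiece]
        exact indicator_of_notMem hy _
      · intro hxb
        exact hx2 (mem_iUnion₂.2 ⟨b, hb, hxb⟩)
    have h2 := hT1 x
    rw [hT x] at hx
    have := abs_add_three (∫ y in (uball d), K x y * g y) (∫ y in (uball d), K x y * f1 y)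
      (∑ b ∈ F, ∫ y in (uball d), K x y * h b y)
    linarith
  have hTgm : BddMeas fun x => ∫ y in (uball d), K x y * g y := by
    obtain ⟨Mg, hMg⟩ := hgm.2
    refine ⟨?_, Mk * Mg * ω, fun x => ?_⟩
    · have : Measurable (Function.uncurry fun x y => K x y * g y) :=
        hKm.mul (hgm.1.comp measurable_snd)
      exact this.stronglyMeasurable.integral_prod_right.measurable
    · have := norm_setIntegral_le_of_norm_le_const (μ := volume) (s := (uball d))
        (f := fun y => K x y * g y) (C := Mk * Mg) measure_ball_lt_top
        (fun y _ => by
          rw [Real.norm_eq_abs, abs_mul]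
          exact mul_le_mul (hMk x y) (hMg y) (abs_nonneg _) hMk0)
      simpa using this
  have hm1 : volume S1 ≤ ENNReal.ofReal (C1 / α * I) := by
    refine (measure_setOf_lt_le_of_integrableOn
      (by simpa only [sq] using (hTgm.mul hTgm).integrable_uball)
      (fun x => sq_nonneg _) (by positivity)).trans (ENNReal.ofReal_le_ofReal ?_)
    rw [div_le_iff₀ (by positivity)]
    calc ∫ x in (uball d), (∫ y in (uball d), K x y * g y) ^ 2
        ≤ A * ∫ y in (uball d), g y ^ 2 := hL2 g hgm
      _ ≤ A * (G * (2 * I)) := mul_le_mul_of_nonneg_left hg2 hA.le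
      _ = _ := by rw [hC1, hG]; field_simp; ring
  have hm2 : volume S2 ≤ ENNReal.ofReal (C2 / α * I) := by
    have hvb : ∀ b ∈ F, volume (ball b (20 * r b)) = ENNReal.ofReal ((C2 / α) * (α * r b ^ d)) := by
      intro b hb
      have hrb := hr0 b hb
      rw [← ENNReal.ofReal_toReal (a := volume (ball b (20 * r b))) measure_ball_lt_top.ne]
      congr 1
      change volume.real _ = _
      rw [volume_real_ball b (by positivity), hC2]
      field_simp
      ring
    refine (measure_biUnion_finset_le F _).trans ?_
    rw [Finset.sum_congr rfl hvb, ← ENNReal.ofReal_sum_of_nonneg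
      (fun b hb => by have := hr0 b hb; positivity), ← Finset.mul_sum]
    refine ENNReal.ofReal_le_ofReal (mul_le_mul_of_nonneg_left ?_ (by positivity))
    exact sum_bad_le F hf.integrable_uball (fun b hb => (hF b hb).2.1) hdisj
  have hZi : ∀ b ∈ F, IntegrableOn (fun x => (10 * A * 2 ^ (d + 1)) *
      (r b * (r b + ‖x - b‖) ^ (-((d : ℝ) + 1))) *
        ∫ y in (uball d), |φ b y|) (uball d) := fun b hb =>
    (((integrable_tail_weight b (hr0 b hb)).integrableOn).const_mul _).mul_const _
  have hm3 : volume S3 ≤ ENNReal.ofReal (C3 / α * I) := by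
    have hφ0 : ∀ b, 0 ≤ ∫ y in (uball d), |φ b y| := fun b => integral_nonneg fun _ => abs_nonneg _
    refine (measure_setOf_lt_le_of_integrableOn (integrable_finsetSum F hZi)
      (fun x => Finset.sum_nonneg fun b hb => ?_) (by positivity)).trans
      (ENNReal.ofReal_le_ofReal ?_)
    · have := hr0 b hb
      have := hφ0 b
      positivity
    rw [div_le_iff₀ (by positivity), integral_finsetSum F hZi]
    calc ∑ b ∈ F, ∫ x in (uball d), (10 * A * 2 ^ (d + 1)) *
          (r b * (r b + ‖x - b‖) ^ (-((d : ℝ) + 1))) * ∫ y in (uball d), |φ b y|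
        ≤ ∑ b ∈ F, (10 * A * 2 ^ (d + 1)) * Ct * ∫ y in (uball d), |φ b y| := by
          refine Finset.sum_le_sum fun b hb => ?_
          rw [integral_mul_const, integral_const_mul]
          refine mul_le_mul_of_nonneg_right ?_ (hφ0 b)
          exact mul_le_mul_of_nonneg_left (integral_tail_weight_le b (hr0 b hb)) (by positivity)
      _ = (10 * A * 2 ^ (d + 1)) * Ct * ∑ b ∈ F, ∫ y in (uball d), |φ b y| := by rw [Finset.mul_sum]
      _ ≤ (10 * A * 2 ^ (d + 1)) * Ct * I := mul_le_mul_of_nonneg_left hsumφ (by positivity)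
      _ = _ := by rw [hC3]; field_simp
  calc volume {x ∈ (uball d) | α < |∫ y in (uball d), K x y * f y|} ≤ volume (S1 ∪ S2 ∪ S3) :=
        measure_mono hsub
    _ ≤ volume S1 + volume S2 + volume S3 :=
        (measure_union_le _ _).trans (add_le_add (measure_union_le _ _) le_rfl)
    _ ≤ ENNReal.ofReal (C1 / α * I) + ENNReal.ofReal (C2 / α * I) + ENNReal.ofReal (C3 / α * I) :=
        add_le_add (add_le_add hm1 hm2) hm3
    _ = ENNReal.ofReal (C1 / α * I + C2 / α * I + C3 / α * I) := by
        rw [← ENNReal.ofReal_add (by positivity) (by positivity),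
          ← ENNReal.ofReal_add (by positivity) (by positivity)]
    _ ≤ _ := by
        refine ENNReal.ofReal_le_ofReal ?_
        have : 0 ≤ ω / α * I := by positivity
        have e : (C1 + C2 + C3 + ω) / α * I =
          C1 / α * I + C2 / α * I + C3 / α * I + ω / α * I := by ring
        linarith

end WeakType

section Cutoff

open Filter Topology

variable {d : ℕ}

/-- The defining function `1 - |y|²` of the unit ball. -/
noncomputable def bdryQ (y : Euc d) : ℝ := 1 - ‖y‖ ^ 2

lemma bdryQ_pos {y : Euc d} (hy : y ∈ uball d) : 0 < bdryQ y := by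
  have : ‖y‖ < 1 := by simpa using hy
  unfold bdryQ
  nlinarith [norm_nonneg y]

lemma bdryQ_le_one (y : Euc d) : bdryQ y ≤ 1 := by
  unfold bdryQ; nlinarith [sq_nonneg ‖y‖]

lemma contDiff_bdryQ {n : WithTop ℕ∞} : ContDiff ℝ n (bdryQ : Euc d → ℝ) :=
  contDiff_const.sub (contDiff_norm_sq ℝ)

lemma continuous_bdryQ : Continuous (bdryQ : Euc d → ℝ) := contDiff_bdryQ (n := 0).continuous

lemma hasFDerivAt_bdryQ (y : Euc d) :
    HasFDerivAt bdryQ (-(2 • (innerSL ℝ y))) y := by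
  have := (hasStrictFDerivAt_norm_sq (F := Euc d) y).hasFDerivAt.const_sub 1
  exact this

lemma exists_smoothTransition_deriv_bound : ∃ C : ℝ, 0 ≤ C ∧
    (∀ t, |deriv Real.smoothTransition t| ≤ C) := by
  have hc : Continuous (deriv Real.smoothTransition) :=
    (Real.smoothTransition.contDiff (n := 1)).continuous_deriv le_rfl
  obtain ⟨C, hC⟩ := (isCompact_Icc (a := (0 : ℝ)) (b := 1)).exists_bound_of_continuousOn
    hc.continuousOn
  refine ⟨C, (norm_nonneg _).trans (hC 0 (by simp)), fun t => ?_⟩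
  have hC0 : 0 ≤ C := (norm_nonneg _).trans (hC 0 (by simp))
  rcases lt_or_ge t 0 with h | h
  · have : Real.smoothTransition =ᶠ[𝓝 t] fun _ => 0 := by
      filter_upwards [gt_mem_nhds h] with s hs
      exact Real.smoothTransition.zero_of_nonpos hs.le
    rw [this.deriv_eq]; simpa using hC0
  rcases lt_or_ge 1 t with h1 | h1
  · have : Real.smoothTransition =ᶠ[𝓝 t] fun _ => 1 := by
      filter_upwards [lt_mem_nhds h1] with s hs
      exact Real.smoothTransition.one_of_one_le hs.le
    rw [this.deriv_eq]; simpa using hC0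
  · exact hC t ⟨h, h1⟩

lemma deriv_smoothTransition_of_one_lt {t : ℝ} (h1 : 1 < t) :
    deriv Real.smoothTransition t = 0 := by
  have : Real.smoothTransition =ᶠ[𝓝 t] fun _ => 1 := by
    filter_upwards [lt_mem_nhds h1] with s hs
    exact Real.smoothTransition.one_of_one_le hs.le
  rw [this.deriv_eq]; simp

/-- Smooth cutoff functions exhausting the unit ball. -/
noncomputable def bdryCutoff (n : ℕ) (y : Euc d) : ℝ := Real.smoothTransition (n * bdryQ y - 1)

lemma contDiff_bdryCutoff (n : ℕ) {k : ℕ∞} : ContDiff ℝ k (bdryCutoff n : Euc d → ℝ) :=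
  Real.smoothTransition.contDiff.comp ((contDiff_const.mul contDiff_bdryQ).sub contDiff_const)

lemma bdryCutoff_mem_Icc (n : ℕ) (y : Euc d) : bdryCutoff n y ∈ Icc (0 : ℝ) 1 :=
  ⟨Real.smoothTransition.nonneg _, Real.smoothTransition.le_one _⟩

lemma fderiv_bdryCutoff_apply (n : ℕ) (y v : Euc d) : fderiv ℝ (bdryCutoff n) y v =
    deriv Real.smoothTransition (n * bdryQ y - 1) * (n * (-2 * inner ℝ y v)) := by
  have h1 : HasDerivAt Real.smoothTransition (deriv Real.smoothTransition (n * bdryQ y - 1))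
      (n * bdryQ y - 1) :=
    ((Real.smoothTransition.contDiff (n := 1)).differentiable one_ne_zero _).hasDerivAt
  have h2 := ((hasFDerivAt_bdryQ y).const_mul (n : ℝ)).sub_const 1
  have h3 := h1.comp_hasFDerivAt y h2
  have h4 : HasFDerivAt (bdryCutoff n) _ y := h3
  rw [h4.fderiv]
  simp

lemma eventually_bdryQ_mul_gt {y : Euc d} (hy : y ∈ uball d) :
    ∀ᶠ n : ℕ in atTop, 1 < n * bdryQ y - 1 := by
  have h : Tendsto (fun n : ℕ => (n : ℝ) * bdryQ y) atTop atTop :=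
    tendsto_natCast_atTop_atTop.atTop_mul_const (bdryQ_pos hy)
  filter_upwards [h.eventually_gt_atTop 2] with n hn
  linarith

lemma exists_fderiv_bdryCutoff_bound : ∃ C : ℝ, 0 ≤ C ∧ ∀ (n : ℕ) (y v : Euc d), y ∈ uball d →
    bdryQ y * |fderiv ℝ (bdryCutoff n) y v| ≤ C * ‖v‖ := by
  obtain ⟨C, hC0, hC⟩ := exists_smoothTransition_deriv_bound
  refine ⟨4 * C, by positivity, fun n y v hy => ?_⟩
  rw [fderiv_bdryCutoff_apply]
  by_cases h : 1 < n * bdryQ y - 1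
  · rw [deriv_smoothTransition_of_one_lt h]
    simp only [zero_mul, abs_zero, mul_zero]; positivity
  · push Not at h
    have hq := bdryQ_pos hy
    have hin : |inner ℝ y v| ≤ ‖v‖ := by
      have : ‖y‖ ≤ 1 := by simpa using (ball_subset_closedBall hy)
      calc |inner ℝ y v| ≤ ‖y‖ * ‖v‖ := abs_real_inner_le_norm _ _
        _ ≤ 1 * ‖v‖ := by gcongr
        _ = ‖v‖ := one_mul _
    rw [abs_mul, abs_mul, abs_mul, Nat.abs_cast]
    have e : |(-2 : ℝ)| = 2 := by norm_num
    rw [e]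
    have h2 : n * bdryQ y ≤ 2 := by linarith
    calc bdryQ y * (|deriv Real.smoothTransition (n * bdryQ y - 1)| * (n * (2 * |inner ℝ y v|)))
        = |deriv Real.smoothTransition (n * bdryQ y - 1)| * ((n * bdryQ y) * (2 * |inner ℝ y v|)) :=
          by ring
      _ ≤ C * (2 * (2 * ‖v‖)) := by
          gcongr
          exact hC _
      _ = _ := by ring

lemma bdryCutoff_eq_zero {n : ℕ} {y : Euc d} (h : n * bdryQ y ≤ 1) : bdryCutoff n y = 0 :=
  Real.smoothTransition.zero_of_nonpos (by linarith)

lemma tsupport_bdryCutoff_mul_subset (n : ℕ) (w : Euc d → ℝ) :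
    tsupport (fun y => bdryCutoff n y * w y) ⊆ {y | 1 ≤ n * bdryQ y} := by
  refine closure_minimal (fun y hy => ?_)
    (isClosed_le continuous_const (continuous_const.mul continuous_bdryQ))
  by_contra h
  simp only [mem_ofPred_eq, not_le] at h
  exact hy (by simp [bdryCutoff_eq_zero h.le])

lemma setOf_one_le_mul_bdryQ_subset (n : ℕ) : {y : Euc d | 1 ≤ n * bdryQ y} ⊆ uball d := by
  intro y hy
  have hy' : 1 ≤ n * bdryQ y := hy
  have h0 : 0 < bdryQ y := by
    by_contra h
    have : n * bdryQ y ≤ 0 := mul_nonpos_of_nonneg_of_nonpos (Nat.cast_nonneg n) (not_lt.1 h)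
    linarith
  unfold bdryQ at h0
  rw [mem_ball_zero_iff]
  nlinarith [norm_nonneg y]

lemma hasCompactSupport_bdryCutoff_mul (n : ℕ) (w : Euc d → ℝ) :
    HasCompactSupport (fun y => bdryCutoff n y * w y) := by
  refine HasCompactSupport.of_support_subset_isCompact (isCompact_closedBall (0 : Euc d) 1) ?_
  exact (subset_tsupport _).trans ((tsupport_bdryCutoff_mul_subset n w).trans
    ((setOf_one_le_mul_bdryQ_subset n).trans ball_subset_closedBall))

lemma contDiff_bdryCutoff_mul (n : ℕ) {k : ℕ∞} {w : Euc d → ℝ} (hw : ContDiffOn ℝ k w (uball d)) :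
    ContDiff ℝ k (fun y => bdryCutoff n y * w y) := by
  refine contDiff_iff_contDiffAt.2 fun y => ?_
  by_cases hy : y ∈ uball d
  · exact (contDiff_bdryCutoff n).contDiffAt.mul (hw.contDiffAt (isOpen_ball.mem_nhds hy))
  · have hy2 : y ∉ tsupport (fun y => bdryCutoff n y * w y) := fun h =>
      hy (setOf_one_le_mul_bdryQ_subset n (tsupport_bdryCutoff_mul_subset n w h))
    exact contDiffAt_const.congr_of_eventuallyEq (notMem_tsupport_iff_eventuallyEq.1 hy2)

lemma uniqueDiffOn_closedBall_one : UniqueDiffOn ℝ (closedBall (0 : Euc d) 1) :=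
  uniqueDiffOn_convex (convex_closedBall _ _)
    ⟨0, ball_subset_interior_closedBall (mem_ball_self one_pos)⟩

lemma ContDiffOn.differentiableAt_uball {w : Euc d → ℝ} (hw : ContDiffOn ℝ 1 w (closedBall 0 1))
    {y : Euc d} (hy : y ∈ uball d) : DifferentiableAt ℝ w y :=
  (hw.differentiableOn one_ne_zero).differentiableAt
    (Filter.mem_of_superset (isOpen_ball.mem_nhds hy) ball_subset_closedBall)

lemma fderivWithin_closedBall_eq {w : Euc d → ℝ} {y : Euc d} (hy : y ∈ uball d) :
    fderivWithin ℝ w (closedBall 0 1) y = fderiv ℝ w y :=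
  fderivWithin_of_mem_nhds
    (Filter.mem_of_superset (isOpen_ball.mem_nhds hy) ball_subset_closedBall)

lemma ContDiffOn.exists_fderivWithin_bound {w : Euc d → ℝ}
    (hw : ContDiffOn ℝ 1 w (closedBall 0 1)) :
    ∃ M, 0 ≤ M ∧ ∀ y ∈ closedBall (0 : Euc d) 1, ‖fderivWithin ℝ w (closedBall 0 1) y‖ ≤ M := by
  have hc := hw.continuousOn_fderivWithin uniqueDiffOn_closedBall_one le_rfl
  obtain ⟨M, hM⟩ := (isCompact_closedBall (0 : Euc d) 1).exists_bound_of_continuousOn hc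
  exact ⟨M, (norm_nonneg _).trans (hM 0 (by simp)), hM⟩

lemma ContDiffOn.exists_fderiv_bound {w : Euc d → ℝ} (hw : ContDiffOn ℝ 1 w (closedBall 0 1)) :
    ∃ M, 0 ≤ M ∧ ∀ y ∈ uball d, ‖fderiv ℝ w y‖ ≤ M := by
  obtain ⟨M, h0, hM⟩ := hw.exists_fderivWithin_bound
  refine ⟨M, h0, fun y hy => ?_⟩
  rw [← fderivWithin_closedBall_eq hy]
  exact hM y (ball_subset_closedBall hy)

lemma ContDiffOn.continuousOn_fderiv_uball {w : Euc d → ℝ}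
    (hw : ContDiffOn ℝ 1 w (closedBall 0 1)) : ContinuousOn (fderiv ℝ w) (uball d) :=
  ((hw.continuousOn_fderivWithin uniqueDiffOn_closedBall_one le_rfl).mono
    ball_subset_closedBall).congr fun _ hy => (fderivWithin_closedBall_eq hy).symm

lemma ContDiffOn.integrableOn_uball {w : Euc d → ℝ} (hw : ContDiffOn ℝ 1 w (closedBall 0 1)) :
    IntegrableOn w (uball d) :=
  (hw.continuousOn.integrableOn_compact (isCompact_closedBall _ _)).mono_set ball_subset_closedBall

/-- Functions which are `C¹` on the closed unit ball and vanish on the unit sphere. -/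
def C1Zero (w : Euc d → ℝ) : Prop :=
  ContDiffOn ℝ 1 w (closedBall 0 1) ∧ ∀ x ∈ sphere (0 : Euc d) 1, w x = 0

lemma C1Zero.exists_bound [NeZero d] {w : Euc d → ℝ} (hw : C1Zero w) :
    ∃ M, 0 ≤ M ∧ ∀ y ∈ uball d, |w y| ≤ M * bdryQ y := by
  obtain ⟨M, h0, hM⟩ := hw.1.exists_fderivWithin_bound
  refine ⟨M, h0, fun y hy => ?_⟩
  have hy1 : ‖y‖ < 1 := by simpa using hy
  obtain ⟨z, hz, hyz⟩ : ∃ z : Euc d, ‖z‖ = 1 ∧ ‖y - z‖ = 1 - ‖y‖ := by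
    by_cases h : y = 0
    · refine ⟨EuclideanSpace.single 0 1, by simp, by simp [h]⟩
    · have hn : ‖y‖ ≠ 0 := norm_ne_zero_iff.2 h
      refine ⟨‖y‖⁻¹ • y, by rw [norm_smul, norm_inv, norm_norm, inv_mul_cancel₀ hn], ?_⟩
      have : y - ‖y‖⁻¹ • y = (1 - ‖y‖⁻¹) • y := by module
      rw [this, norm_smul, Real.norm_eq_abs, abs_of_nonpos]
      · field_simp; ring
      · have := (one_le_inv₀ (norm_pos_iff.2 h)).2 hy1.le
        linarith
  have h1 := (convex_closedBall (0 : Euc d) 1).norm_image_sub_le_of_norm_fderivWithin_le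
    (hw.1.differentiableOn one_ne_zero) hM (show z ∈ closedBall (0 : Euc d) 1 by simp [hz])
    (ball_subset_closedBall hy)
  rw [hw.2 z (by simp [hz]), sub_zero, hyz, Real.norm_eq_abs] at h1
  refine h1.trans (mul_le_mul_of_nonneg_left ?_ h0)
  unfold bdryQ
  nlinarith [norm_nonneg y]

lemma fderiv_bdryCutoff_mul_apply (n : ℕ) {w : Euc d → ℝ} {y : Euc d} (v : Euc d)
    (hw : DifferentiableAt ℝ w y) :
    fderiv ℝ (fun y => bdryCutoff n y * w y) y v =
      bdryCutoff n y * fderiv ℝ w y v + w y * fderiv ℝ (bdryCutoff n) y v := by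
  rw [fderiv_fun_mul ((contDiff_bdryCutoff n (k := 1)).differentiable one_ne_zero y) hw]
  simp

lemma C1Zero.tendsto_integral_cutoff [NeZero d] {w G : Euc d → ℝ} (hw : C1Zero w)
    (hG : IntegrableOn G (uball d)) (v : Euc d) :
    Tendsto (fun n : ℕ => ∫ y in uball d, G y * fderiv ℝ (fun y => bdryCutoff n y * w y) y v)
      atTop (𝓝 (∫ y in uball d, G y * fderiv ℝ w y v)) := by
  obtain ⟨M1, hM10, hM1⟩ := hw.exists_bound
  obtain ⟨M2, hM20, hM2⟩ := hw.1.exists_fderiv_bound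
  obtain ⟨C, hC0, hC⟩ := exists_fderiv_bdryCutoff_bound (d := d)
  refine tendsto_integral_of_dominated_convergence
    (fun y => (M2 * ‖v‖ + M1 * (C * ‖v‖)) * |G y|) (fun n => ?_) (hG.abs.const_mul _)
    (fun n => ?_) ?_
  · have : Continuous fun y => fderiv ℝ (fun y => bdryCutoff n y * w y) y v :=
      ((contDiff_bdryCutoff_mul n (k := 1)
        (hw.1.mono ball_subset_closedBall)).continuous_fderiv one_ne_zero).clm_apply
        continuous_const
    exact hG.aestronglyMeasurable.mul this.aestronglyMeasurable
  · filter_upwards [ae_restrict_mem measurableSet_ball] with y hy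
    rw [fderiv_bdryCutoff_mul_apply n v (hw.1.differentiableAt_uball hy), Real.norm_eq_abs,
      abs_mul, mul_comm]
    refine mul_le_mul_of_nonneg_right ((abs_add_le _ _).trans (add_le_add ?_ ?_)) (abs_nonneg _)
    · rw [abs_mul, abs_of_nonneg (bdryCutoff_mem_Icc n y).1]
      calc bdryCutoff n y * |fderiv ℝ w y v| ≤ 1 * (M2 * ‖v‖) := by
            gcongr
            · exact (bdryCutoff_mem_Icc n y).2
            · exact ((fderiv ℝ w y).le_opNorm v).trans
                (mul_le_mul_of_nonneg_right (hM2 y hy) (norm_nonneg v))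
        _ = _ := one_mul _
    · rw [abs_mul]
      calc |w y| * |fderiv ℝ (bdryCutoff n) y v|
          ≤ M1 * bdryQ y * |fderiv ℝ (bdryCutoff n) y v| := by gcongr; exact hM1 y hy
        _ = M1 * (bdryQ y * |fderiv ℝ (bdryCutoff n) y v|) := by ring
        _ ≤ _ := mul_le_mul_of_nonneg_left (hC n y v hy) hM10
  · filter_upwards [ae_restrict_mem measurableSet_ball] with y hy
    refine tendsto_const_nhds.congr' ?_
    filter_upwards [eventually_bdryQ_mul_gt hy] with n hn
    rw [fderiv_bdryCutoff_mul_apply n v (hw.1.differentiableAt_uball hy), fderiv_bdryCutoff_apply,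
      deriv_smoothTransition_of_one_lt hn, bdryCutoff,
      Real.smoothTransition.one_of_one_le hn.le]
    ring

lemma integral_fderiv_eq_zero_of_hasCompactSupport {g : Euc d → ℝ} (hg : ContDiff ℝ 1 g)
    (hc : HasCompactSupport g) (v : Euc d) : ∫ y, fderiv ℝ g y v = 0 := by
  have hd : Continuous fun y => fderiv ℝ g y v :=
    (hg.continuous_fderiv one_ne_zero).clm_apply continuous_const
  have hdc : HasCompactSupport fun y => fderiv ℝ g y v :=
    hc.fderiv_apply (𝕜 := ℝ) v
  have := integral_mul_fderiv_eq_neg_fderiv_mul_of_integrable (μ := (volume : Measure (Euc d)))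
    (f := fun _ => (1 : ℝ)) (g := g) (v := v) (by simp)
    (by simpa using hd.integrable_of_hasCompactSupport hdc)
    (by simpa using hg.continuous.integrable_of_hasCompactSupport hc)
    (fun _ _ => differentiableAt_const _) (fun x _ => hg.differentiable one_ne_zero x)
  simpa using this

lemma setIntegral_fderiv_cutoff (n : ℕ) {w : Euc d → ℝ} (hw : ContDiffOn ℝ 1 w (uball d))
    (v : Euc d) :
    ∫ y in uball d, fderiv ℝ (fun y => bdryCutoff n y * w y) y v = 0 := by
  rw [setIntegral_eq_integral_of_forall_compl_eq_zero]
  · exact integral_fderiv_eq_zero_of_hasCompactSupport (contDiff_bdryCutoff_mul n (k := 1) hw)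
      (hasCompactSupport_bdryCutoff_mul n w) v
  · intro y hy
    have hy2 : y ∉ tsupport (fun y => bdryCutoff n y * w y) := fun h =>
      hy (setOf_one_le_mul_bdryQ_subset n (tsupport_bdryCutoff_mul_subset n w h))
    rw [(notMem_tsupport_iff_eventuallyEq.1 hy2).fderiv_eq]
    simp

/-- The integral over the ball of a derivative of a function vanishing on the sphere is zero. -/
lemma C1Zero.integral_fderiv_eq_zero [NeZero d] {w : Euc d → ℝ} (hw : C1Zero w) (v : Euc d) :
    ∫ y in uball d, fderiv ℝ w y v = 0 := by
  have h := hw.tendsto_integral_cutoff (G := fun _ => 1)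
    (integrableOn_const measure_ball_lt_top.ne) v
  simp only [one_mul] at h
  refine tendsto_nhds_unique h ?_
  simp only [setIntegral_fderiv_cutoff _ (hw.1.mono ball_subset_closedBall)]
  exact tendsto_const_nhds

lemma ContDiffOn.integrableOn_fderiv_apply {w : Euc d → ℝ}
    (hw : ContDiffOn ℝ 1 w (closedBall 0 1)) (v : Euc d) :
    IntegrableOn (fun y => fderiv ℝ w y v) (uball d) := by
  obtain ⟨M, h0, hM⟩ := hw.exists_fderiv_bound
  refine Integrable.of_bound
    ((hw.continuousOn_fderiv_uball.clm_apply continuousOn_const).aestronglyMeasurable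
      measurableSet_ball) (M * ‖v‖) ?_
  filter_upwards [ae_restrict_mem measurableSet_ball] with y hy
  exact (ContinuousLinearMap.le_opNorm _ _).trans (by gcongr; exact hM y hy)

lemma C1Zero.mul {w ψ : Euc d → ℝ} (hw : C1Zero w) (hψ : ContDiffOn ℝ 1 ψ (closedBall 0 1)) :
    C1Zero fun y => w y * ψ y :=
  ⟨hw.1.mul hψ, fun x hx => by simp [hw.2 x hx]⟩

lemma ContDiffOn.integrableOn_mul_fderiv {w ψ : Euc d → ℝ}
    (hw : ContDiffOn ℝ 1 w (closedBall 0 1)) (hψ : ContDiffOn ℝ 1 ψ (closedBall 0 1))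
    (v : Euc d) : IntegrableOn (fun y => w y * fderiv ℝ ψ y v) (uball d) := by
  obtain ⟨M, hM⟩ := (isCompact_closedBall (0 : Euc d) 1).exists_bound_of_continuousOn
    hw.continuousOn
  refine (hψ.integrableOn_fderiv_apply v).bdd_mul (c := M)
    ((hw.continuousOn.mono ball_subset_closedBall).aestronglyMeasurable measurableSet_ball) ?_
  filter_upwards [ae_restrict_mem measurableSet_ball] with y hy
  exact hM y (ball_subset_closedBall hy)

/-- Integration by parts on the unit ball. -/
lemma C1Zero.integral_fderiv_mul [NeZero d] {w ψ : Euc d → ℝ} (hw : C1Zero w)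
    (hψ : ContDiffOn ℝ 1 ψ (closedBall 0 1)) (v : Euc d) :
    ∫ y in uball d, fderiv ℝ w y v * ψ y = -∫ y in uball d, w y * fderiv ℝ ψ y v := by
  have h := (hw.mul hψ).integral_fderiv_eq_zero v
  have h2 : ∫ y in uball d, fderiv ℝ (fun y => w y * ψ y) y v =
      ∫ y in uball d, (fderiv ℝ w y v * ψ y + w y * fderiv ℝ ψ y v) := by
    refine setIntegral_congr_fun measurableSet_ball fun y hy => ?_
    rw [fderiv_fun_mul (hw.1.differentiableAt_uball hy) (hψ.differentiableAt_uball hy)]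
    simp [mul_comm, add_comm]
  have h3 : IntegrableOn (fun y => fderiv ℝ w y v * ψ y) (uball d) := by
    simpa only [mul_comm] using hψ.integrableOn_mul_fderiv hw.1 v
  rw [h2, integral_add h3 (hw.1.integrableOn_mul_fderiv hψ v)] at h
  linarith

end Cutoff

section Schur

variable {d : ℕ}

lemma bddMeas_integral {H : Euc d → Euc d → ℝ} (hm : Measurable (Function.uncurry H))
    {M : ℝ} (hM : ∀ x y, |H x y| ≤ M) : BddMeas fun x => ∫ y in uball d, H x y := by
  refine ⟨hm.stronglyMeasurable.integral_prod_right.measurable,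
    M * volume.real (uball d), fun x => ?_⟩
  exact norm_setIntegral_le_of_norm_le_const (μ := volume) (s := uball d)
    (f := fun y => H x y) (C := M) measure_ball_lt_top (fun y _ => hM x y)

lemma integral_integral_swap_uball {H : Euc d → Euc d → ℝ}
    (hm : Measurable (Function.uncurry H)) {M : ℝ} (hM : ∀ x y, |H x y| ≤ M) :
    ∫ x in uball d, ∫ y in uball d, H x y = ∫ y in uball d, ∫ x in uball d, H x y := by
  refine integral_integral_swap ?_
  exact Integrable.of_bound hm.aestronglyMeasurable M
    (Filter.Eventually.of_forall fun p => hM p.1 p.2)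

lemma sq_integral_mul_le {k w g w' : Euc d → ℝ} (hk : BddMeas k) (hw : BddMeas w)
    (hg : BddMeas g) (hw' : BddMeas w') (h1 : ∀ y, w y * w' y = 1) (hk0 : ∀ y, 0 ≤ k y)
    (hw0 : ∀ y, 0 ≤ w y) :
    (∫ y in uball d, k y * g y) ^ 2 ≤
      (∫ y in uball d, k y * w y) * ∫ y in uball d, k y * (g y * g y * w' y) := by
  have hq : ∀ s : ℝ, 0 ≤ (∫ y in uball d, k y * w y) * (s * s) +
      (-2 * ∫ y in uball d, k y * g y) * s + ∫ y in uball d, k y * (g y * g y * w' y) := by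
    intro s
    have i1 := (hk.mul hw).integrable_uball
    have i2 := (hk.mul hg).integrable_uball
    have i3 := (hk.mul ((hg.mul hg).mul hw')).integrable_uball
    have e : (∫ y in uball d, k y * w y) * (s * s) +
        (-2 * ∫ y in uball d, k y * g y) * s + ∫ y in uball d, k y * (g y * g y * w' y) =
        ∫ y in uball d, ((s * s) * (k y * w y) + (-2 * s) * (k y * g y) +
          k y * (g y * g y * w' y)) := by
      have i12 : IntegrableOn (fun y => (s * s) * (k y * w y) + (-2 * s) * (k y * g y))
          (uball d) := (i1.const_mul _).add (i2.const_mul _)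
      rw [integral_add i12 i3,
        integral_add (i1.const_mul _) (i2.const_mul _), integral_const_mul, integral_const_mul]
      ring
    rw [e]
    refine integral_nonneg fun y => ?_
    have h2 : (s * s) * (k y * w y) + (-2 * s) * (k y * g y) + k y * (g y * g y * w' y) =
        k y * w y * (g y * w' y - s) ^ 2 := by
      linear_combination (-(k y * g y * g y * w' y) + 2 * s * k y * g y) * h1 y
    simp only
    rw [h2]
    exact mul_nonneg (mul_nonneg (hk0 y) (hw0 y)) (sq_nonneg _)
  have := discrim_le_zero hq
  unfold discrim at this
  nlinarith

/-- Schur's test on the unit ball. -/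
lemma schur_test {K : Euc d → Euc d → ℝ} (hKm : Measurable (Function.uncurry K)) {Mk : ℝ}
    (hMk : ∀ x y, |K x y| ≤ Mk) (hK0 : ∀ x y, 0 ≤ K x y) (hsymm : ∀ x y, K x y = K y x)
    {w w' : Euc d → ℝ} (hw : BddMeas w) (hw' : BddMeas w') (h1 : ∀ y, w y * w' y = 1)
    (hw0 : ∀ y, 0 ≤ w y) {S : ℝ} (hS : 0 ≤ S)
    (hintegral : ∀ x ∈ uball d, ∫ y in uball d, K x y * w y ≤ S * w x) {g : Euc d → ℝ}
    (hg : BddMeas g) :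
    ∫ x in uball d, (∫ y in uball d, K x y * g y) ^ 2 ≤ S ^ 2 * ∫ y in uball d, g y ^ 2 := by
  have hK : ∀ x, BddMeas (K x) := fun x => ⟨hKm.comp measurable_prodMk_left, Mk, hMk x⟩
  have hMk0 : 0 ≤ Mk := (abs_nonneg _).trans (hMk 0 0)
  set G : Euc d → ℝ := fun y => g y * g y * w' y with hG
  have hGm : BddMeas G := (hg.mul hg).mul hw'
  have hw'0 : ∀ y, 0 ≤ w' y := fun y => by
    by_contra h
    have := mul_nonneg (hw0 y) (le_of_lt (neg_pos.2 (not_le.1 h)))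
    linarith [h1 y]
  have hG0 : ∀ y, 0 ≤ G y := fun y => mul_nonneg (mul_self_nonneg _) (hw'0 y)
  obtain ⟨Mg, hMg⟩ := hg.2
  obtain ⟨MG, hMG⟩ := hGm.2
  obtain ⟨Mw, hMw⟩ := hw.2
  have hMG0 : 0 ≤ MG := (abs_nonneg _).trans (hMG 0)
  have hMw0 : 0 ≤ Mw := (abs_nonneg _).trans (hMw 0)
  have hKg : BddMeas fun x => ∫ y in uball d, K x y * g y :=
    bddMeas_integral (H := fun x y => K x y * g y) (hKm.mul (hg.1.comp measurable_snd))
      (M := Mk * Mg) fun x y => by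
        rw [abs_mul]; exact mul_le_mul (hMk x y) (hMg y) (abs_nonneg _) hMk0
  have hKG : BddMeas fun x => ∫ y in uball d, K x y * G y :=
    bddMeas_integral (H := fun x y => K x y * G y) (hKm.mul (hGm.1.comp measurable_snd))
      (M := Mk * MG) fun x y => by
        rw [abs_mul]; exact mul_le_mul (hMk x y) (hMG y) (abs_nonneg _) hMk0
  calc ∫ x in uball d, (∫ y in uball d, K x y * g y) ^ 2
      ≤ ∫ x in uball d, S * (w x * ∫ y in uball d, K x y * G y) := by
        refine setIntegral_mono_on
          (by simpa only [sq, IntegrableOn] using (hKg.mul hKg).integrable_uball)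
          ((BddMeas.const S).mul (hw.mul hKG)).integrable_uball measurableSet_ball fun x hx => ?_
        refine (sq_integral_mul_le (hK x) hw hg hw' h1 (hK0 x) hw0).trans ?_
        rw [← mul_assoc]
        exact mul_le_mul_of_nonneg_right (hintegral x hx)
          (integral_nonneg fun y => mul_nonneg (hK0 x y) (hG0 y))
    _ = S * ∫ x in uball d, ∫ y in uball d, w x * (K x y * G y) := by
        rw [integral_const_mul]
        simp only [integral_const_mul]
    _ = S * ∫ y in uball d, ∫ x in uball d, w x * (K x y * G y) := by
        rw [integral_integral_swap_uball (H := fun x y => w x * (K x y * G y))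
          ((hw.1.comp measurable_fst).mul (hKm.mul (hGm.1.comp measurable_snd)))
          (M := Mw * (Mk * MG))]
        intro x y
        rw [abs_mul, abs_mul]
        have := hMw x
        have := hMk x y
        have := hMG y
        gcongr
    _ = S * ∫ y in uball d, G y * ∫ x in uball d, K y x * w x := by
        congr 1
        refine integral_congr_ae (Filter.Eventually.of_forall fun y => ?_)
        simp only
        rw [← integral_const_mul]
        refine integral_congr_ae (Filter.Eventually.of_forall fun x => ?_)
        simp only
        rw [hsymm y x]; ring
    _ ≤ S * ∫ y in uball d, S * (g y ^ 2) := by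
        refine mul_le_mul_of_nonneg_left ?_ hS
        refine setIntegral_mono_on ?_ ?_ measurableSet_ball fun y hy => ?_
        · have : BddMeas fun x => ∫ y in uball d, K x y * w y :=
            bddMeas_integral (H := fun x y => K x y * w y) (hKm.mul (hw.1.comp measurable_snd))
              (M := Mk * Mw) fun x y => by
                rw [abs_mul]; exact mul_le_mul (hMk x y) (hMw y) (abs_nonneg _) hMk0
          exact (hGm.mul this).integrable_uball
        · simpa only [sq, IntegrableOn] using
            ((BddMeas.const S).mul (hg.mul hg)).integrable_uball
        · calc G y * ∫ x in uball d, K y x * w x ≤ G y * (S * w y) :=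
                mul_le_mul_of_nonneg_left (hintegral y hy) (hG0 y)
            _ = S * g y ^ 2 * (w y * w' y) := by rw [hG]; ring
            _ = _ := by rw [h1, mul_one]
    _ = _ := by rw [integral_const_mul]; ring

end Schur

section EulerIdentity

variable {d : ℕ}

lemma fderiv_apply_eq_sum {h : Euc d → ℝ} (y v : Euc d) :
    fderiv ℝ h y v = ∑ i, fderiv ℝ h y (EuclideanSpace.single i 1) * v i := by
  conv_lhs => rw [← (EuclideanSpace.basisFun (Fin d) ℝ).sum_repr v]
  simp [map_sum, mul_comm]

lemma C1Zero.integral_fderiv_self [NeZero d] {h : Euc d → ℝ} (hh : C1Zero h) :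
    ∫ y in uball d, fderiv ℝ h y y = -(d * ∫ y in uball d, h y) := by
  have hc : ∀ i : Fin d, ContDiffOn ℝ 1 (fun y : Euc d => y i) (closedBall 0 1) := fun i =>
    (EuclideanSpace.proj (𝕜 := ℝ) i).contDiff.contDiffOn
  have h1 : ∀ i : Fin d, ∫ y in uball d, fderiv ℝ h y (EuclideanSpace.single i 1) * y i =
      -∫ y in uball d, h y := by
    intro i
    rw [hh.integral_fderiv_mul (hc i)]
    congr 1
    refine integral_congr_ae (Filter.Eventually.of_forall fun y => ?_)
    have : fderiv ℝ (fun y : Euc d => y i) y = EuclideanSpace.proj (𝕜 := ℝ) i :=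
      (EuclideanSpace.proj (𝕜 := ℝ) i).fderiv
    simp only
    rw [this]; simp
  have h2 : ∀ y, fderiv ℝ h y y = ∑ i, fderiv ℝ h y (EuclideanSpace.single i 1) * y i :=
    fun y => fderiv_apply_eq_sum y y
  simp only [h2]
  rw [integral_finsetSum]
  · simp only [h1]; simp
  · intro i _
    have := (hc i).integrableOn_mul_fderiv hh.1 (EuclideanSpace.single i 1)
    simpa only [mul_comm, IntegrableOn] using this

end EulerIdentity

section BoundaryKernel

variable {d : ℕ}

lemma fderiv_apply_eq_of_hasDerivAt_line {f : Euc d → ℝ} {y v : Euc d} {f' : ℝ}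
    (hd : DifferentiableAt ℝ f y) (h : HasDerivAt (fun t : ℝ => f (y + t • v)) f' 0) :
    fderiv ℝ f y v = f' :=
  (hd.hasFDerivAt.hasLineDerivAt v).unique h

lemma hasDerivAt_bdryQ_line (y v : Euc d) :
    HasDerivAt (fun t : ℝ => bdryQ (y + t • v)) (-2 * inner ℝ y v) 0 := by
  have e : -2 * inner ℝ y v = (-(2 • innerSL ℝ y)) v := by simp
  rw [e]
  exact (hasFDerivAt_bdryQ y).hasLineDerivAt v

lemma hasDerivAt_norm_sq_line (x y v : Euc d) :
    HasDerivAt (fun t : ℝ => ‖x - (y + t • v)‖ ^ 2) (-2 * inner ℝ (x - y) v) 0 := by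
  have h := (hasStrictFDerivAt_norm_sq (F := Euc d) (x - y)).hasFDerivAt.hasLineDerivAt (-v)
  have e : (fun t : ℝ => ‖x - (y + t • v)‖ ^ 2) = fun t : ℝ => ‖x - y + t • -v‖ ^ 2 := by
    funext t
    congr 2
    module
  have e' : -2 * inner ℝ (x - y) v = (2 • innerSL ℝ (x - y)) (-v) := by
    simp [inner_sub_left]; ring
  rw [e, e']
  exact h

/-- The squared distance scale of the boundary kernel. -/
noncomputable def bdryRho (ε : ℝ) (x y : Euc d) : ℝ :=
  ε ^ 2 + ‖x - y‖ ^ 2 + bdryQ x ^ 2 + bdryQ y ^ 2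

lemma sq_le_bdryRho (ε : ℝ) (x y : Euc d) : ε ^ 2 ≤ bdryRho ε x y := by
  unfold bdryRho; nlinarith [sq_nonneg ‖x - y‖, sq_nonneg (bdryQ x), sq_nonneg (bdryQ y)]

lemma bdryRho_pos {ε : ℝ} (hε : 0 < ε) (x y : Euc d) : 0 < bdryRho ε x y :=
  (pow_pos hε 2).trans_le (sq_le_bdryRho ε x y)

lemma bdryRho_comm (ε : ℝ) (x y : Euc d) : bdryRho ε x y = bdryRho ε y x := by
  unfold bdryRho; rw [norm_sub_rev]; ring

lemma contDiff_bdryRho (ε : ℝ) (x : Euc d) {n : WithTop ℕ∞} :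
    ContDiff ℝ n (bdryRho ε x) := by
  unfold bdryRho
  exact ((contDiff_const.add ((contDiff_norm_sq ℝ).comp (contDiff_const.sub contDiff_id))).add
    contDiff_const).add (contDiff_bdryQ.pow 2)

lemma continuous_uncurry_bdryRho (ε : ℝ) :
    Continuous (Function.uncurry (bdryRho ε : Euc d → Euc d → ℝ)) := by
  unfold bdryRho Function.uncurry
  have := continuous_bdryQ (d := d)
  fun_prop

lemma norm_sub_le_sqrt_bdryRho (ε : ℝ) (x y : Euc d) : ‖x - y‖ ≤ √(bdryRho ε x y) := by
  refine Real.le_sqrt_of_sq_le ?_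
  unfold bdryRho; nlinarith [sq_nonneg ε, sq_nonneg (bdryQ x), sq_nonneg (bdryQ y)]

lemma bdryQ_le_sqrt_bdryRho (ε : ℝ) (x y : Euc d) : bdryQ y ≤ √(bdryRho ε x y) := by
  refine Real.le_sqrt_of_sq_le ?_
  unfold bdryRho; nlinarith [sq_nonneg ε, sq_nonneg (bdryQ x), sq_nonneg ‖x - y‖]

lemma abs_bdryQ_sub_le {y y' : Euc d} (hy : y ∈ uball d) (hy' : y' ∈ uball d) :
    |bdryQ y - bdryQ y'| ≤ 2 * ‖y - y'‖ := by
  have h1 : ‖y‖ < 1 := by simpa using hy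
  have h2 : ‖y'‖ < 1 := by simpa using hy'
  have e : bdryQ y - bdryQ y' = (‖y'‖ - ‖y‖) * (‖y'‖ + ‖y‖) := by unfold bdryQ; ring
  rw [e, abs_mul, abs_of_nonneg (by positivity : 0 ≤ ‖y'‖ + ‖y‖)]
  have h3 : |‖y'‖ - ‖y‖| ≤ ‖y - y'‖ := by
    rw [norm_sub_rev]; exact abs_norm_sub_norm_le _ _
  calc _ ≤ ‖y - y'‖ * 2 := by gcongr; linarith
    _ = _ := mul_comm _ _

lemma abs_sqrt_bdryRho_sub_le {ε : ℝ} (hε : 0 < ε) (x : Euc d) {y y' : Euc d}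
    (hy : y ∈ uball d) (hy' : y' ∈ uball d) :
    |√(bdryRho ε x y) - √(bdryRho ε x y')| ≤ 3 * ‖y - y'‖ := by
  set X := √(bdryRho ε x y) with hX
  set Y := √(bdryRho ε x y') with hY
  have hX0 : 0 < X := Real.sqrt_pos.2 (bdryRho_pos hε x y)
  have hY0 : 0 < Y := Real.sqrt_pos.2 (bdryRho_pos hε x y')
  have e : X ^ 2 - Y ^ 2 = (‖x - y‖ - ‖x - y'‖) * (‖x - y‖ + ‖x - y'‖) +
      (bdryQ y - bdryQ y') * (bdryQ y + bdryQ y') := by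
    rw [hX, hY, Real.sq_sqrt (bdryRho_pos hε x y).le, Real.sq_sqrt (bdryRho_pos hε x y').le]
    unfold bdryRho; ring
  have h1 : |‖x - y‖ - ‖x - y'‖| ≤ ‖y - y'‖ := by
    refine (abs_norm_sub_norm_le _ _).trans ?_
    rw [sub_sub_sub_cancel_left, norm_sub_rev]
  have h2 := abs_bdryQ_sub_le hy hy'
  have h3 : |X ^ 2 - Y ^ 2| ≤ 3 * ‖y - y'‖ * (X + Y) := by
    rw [e]
    refine (abs_add_le _ _).trans ?_
    rw [abs_mul, abs_mul, abs_of_nonneg (by positivity : 0 ≤ ‖x - y‖ + ‖x - y'‖),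
      abs_of_nonneg (add_nonneg (bdryQ_pos hy).le (bdryQ_pos hy').le)]
    have a1 : ‖x - y‖ + ‖x - y'‖ ≤ X + Y :=
      add_le_add (norm_sub_le_sqrt_bdryRho ε x y) (norm_sub_le_sqrt_bdryRho ε x y')
    have a2 : bdryQ y + bdryQ y' ≤ X + Y :=
      add_le_add (bdryQ_le_sqrt_bdryRho ε x y) (bdryQ_le_sqrt_bdryRho ε x y')
    calc _ ≤ ‖y - y'‖ * (X + Y) + 2 * ‖y - y'‖ * (X + Y) := by
          gcongr
          exact add_nonneg (bdryQ_pos hy).le (bdryQ_pos hy').le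
      _ = _ := by ring
  have h4 : |X - Y| * (X + Y) = |X ^ 2 - Y ^ 2| := by
    have e2 : X ^ 2 - Y ^ 2 = (X - Y) * (X + Y) := by ring
    rw [e2, abs_mul, abs_of_pos (add_pos hX0 hY0)]
  rw [← h4] at h3
  exact le_of_mul_le_mul_right h3 (by positivity)

lemma abs_inv_pow_sub_inv_pow_le {m X Y : ℝ} (hm : 0 < m) (hX : m ≤ X) (hY : m ≤ Y) (n : ℕ) :
    |(X ^ n)⁻¹ - (Y ^ n)⁻¹| ≤ n * |X - Y| / m ^ (n + 1) := by
  have hX0 := hm.trans_le hX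
  have hY0 := hm.trans_le hY
  induction n with
  | zero => simp
  | succ n ih =>
    have e : (X ^ (n + 1))⁻¹ - (Y ^ (n + 1))⁻¹ =
        X⁻¹ * ((X ^ n)⁻¹ - (Y ^ n)⁻¹) + (Y ^ n)⁻¹ * (X⁻¹ - Y⁻¹) := by
      rw [pow_succ, pow_succ, mul_inv, mul_inv]; ring
    have h1 : |X⁻¹ - Y⁻¹| ≤ |X - Y| / m ^ 2 := by
      have : X⁻¹ - Y⁻¹ = (Y - X) / (X * Y) := by field_simp
      rw [this, abs_div, abs_sub_comm, abs_of_pos (mul_pos hX0 hY0), sq]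
      gcongr
    rw [e]
    refine (abs_add_le _ _).trans ?_
    rw [abs_mul, abs_mul, abs_of_pos (inv_pos.2 hX0), abs_of_pos (inv_pos.2 (pow_pos hY0 n))]
    calc _ ≤ m⁻¹ * (n * |X - Y| / m ^ (n + 1)) + (m ^ n)⁻¹ * (|X - Y| / m ^ 2) := by
          gcongr
      _ = _ := by push_cast; field_simp; ring

/-- The positive kernel controlling the boundary terms of the parametrix. -/
noncomputable def bdryKer (ε : ℝ) (x y : Euc d) : ℝ := bdryRho ε x y ^ (-((d : ℝ) / 2))

lemma rpow_neg_half_eq_inv_sqrt_pow {ρ : ℝ} (hρ : 0 ≤ ρ) (n : ℕ) :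
    ρ ^ (-((n : ℝ) / 2)) = (√ρ ^ n)⁻¹ := by
  rw [Real.rpow_neg hρ, Real.sqrt_eq_rpow, ← Real.rpow_natCast, ← Real.rpow_mul hρ]
  congr 2; ring

lemma bdryKer_hormander {ε : ℝ} (hε : 0 < ε) {x y y' : Euc d} (hy : y ∈ uball d)
    (hy' : y' ∈ uball d) (h : 2 * ‖y - y'‖ ≤ ‖x - y‖) :
    |bdryKer ε x y - bdryKer ε x y'| ≤ (3 * d * 2 ^ (d + 1)) * ‖y - y'‖ / ‖x - y‖ ^ (d + 1) := by
  rcases (norm_nonneg (x - y)).eq_or_lt with h0 | h0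
  · have : ‖y - y'‖ = 0 := le_antisymm (by linarith) (norm_nonneg _)
    rw [sub_eq_zero.1 (norm_eq_zero.1 this)]
    simp
  unfold bdryKer
  rw [rpow_neg_half_eq_inv_sqrt_pow (bdryRho_pos hε x y).le,
    rpow_neg_half_eq_inv_sqrt_pow (bdryRho_pos hε x y').le]
  have h1 : ‖x - y‖ / 2 ≤ √(bdryRho ε x y) :=
    (by linarith : ‖x - y‖ / 2 ≤ ‖x - y‖).trans (norm_sub_le_sqrt_bdryRho ε x y)
  have h2 : ‖x - y‖ / 2 ≤ √(bdryRho ε x y') := by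
    refine le_trans ?_ (norm_sub_le_sqrt_bdryRho ε x y')
    have : ‖x - y‖ ≤ ‖x - y'‖ + ‖y' - y‖ := norm_sub_le_norm_sub_add_norm_sub _ _ _
    rw [norm_sub_rev y' y] at this
    linarith
  refine (abs_inv_pow_sub_inv_pow_le (by positivity) h1 h2 d).trans ?_
  calc _ ≤ d * (3 * ‖y - y'‖) / (‖x - y‖ / 2) ^ (d + 1) := by
        gcongr; exact abs_sqrt_bdryRho_sub_le hε x hy hy'
    _ = _ := by rw [div_pow]; field_simp

lemma measurable_uncurry_bdryKer {ε : ℝ} (hε : 0 < ε) :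
    Measurable (Function.uncurry (bdryKer ε : Euc d → Euc d → ℝ)) := by
  have : Continuous (Function.uncurry (bdryKer ε : Euc d → Euc d → ℝ)) :=
    (continuous_uncurry_bdryRho ε).rpow_const fun p => Or.inl (bdryRho_pos hε p.1 p.2).ne'
  exact this.measurable

lemma bdryKer_pos {ε : ℝ} (hε : 0 < ε) (x y : Euc d) : 0 < bdryKer ε x y :=
  Real.rpow_pos_of_pos (bdryRho_pos hε x y) _

lemma abs_bdryKer_le {ε : ℝ} (hε : 0 < ε) (x y : Euc d) :
    |bdryKer ε x y| ≤ (ε ^ 2) ^ (-((d : ℝ) / 2)) := by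
  rw [abs_of_pos (bdryKer_pos hε x y)]
  exact Real.rpow_le_rpow_of_nonpos (by positivity) (sq_le_bdryRho ε x y)
    (by simp only [Left.neg_nonpos_iff]; positivity)

/-- The tail function dominating the boundary kernel. -/
noncomputable def bdryTail (ε : ℝ) (x y : Euc d) : ℝ :=
  (ε + bdryQ x + ‖y - x‖) ^ (-((d : ℝ) + 1 / 2))

lemma bdryRho_rpow_le_bdryTail {ε : ℝ} (hε : 0 < ε) {x : Euc d} (hx : x ∈ uball d) (y : Euc d) :
    bdryRho ε x y ^ (-((d : ℝ) / 2) - 1 / 4) ≤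
      3 ^ (((d : ℝ) + 1 / 2) / 2) * bdryTail ε x y := by
  have hq := bdryQ_pos hx
  have ht : 0 < ε + bdryQ x + ‖y - x‖ := by positivity
  have h1 : (ε + bdryQ x + ‖y - x‖) ^ 2 / 3 ≤ bdryRho ε x y := by
    unfold bdryRho
    rw [norm_sub_rev x y]
    nlinarith [sq_nonneg (ε - bdryQ x), sq_nonneg (ε - ‖y - x‖), sq_nonneg (bdryQ x - ‖y - x‖),
      sq_nonneg (bdryQ y)]
  calc bdryRho ε x y ^ (-((d : ℝ) / 2) - 1 / 4)
      ≤ ((ε + bdryQ x + ‖y - x‖) ^ 2 / 3) ^ (-((d : ℝ) / 2) - 1 / 4) :=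
        Real.rpow_le_rpow_of_nonpos (by positivity) h1 (by
          have : (0 : ℝ) ≤ d := Nat.cast_nonneg d
          linarith)
    _ = _ := by
        unfold bdryTail
        rw [Real.div_rpow (by positivity) (by norm_num), ← Real.rpow_natCast _ 2,
          ← Real.rpow_mul ht.le, div_eq_mul_inv, ← Real.rpow_neg (by norm_num), mul_comm]
        congr 1
        · congr 1; ring
        · congr 1; push_cast; ring

lemma integrable_bdryTail {ε : ℝ} (hε : 0 < ε) {x : Euc d} (hx : x ∈ uball d) :
    Integrable (bdryTail ε x) := by
  have hq := bdryQ_pos hx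
  exact (integrable_add_norm_rpow_neg (by linarith) (by positivity)).comp_sub_right x

lemma bdryTail_nonneg {ε : ℝ} (hε : 0 < ε) {x : Euc d} (hx : x ∈ uball d) (y : Euc d) :
    0 ≤ bdryTail ε x y := by
  have hq := bdryQ_pos hx
  unfold bdryTail; positivity

lemma integral_bdryTail_le {ε : ℝ} (hε : 0 < ε) {x : Euc d} (hx : x ∈ uball d) :
    ∫ y in uball d, bdryTail ε x y ≤
      (bdryQ x + ε) ^ (-(1 / 2 : ℝ)) * ∫ z : Euc d, (1 + ‖z‖) ^ (-((d : ℝ) + 1 / 2)) := by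
  have hq := bdryQ_pos hx
  refine (setIntegral_le_integral (integrable_bdryTail hε hx)
    (Filter.Eventually.of_forall fun y => bdryTail_nonneg hε hx y)).trans ?_
  unfold bdryTail
  rw [integral_sub_right_eq_self
      (fun y : Euc d => (ε + bdryQ x + ‖y‖) ^ (-((d : ℝ) + 1 / 2))) x,
    integral_add_norm_rpow_neg (by positivity)]
  apply le_of_eq
  congr 1
  rw [add_comm ε]
  congr 1; ring

end BoundaryKernel

section BoundarySchur

variable {d : ℕ}

/-- The Schur test weights for the boundary kernel. -/
noncomputable def bdryWeight (ε p : ℝ) (y : Euc d) : ℝ := (max (bdryQ y) 0 + ε) ^ p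

lemma bddMeas_bdryWeight {ε : ℝ} (hε : 0 < ε) (p : ℝ) :
    BddMeas (bdryWeight ε p : Euc d → ℝ) := by
  have hpos : ∀ y : Euc d, 0 < max (bdryQ y) 0 + ε := fun y => by positivity
  refine ⟨Continuous.measurable ?_, (1 + ε) ^ p + ε ^ p, fun y => ?_⟩
  · exact ((continuous_bdryQ.max continuous_const).add continuous_const).rpow_const
      fun y => Or.inl (hpos y).ne'
  · unfold bdryWeight
    rw [abs_of_pos (Real.rpow_pos_of_pos (hpos y) _)]
    rcases le_total 0 p with hp | hp
    · refine le_add_of_le_of_nonneg (Real.rpow_le_rpow (hpos y).le ?_ hp) (by positivity)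
      gcongr
      exact max_le (bdryQ_le_one y) zero_le_one
    · refine le_add_of_nonneg_of_le (by positivity) (Real.rpow_le_rpow_of_nonpos hε ?_ hp)
      simp

/-- The auxiliary function whose radial derivative absorbs the singular weight. -/
noncomputable def bdryAux (ε : ℝ) (x y : Euc d) : ℝ :=
  bdryQ y * (bdryQ y + ε) ^ (-(1 / 2 : ℝ)) * bdryKer ε x y

lemma c1Zero_bdryAux {ε : ℝ} (hε : 0 < ε) (x : Euc d) : C1Zero (bdryAux ε x) := by
  constructor
  · unfold bdryAux bdryKer
    have h0 : ∀ y ∈ closedBall (0 : Euc d) 1, bdryQ y + ε ≠ 0 := fun y hy => by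
      have : ‖y‖ ≤ 1 := by simpa using hy
      unfold bdryQ
      nlinarith [norm_nonneg y]
    exact (contDiff_bdryQ.contDiffOn.mul
      ((contDiff_bdryQ.contDiffOn.add contDiffOn_const).rpow_const_of_ne h0)).mul
      ((contDiff_bdryRho ε x).contDiffOn.rpow_const_of_ne fun y _ => (bdryRho_pos hε x y).ne')
  · intro y hy
    have : ‖y‖ = 1 := by simpa using hy
    simp [bdryAux, bdryQ, this]

lemma hasDerivAt_bdryRho_line (ε : ℝ) (x y v : Euc d) :
    HasDerivAt (fun t : ℝ => bdryRho ε x (y + t • v))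
      (-2 * inner ℝ (x - y) v + 2 * bdryQ y * (-2 * inner ℝ y v)) 0 := by
  have h1 := (hasDerivAt_norm_sq_line x y v).const_add (ε ^ 2)
  have h2 := (hasDerivAt_bdryQ_line y v).pow 2
  have h3 := (h1.add_const (bdryQ x ^ 2)).add h2
  exact h3.congr_deriv (by simp)

lemma bdryQ_mul_rpow_le {ε : ℝ} (hε : 0 < ε) (x : Euc d) {y : Euc d} (hy : y ∈ uball d) :
    bdryQ y * (bdryQ y + ε) ^ (-(1 / 2 : ℝ)) ≤ bdryRho ε x y ^ (1 / 4 : ℝ) := by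
  have hq := bdryQ_pos hy
  have hr := bdryRho_pos hε x y
  calc bdryQ y * (bdryQ y + ε) ^ (-(1 / 2 : ℝ))
      ≤ bdryQ y * bdryQ y ^ (-(1 / 2 : ℝ)) := by
        exact mul_le_mul_of_nonneg_left (Real.rpow_le_rpow_of_nonpos hq
          (le_add_of_nonneg_right hε.le) (by norm_num)) hq.le
    _ = bdryQ y ^ (1 / 2 : ℝ) := by
        nth_rewrite 1 [← Real.rpow_one (bdryQ y)]
        rw [← Real.rpow_add hq]; norm_num
    _ ≤ (√(bdryRho ε x y)) ^ (1 / 2 : ℝ) := by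
        gcongr; exact bdryQ_le_sqrt_bdryRho ε x y
    _ = _ := by
        rw [Real.sqrt_eq_rpow, ← Real.rpow_mul hr.le]; norm_num

lemma bdryKer_mul_weight_le {ε : ℝ} (hε : 0 < ε) {x y : Euc d} (hx : x ∈ uball d)
    (hy : y ∈ uball d) :
    bdryKer ε x y * (bdryQ y + ε) ^ (-(1 / 2 : ℝ)) ≤
      -fderiv ℝ (bdryAux ε x) y y + bdryAux ε x y +
        3 * d * (3 ^ (((d : ℝ) + 1 / 2) / 2) * bdryTail ε x y) := by
  have hq := bdryQ_pos hy
  have hr := bdryRho_pos hε x y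
  have hs : 0 < bdryQ y + ε := by positivity
  have hyn : ‖y‖ < 1 := by simpa using hy
  have hq1 := hasDerivAt_bdryQ_line y y
  have hw := (hq1.add_const ε).rpow_const (p := -(1 / 2 : ℝ)) (by simpa using Or.inl hs.ne')
  have hk := (hasDerivAt_bdryRho_line ε x y y).rpow_const (p := -((d : ℝ) / 2))
    (by simpa using Or.inl hr.ne')
  have hH := (hq1.mul hw).mul hk
  have hder := fderiv_apply_eq_of_hasDerivAt_line (f := bdryAux ε x)
    ((c1Zero_bdryAux hε x).1.differentiableAt_uball hy) hH
  rw [hder]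
  simp only [zero_smul, add_zero, real_inner_self_eq_norm_sq]
  unfold bdryAux bdryKer
  have hin : |inner ℝ (x - y) y| ≤ √(bdryRho ε x y) := by
    refine (abs_real_inner_le_norm _ _).trans ?_
    calc _ ≤ ‖x - y‖ * 1 := by gcongr
      _ ≤ _ := by rw [mul_one]; exact norm_sub_le_sqrt_bdryRho ε x y
  have hQs := bdryQ_le_sqrt_bdryRho ε x y
  have hR' : |-2 * inner ℝ (x - y) y + 2 * bdryQ y * (-2 * ‖y‖ ^ 2)| ≤
      6 * bdryRho ε x y ^ (1 / 2 : ℝ) := by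
    rw [← Real.sqrt_eq_rpow]
    have hy2 : ‖y‖ ^ 2 ≤ 1 := by nlinarith [norm_nonneg y]
    have := abs_le.1 hin
    rw [abs_le]
    constructor <;> nlinarith [sq_nonneg ‖y‖]
  set ρ := bdryRho ε x y with hρ
  set s := bdryQ y + ε with hsdef
  have e1 : s ^ (-(1 / 2 : ℝ) - 1) = s ^ (-(1 / 2 : ℝ)) / s := by
    rw [Real.rpow_sub_one hs.ne']
  have e2 : ρ ^ (-((d : ℝ) / 2) - 1) * ρ ^ (1 / 2 : ℝ) * ρ ^ (1 / 4 : ℝ) =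
      ρ ^ (-((d : ℝ) / 2) - 1 / 4) := by
    rw [← Real.rpow_add hr, ← Real.rpow_add hr]; congr 1; ring
  have hw0 : 0 < s ^ (-(1 / 2 : ℝ)) := Real.rpow_pos_of_pos hs _
  have hk0 : 0 < ρ ^ (-((d : ℝ) / 2)) := Real.rpow_pos_of_pos hr _
  have hk1 : 0 < ρ ^ (-((d : ℝ) / 2) - 1) := Real.rpow_pos_of_pos hr _
  have hp0 : 0 < ρ ^ (1 / 2 : ℝ) := Real.rpow_pos_of_pos hr _
  have ha := bdryQ_mul_rpow_le hε x hy
  have htail := bdryRho_rpow_le_bdryTail hε hx y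
  rw [← hρ, ← hsdef] at ha
  rw [← hρ, ← e2] at htail
  have ha0 : 0 ≤ bdryQ y * s ^ (-(1 / 2 : ℝ)) := by positivity
  set T := 3 ^ (((d : ℝ) + 1 / 2) / 2) * bdryTail ε x y with hT
  rw [e1]
  have hd0 : (0 : ℝ) ≤ d := Nat.cast_nonneg d
  have herr : |bdryQ y * s ^ (-(1 / 2 : ℝ)) *
      ((-2 * inner ℝ (x - y) y + 2 * bdryQ y * (-2 * ‖y‖ ^ 2)) * (-((d : ℝ) / 2)) *
        ρ ^ (-((d : ℝ) / 2) - 1))| ≤ 3 * d * T := by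
    rw [abs_mul, abs_of_nonneg ha0, abs_mul, abs_mul, abs_of_pos hk1, abs_neg,
      abs_of_nonneg (by positivity : 0 ≤ (d : ℝ) / 2)]
    calc _ ≤ ρ ^ (1 / 4 : ℝ) * (6 * ρ ^ (1 / 2 : ℝ) * ((d : ℝ) / 2) *
          ρ ^ (-((d : ℝ) / 2) - 1)) := by gcongr
      _ = 3 * d * (ρ ^ (-((d : ℝ) / 2) - 1) * ρ ^ (1 / 2 : ℝ) * ρ ^ (1 / 4 : ℝ)) := by ring
      _ ≤ _ := by gcongr
  have hfrac : bdryQ y / s ≤ 1 := by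
    rw [div_le_one hs]; linarith
  have h5 := (abs_le.1 herr).2
  have hq2 : ‖y‖ ^ 2 = 1 - bdryQ y := by unfold bdryQ; ring
  have hmain : ‖y‖ ^ 2 * (s ^ (-(1 / 2 : ℝ)) * ρ ^ (-((d : ℝ) / 2))) * (bdryQ y / s) ≤
      ‖y‖ ^ 2 * (s ^ (-(1 / 2 : ℝ)) * ρ ^ (-((d : ℝ) / 2))) := by
    exact mul_le_of_le_one_right (by positivity) hfrac
  have hid : ρ ^ (-((d : ℝ) / 2)) * s ^ (-(1 / 2 : ℝ)) =
      ‖y‖ ^ 2 * (s ^ (-(1 / 2 : ℝ)) * ρ ^ (-((d : ℝ) / 2))) +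
        bdryQ y * s ^ (-(1 / 2 : ℝ)) * ρ ^ (-((d : ℝ) / 2)) := by
    rw [hq2]; ring
  rw [hid]
  have hexp : (-2 * ‖y‖ ^ 2 * s ^ (-(1 / 2 : ℝ)) +
      bdryQ y * (-2 * ‖y‖ ^ 2 * -(1 / 2) * (s ^ (-(1 / 2 : ℝ)) / s))) * ρ ^ (-((d : ℝ) / 2)) =
      -(2 * (‖y‖ ^ 2 * (s ^ (-(1 / 2 : ℝ)) * ρ ^ (-((d : ℝ) / 2))))) +
        ‖y‖ ^ 2 * (s ^ (-(1 / 2 : ℝ)) * ρ ^ (-((d : ℝ) / 2))) * (bdryQ y / s) := by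
    ring
  simp only [Pi.mul_apply, zero_smul, add_zero]
  rw [← hsdef, hexp]
  linarith

lemma bdryAux_le {ε : ℝ} (hε : 0 < ε) (hε1 : ε ≤ 1) {x y : Euc d} (hx : x ∈ uball d)
    (hy : y ∈ uball d) :
    bdryAux ε x y ≤ 3 * (3 ^ (((d : ℝ) + 1 / 2) / 2) * bdryTail ε x y) := by
  have hr := bdryRho_pos hε x y
  have hxn : ‖x‖ < 1 := by simpa using hx
  have hyn : ‖y‖ < 1 := by simpa using hy
  have hr9 : bdryRho ε x y ≤ 9 := by
    have h1 : ‖x - y‖ ≤ 2 := (norm_sub_le _ _).trans (by linarith)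
    have h2 := bdryQ_pos hx
    have h3 := bdryQ_pos hy
    have h4 := bdryQ_le_one x
    have h5 := bdryQ_le_one y
    unfold bdryRho
    nlinarith [norm_nonneg (x - y)]
  have h3 : bdryRho ε x y ^ (1 / 2 : ℝ) ≤ 3 := by
    rw [← Real.sqrt_eq_rpow, Real.sqrt_le_left (by norm_num)]; linarith
  unfold bdryAux bdryKer
  calc _ ≤ bdryRho ε x y ^ (1 / 4 : ℝ) * bdryRho ε x y ^ (-((d : ℝ) / 2)) := by
        gcongr; exact bdryQ_mul_rpow_le hε x hy
    _ = bdryRho ε x y ^ (1 / 2 : ℝ) * bdryRho ε x y ^ (-((d : ℝ) / 2) - 1 / 4) := by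
        rw [← Real.rpow_add hr, ← Real.rpow_add hr]; congr 1; ring
    _ ≤ _ := by
        gcongr
        exact bdryRho_rpow_le_bdryTail hε hx y

/-- The constant in the Schur test for the boundary kernel. -/
noncomputable def bdrySchurConst (d : ℕ) : ℝ :=
  (6 * d + 3) * 3 ^ (((d : ℝ) + 1 / 2) / 2) * ∫ z : Euc d, (1 + ‖z‖) ^ (-((d : ℝ) + 1 / 2))

lemma bdrySchurConst_nonneg : 0 ≤ bdrySchurConst d := by
  unfold bdrySchurConst
  have := integral_one_add_norm_rpow_neg_nonneg (d := d) ((d : ℝ) + 1 / 2)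
  positivity

lemma integral_bdryKer_mul_weight_le [NeZero d] {ε : ℝ} (hε : 0 < ε) (hε1 : ε ≤ 1) {x : Euc d}
    (hx : x ∈ uball d) :
    ∫ y in uball d, bdryKer ε x y * bdryWeight ε (-(1 / 2)) y ≤
      bdrySchurConst d * bdryWeight ε (-(1 / 2)) x := by
  set k : ℝ := 3 ^ (((d : ℝ) + 1 / 2) / 2) with hk
  have hC1 := c1Zero_bdryAux hε x
  have hT : IntegrableOn (fun y => k * bdryTail ε x y) (uball d) :=
    ((integrable_bdryTail hε hx).const_mul k).integrableOn
  have hA : IntegrableOn (bdryAux ε x) (uball d) := hC1.1.integrableOn_uball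
  have hF : IntegrableOn (fun y => fderiv ℝ (bdryAux ε x) y y) (uball d) := by
    have : (fun y => fderiv ℝ (bdryAux ε x) y y) = fun y => ∑ i,
        y i * fderiv ℝ (bdryAux ε x) y (EuclideanSpace.single i 1) := by
      funext y
      rw [fderiv_apply_eq_sum y y]
      exact Finset.sum_congr rfl fun i _ => mul_comm _ _
    rw [this]
    refine integrable_finsetSum _ fun i _ => ?_
    exact ContDiffOn.integrableOn_mul_fderiv
      (EuclideanSpace.proj (𝕜 := ℝ) i).contDiff.contDiffOn hC1.1 _
  have hK : IntegrableOn (fun y => bdryKer ε x y * bdryWeight ε (-(1 / 2)) y) (uball d) :=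
    (BddMeas.mul ⟨(measurable_uncurry_bdryKer hε).comp measurable_prodMk_left, _,
      abs_bdryKer_le hε x⟩ (bddMeas_bdryWeight hε _)).integrable_uball
  have hwx : ∀ y ∈ uball d, bdryWeight ε (-(1 / 2)) y = (bdryQ y + ε) ^ (-(1 / 2 : ℝ)) :=
    fun y hy => by unfold bdryWeight; rw [max_eq_left (bdryQ_pos hy).le]
  have hFA : IntegrableOn (fun y => -fderiv ℝ (bdryAux ε x) y y + bdryAux ε x y) (uball d) :=
    hF.neg.add hA
  have hT' : IntegrableOn (fun y => 3 * d * (k * bdryTail ε x y)) (uball d) :=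
    Integrable.const_mul hT _
  have h1 : ∫ y in uball d, bdryKer ε x y * bdryWeight ε (-(1 / 2)) y ≤
      ∫ y in uball d,
        (-fderiv ℝ (bdryAux ε x) y y + bdryAux ε x y + 3 * d * (k * bdryTail ε x y)) := by
    refine setIntegral_mono_on hK (hFA.add hT') measurableSet_ball fun y hy => ?_
    rw [hwx y hy]
    exact bdryKer_mul_weight_le hε hx hy
  have h2 : ∫ y in uball d, bdryAux ε x y ≤ 3 * ∫ y in uball d, k * bdryTail ε x y := by
    rw [← integral_const_mul]
    exact setIntegral_mono_on hA (Integrable.const_mul hT 3) measurableSet_ball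
      fun y hy => bdryAux_le hε hε1 hx hy
  have hFn : IntegrableOn (fun y => -fderiv ℝ (bdryAux ε x) y y) (uball d) := hF.neg
  rw [integral_add hFA hT', integral_add hFn hA, integral_neg, hC1.integral_fderiv_self,
    integral_const_mul] at h1
  have h3 : ∫ y in uball d, k * bdryTail ε x y ≤
      k * ((bdryQ x + ε) ^ (-(1 / 2 : ℝ)) * ∫ z : Euc d, (1 + ‖z‖) ^ (-((d : ℝ) + 1 / 2))) := by
    rw [integral_const_mul]
    have : 0 ≤ k := by positivity
    gcongr
    exact integral_bdryTail_le hε hx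
  rw [hwx x hx]
  unfold bdrySchurConst
  rw [← hk]
  have hd0 : (0 : ℝ) ≤ d := Nat.cast_nonneg d
  nlinarith

/-- Weak type (1,1) bound for the boundary kernels, uniformly in the regularization. -/
theorem weak_type_bdryKer [NeZero d] : ∃ C : ℝ, 0 < C ∧ ∀ ε : ℝ, 0 < ε → ε ≤ 1 →
    ∀ f : Euc d → ℝ, BddMeas f → ContinuousOn f (uball d) → ∀ α : ℝ, 0 < α →
      volume {x ∈ uball d | α < |∫ y in uball d, bdryKer ε x y * f y|} ≤
        ENNReal.ofReal (C / α * ∫ y in uball d, |f y|) := by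
  have hA : (0 : ℝ) < bdrySchurConst d ^ 2 + 3 * d * 2 ^ (d + 1) + 1 := by positivity
  obtain ⟨C, hC, H⟩ := weak_type_one_one (d := d) hA
  refine ⟨C, hC, fun ε hε hε1 => H (bdryKer ε) (measurable_uncurry_bdryKer hε)
    ⟨_, abs_bdryKer_le hε⟩ (fun g hg => ?_) fun x hx y hy y' hy' h => ?_⟩
  · have hpos : ∀ y : Euc d, 0 < max (bdryQ y) 0 + ε := fun y => by positivity
    refine (schur_test (measurable_uncurry_bdryKer hε) (abs_bdryKer_le hε)
      (fun x y => (bdryKer_pos hε x y).le) (fun x y => by unfold bdryKer; rw [bdryRho_comm])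
      (bddMeas_bdryWeight hε (-(1 / 2))) (bddMeas_bdryWeight hε (1 / 2)) (fun y => ?_)
      (fun y => (Real.rpow_pos_of_pos (hpos y) _).le) bdrySchurConst_nonneg
      (fun x hx => integral_bdryKer_mul_weight_le hε hε1 hx) hg).trans ?_
    · unfold bdryWeight
      rw [← Real.rpow_add (hpos y)]
      norm_num
    · have : 0 ≤ ∫ y in uball d, g y ^ 2 := integral_nonneg fun y => sq_nonneg _
      gcongr
      have : (0 : ℝ) ≤ 3 * d * 2 ^ (d + 1) := by positivity
      linarith
  · refine (bdryKer_hormander hε hy hy' h).trans ?_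
    gcongr
    nlinarith [sq_nonneg (bdrySchurConst d)]

end BoundarySchur

section Decay

variable {d : ℕ}

/-- Continuous functions decaying like `‖z‖ ^ (-s)` at infinity. -/
def Decay (s : ℝ) (f : Euc d → ℝ) : Prop :=
  Continuous f ∧ ∃ C, 0 ≤ C ∧ ∀ z, |f z| ≤ C * (1 + ‖z‖) ^ (-s)

lemma Decay.integrable {s : ℝ} (hs : (d : ℝ) < s) {f : Euc d → ℝ} (hf : Decay s f) :
    Integrable f := by
  obtain ⟨hc, C, hC0, hC⟩ := hf
  exact ((integrable_add_norm_rpow_neg hs one_pos).const_mul C).mono' hc.aestronglyMeasurable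
    (Filter.Eventually.of_forall hC)

lemma Decay.mul {s t : ℝ} {f g : Euc d → ℝ} (hf : Decay s f) (hg : Decay t g) :
    Decay (s + t) fun z => f z * g z := by
  obtain ⟨hc, C, hC0, hC⟩ := hf
  obtain ⟨hc', C', hC0', hC'⟩ := hg
  refine ⟨hc.mul hc', C * C', by positivity, fun z => ?_⟩
  rw [abs_mul]
  calc _ ≤ (C * (1 + ‖z‖) ^ (-s)) * (C' * (1 + ‖z‖) ^ (-t)) :=
        mul_le_mul (hC z) (hC' z) (abs_nonneg _) (by positivity)
    _ = C * C' * ((1 + ‖z‖) ^ (-s) * (1 + ‖z‖) ^ (-t)) := by ring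
    _ = _ := by rw [← Real.rpow_add (by positivity)]; congr 2; ring

lemma Decay.add {s : ℝ} {f g : Euc d → ℝ} (hf : Decay s f) (hg : Decay s g) :
    Decay s fun z => f z + g z := by
  obtain ⟨hc, C, hC0, hC⟩ := hf
  obtain ⟨hc', C', hC0', hC'⟩ := hg
  refine ⟨hc.add hc', C + C', by positivity, fun z => (abs_add_le _ _).trans ?_⟩
  rw [add_mul]
  exact add_le_add (hC z) (hC' z)

lemma one_add_norm_sub_rpow_le {s : ℝ} (hs : 0 ≤ s) (z w : Euc d) :
    (1 + ‖z - w‖) ^ (-s) ≤ (1 + ‖w‖) ^ s * (1 + ‖z‖) ^ (-s) := by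
  have h : 1 + ‖z‖ ≤ (1 + ‖w‖) * (1 + ‖z - w‖) := by
    have := norm_le_norm_sub_add z w
    nlinarith [norm_nonneg w, norm_nonneg (z - w)]
  calc (1 + ‖z - w‖) ^ (-s) = (1 + ‖w‖) ^ s * ((1 + ‖w‖) * (1 + ‖z - w‖)) ^ (-s) := by
        rw [Real.mul_rpow (by positivity) (by positivity), ← mul_assoc,
          ← Real.rpow_add (by positivity)]
        simp
    _ ≤ _ := mul_le_mul_of_nonneg_left
        (Real.rpow_le_rpow_of_nonpos (by positivity) h (by linarith)) (by positivity)

lemma Decay.comp_sub {s : ℝ} (hs : 0 ≤ s) {f : Euc d → ℝ} (hf : Decay s f) (w : Euc d) :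
    Decay s fun z => f (z - w) := by
  obtain ⟨hc, C, hC0, hC⟩ := hf
  refine ⟨hc.comp (continuous_id.sub continuous_const), C * (1 + ‖w‖) ^ s, by positivity,
    fun z => (hC _).trans ?_⟩
  rw [mul_assoc]
  exact mul_le_mul_of_nonneg_left (one_add_norm_sub_rpow_le hs z w) hC0

lemma Decay.exists_comp_sub_bound {s : ℝ} (hs : 0 ≤ s) {f : Euc d → ℝ} (hf : Decay s f) :
    ∃ C, 0 ≤ C ∧ ∀ x y, y ∈ uball d → |f (x - y)| ≤ C * (1 + ‖x‖) ^ (-s) := by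
  obtain ⟨hc, C, hC0, hC⟩ := hf
  refine ⟨C * 2 ^ s, by positivity, fun x y hy => (hC _).trans ?_⟩
  have hyn : ‖y‖ < 1 := by simpa using hy
  rw [mul_assoc]
  refine mul_le_mul_of_nonneg_left ((one_add_norm_sub_rpow_le hs x y).trans ?_) hC0
  gcongr
  linarith

lemma Decay.exists_bound {s : ℝ} (hs : 0 ≤ s) {f : Euc d → ℝ} (hf : Decay s f) :
    ∃ C, ∀ x, |f x| ≤ C := by
  obtain ⟨hc, C, hC0, hC⟩ := hf
  refine ⟨C, fun x => (hC x).trans (mul_le_of_le_one_right hC0 ?_)⟩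
  exact Real.rpow_le_one_of_one_le_of_nonpos (by linarith [norm_nonneg x]) (by linarith)

lemma Decay.bddMeas_sub {s : ℝ} (hs : 0 ≤ s) {f : Euc d → ℝ} (hf : Decay s f) (x : Euc d) :
    BddMeas fun y => f (x - y) := by
  obtain ⟨C, hC⟩ := hf.exists_bound hs
  exact ⟨(hf.1.comp (continuous_const.sub continuous_id)).measurable, C, fun y => hC _⟩

/-- Convolution over the unit ball. -/
noncomputable def convBall (a g : Euc d → ℝ) (x : Euc d) : ℝ := ∫ y in uball d, a (x - y) * g y

lemma integrable_fubini_decay {s t : ℝ} (hs : 0 ≤ s) (ht : 0 ≤ t) (hst : (d : ℝ) < s + t)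
    {a b : Euc d → ℝ} (ha : Decay s a) (hb : Decay t b) {g h : Euc d → ℝ} (hg : BddMeas g)
    (hg0 : ∀ y ∉ uball d, g y = 0) (hh : BddMeas h) (hh0 : ∀ y ∉ uball d, h y = 0) :
    Integrable (fun q : Euc d × (Euc d × Euc d) =>
      (a (q.1 - q.2.1) * g q.2.1) * (b (q.1 - q.2.2) * h q.2.2))
      (volume.prod ((volume.restrict (uball d)).prod (volume.restrict (uball d)))) := by
  obtain ⟨A, hA0, hA⟩ := ha.exists_comp_sub_bound hs
  obtain ⟨B, hB0, hB⟩ := hb.exists_comp_sub_bound ht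
  obtain ⟨M, hM⟩ := hg.2
  obtain ⟨M', hM'⟩ := hh.2
  have hM0 : 0 ≤ M := (abs_nonneg _).trans (hM 0)
  have hM0' : 0 ≤ M' := (abs_nonneg _).trans (hM' 0)
  have hdom : Integrable (fun q : Euc d × (Euc d × Euc d) =>
      (1 + ‖q.1‖) ^ (-(s + t)) * (A * M * (B * M')))
      (volume.prod ((volume.restrict (uball d)).prod (volume.restrict (uball d)))) :=
    (integrable_add_norm_rpow_neg hst one_pos).mul_prod (integrable_const (A * M * (B * M')))
  refine hdom.mono' ?_ (Filter.Eventually.of_forall fun q => ?_)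
  · have hm1 := ha.1.measurable
    have hm2 := hb.1.measurable
    have hm3 := hg.1
    have hm4 := hh.1
    refine Measurable.aestronglyMeasurable ?_
    exact ((hm1.comp (measurable_fst.sub measurable_snd.fst)).mul
      (hm3.comp measurable_snd.fst)).mul
      ((hm2.comp (measurable_fst.sub measurable_snd.snd)).mul (hm4.comp measurable_snd.snd))
  · obtain ⟨x, y, y'⟩ := q
    simp only [Real.norm_eq_abs]
    have h1 : |a (x - y) * g y| ≤ A * (1 + ‖x‖) ^ (-s) * M := by
      by_cases hy : y ∈ uball d
      · rw [abs_mul]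
        exact mul_le_mul (hA x y hy) (hM y) (abs_nonneg _) (by positivity)
      · rw [hg0 y hy]; simp; positivity
    have h2 : |b (x - y') * h y'| ≤ B * (1 + ‖x‖) ^ (-t) * M' := by
      by_cases hy : y' ∈ uball d
      · rw [abs_mul]
        exact mul_le_mul (hB x y' hy) (hM' y') (abs_nonneg _) (by positivity)
      · rw [hh0 y' hy]; simp; positivity
    rw [abs_mul]
    calc _ ≤ A * (1 + ‖x‖) ^ (-s) * M * (B * (1 + ‖x‖) ^ (-t) * M') :=
          mul_le_mul h1 h2 (abs_nonneg _) (by positivity)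
      _ = ((1 + ‖x‖) ^ (-s) * (1 + ‖x‖) ^ (-t)) * (A * M * (B * M')) := by ring
      _ = _ := by rw [← Real.rpow_add (by positivity)]; congr 2; ring

lemma convBall_mul_convBall (a b g h : Euc d → ℝ) (x : Euc d) :
    convBall a g x * convBall b h x = ∫ p : Euc d × Euc d, (a (x - p.1) * g p.1) *
      (b (x - p.2) * h p.2) ∂((volume.restrict (uball d)).prod (volume.restrict (uball d))) := by
  unfold convBall
  rw [← integral_prod_mul]

lemma integrable_convBall_mul {s t : ℝ} (hs : 0 ≤ s) (ht : 0 ≤ t) (hst : (d : ℝ) < s + t)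
    {a b : Euc d → ℝ} (ha : Decay s a) (hb : Decay t b) {g h : Euc d → ℝ} (hg : BddMeas g)
    (hg0 : ∀ y ∉ uball d, g y = 0) (hh : BddMeas h) (hh0 : ∀ y ∉ uball d, h y = 0) :
    Integrable fun x => convBall a g x * convBall b h x := by
  have := (integrable_fubini_decay hs ht hst ha hb hg hg0 hh hh0).integral_prod_left
  refine this.congr (Filter.Eventually.of_forall fun x => ?_)
  exact (convBall_mul_convBall a b g h x).symm

lemma integral_convBall_mul {s t : ℝ} (hs : 0 ≤ s) (ht : 0 ≤ t) (hst : (d : ℝ) < s + t)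
    {a b : Euc d → ℝ} (ha : Decay s a) (hb : Decay t b) {g h : Euc d → ℝ} (hg : BddMeas g)
    (hg0 : ∀ y ∉ uball d, g y = 0) (hh : BddMeas h) (hh0 : ∀ y ∉ uball d, h y = 0) :
    ∫ x, convBall a g x * convBall b h x = ∫ p : Euc d × Euc d,
      (∫ x, a (x - p.1) * b (x - p.2)) * (g p.1 * h p.2)
        ∂((volume.restrict (uball d)).prod (volume.restrict (uball d))) := by
  simp_rw [convBall_mul_convBall]
  rw [integral_integral_swap (integrable_fubini_decay hs ht hst ha hb hg hg0 hh hh0)]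
  refine integral_congr_ae (Filter.Eventually.of_forall fun p => ?_)
  simp only
  rw [← integral_mul_const]
  refine integral_congr_ae (Filter.Eventually.of_forall fun x => ?_)
  simp only
  ring

lemma integral_convBall_sq_le {s : ℝ} (hs : (d : ℝ) < s) {ψ : Euc d → ℝ} (hψ : Decay s ψ)
    (hψ0 : ∀ z, 0 ≤ ψ z) {g : Euc d → ℝ} (hg : BddMeas g) (hg0 : ∀ y ∉ uball d, g y = 0) :
    ∫ x, convBall ψ g x * convBall ψ g x ≤ (∫ z, ψ z) ^ 2 * ∫ y in uball d, g y ^ 2 := by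
  have hs0 : 0 ≤ s := (Nat.cast_nonneg d).trans hs.le
  have hI := hψ.integrable hs
  have hI0 : 0 ≤ ∫ z, ψ z := integral_nonneg hψ0
  have hg2 : Integrable (fun y => g y ^ 2) (volume.restrict (uball d)) := by
    simpa only [sq, IntegrableOn] using (hg.mul hg).integrable_uball
  have hpt : ∀ x, convBall ψ g x * convBall ψ g x ≤
      (∫ z, ψ z) * ∫ y in uball d, ψ (x - y) * g y ^ 2 := by
    intro x
    have h1 := sq_integral_mul_le (hψ.bddMeas_sub hs0 x) (BddMeas.const 1) hg (BddMeas.const 1)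
      (by simp) (fun y => hψ0 _) (by simp)
    simp only [mul_one, ← sq] at h1
    rw [← sq]
    refine h1.trans (mul_le_mul_of_nonneg_right ?_
      (integral_nonneg fun y => mul_nonneg (hψ0 _) (sq_nonneg _)))
    rw [← integral_sub_left_eq_self ψ volume x]
    exact setIntegral_le_integral (hI.comp_sub_left x) (Filter.Eventually.of_forall fun y => hψ0 _)
  have hprod : Integrable (fun p : Euc d × Euc d => ψ (p.1 - p.2) * g p.2 ^ 2)
      (volume.prod (volume.restrict (uball d))) := by
    have := hg2.convolution_integrand (ContinuousLinearMap.mul ℝ ℝ) hI (μ := volume)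
    simpa [mul_comm] using this
  calc ∫ x, convBall ψ g x * convBall ψ g x
      ≤ ∫ x, (∫ z, ψ z) * ∫ y in uball d, ψ (x - y) * g y ^ 2 := by
        refine integral_mono ?_ ?_ hpt
        · exact integrable_convBall_mul hs0 hs0 (by linarith) hψ hψ hg hg0 hg hg0
        · exact hprod.integral_prod_left.const_mul _
    _ = (∫ z, ψ z) * ∫ y in uball d, ∫ x, ψ (x - y) * g y ^ 2 := by
        rw [integral_const_mul, integral_integral_swap hprod]
    _ = _ := by
        simp_rw [integral_mul_const, integral_sub_right_eq_self ψ]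
        rw [integral_const_mul]; ring

/-- An energy identity for a family of kernels gives an `L²` bound for each of them. -/
lemma integral_convBall_sq_le_of_energy {s t : ℝ} (hs0 : 0 ≤ s) (hs : (d : ℝ) < s + s)
    (ht : (d : ℝ) < t) {N : Fin d → Euc d → ℝ} (hN : ∀ j, Decay s (N j)) (m : Fin d)
    {ψ : Euc d → ℝ} (hψ : Decay t ψ) (hψ0 : ∀ z, 0 ≤ ψ z)
    (hen : ∀ y y', ∑ j, ∫ x, N j (x - y) * N j (x - y') = ∫ x, N m (x - y) * ψ (x - y'))
    {g : Euc d → ℝ} (hg : BddMeas g) (hg0 : ∀ y ∉ uball d, g y = 0) (j : Fin d) :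
    ∫ x in uball d, convBall (N j) g x ^ 2 ≤ (∫ z, ψ z) ^ 2 * ∫ y in uball d, g y ^ 2 := by
  have ht0 : 0 ≤ t := (Nat.cast_nonneg d).trans ht.le
  have hNN : ∀ i, Integrable fun x => convBall (N i) g x * convBall (N i) g x := fun i =>
    integrable_convBall_mul hs0 hs0 hs (hN i) (hN i) hg hg0 hg hg0
  have hGG : Integrable fun x => convBall ψ g x * convBall ψ g x :=
    integrable_convBall_mul ht0 ht0 (by linarith) hψ hψ hg hg0 hg hg0
  have hNG : Integrable fun x => convBall (N m) g x * convBall ψ g x :=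
    integrable_convBall_mul hs0 ht0 (by linarith) (hN m) hψ hg hg0 hg hg0
  have hsum : ∑ i, ∫ x, convBall (N i) g x * convBall (N i) g x =
      ∫ x, convBall (N m) g x * convBall ψ g x := by
    rw [integral_convBall_mul hs0 ht0 (by linarith) (hN m) hψ hg hg0 hg hg0]
    simp_rw [integral_convBall_mul hs0 hs0 hs (hN _) (hN _) hg hg0 hg hg0]
    rw [← integral_finsetSum]
    · refine integral_congr_ae (Filter.Eventually.of_forall fun p => ?_)
      simp only
      rw [← Finset.sum_mul, hen]
    · intro i _
      have := (integrable_fubini_decay hs0 hs0 hs (hN i) (hN i) hg hg0 hg hg0).integral_prod_right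
      refine this.congr (Filter.Eventually.of_forall fun p => ?_)
      simp only
      rw [← integral_mul_const]
      refine integral_congr_ae (Filter.Eventually.of_forall fun x => ?_)
      simp only
      ring
  have hle : ∫ x, convBall (N m) g x * convBall ψ g x ≤
      (1 / 2) * (∫ x, convBall (N m) g x * convBall (N m) g x) +
        (1 / 2) * ∫ x, convBall ψ g x * convBall ψ g x := by
    rw [← integral_const_mul, ← integral_const_mul, ← integral_add ((hNN m).const_mul _)
      (hGG.const_mul _)]
    refine integral_mono hNG (((hNN m).const_mul _).add (hGG.const_mul _)) fun x => ?_
    simp only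
    nlinarith [sq_nonneg (convBall (N m) g x - convBall ψ g x)]
  have hnn : ∀ i, 0 ≤ ∫ x, convBall (N i) g x * convBall (N i) g x := fun i =>
    integral_nonneg fun x => mul_self_nonneg _
  have hm := Finset.single_le_sum (fun i _ => hnn i) (Finset.mem_univ m)
  have hj := Finset.single_le_sum (fun i _ => hnn i) (Finset.mem_univ j)
  have hY := integral_convBall_sq_le ht hψ hψ0 hg hg0
  have hset : ∫ x in uball d, convBall (N j) g x ^ 2 ≤
      ∫ x, convBall (N j) g x * convBall (N j) g x := by
    simp_rw [sq]
    exact setIntegral_le_integral (hNN j) (Filter.Eventually.of_forall fun x => mul_self_nonneg _)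
  linarith

end Decay

section Parametrix

variable {d : ℕ}

/-- The images of the standard basis vectors. -/
noncomputable def parVec (β : Euc d ≃L[ℝ] Euc d) (j : Fin d) : Euc d :=
  β (EuclideanSpace.single j 1)

/-- The regularized squared norm adapted to the operator. -/
noncomputable def parP (β : Euc d ≃L[ℝ] Euc d) (ε : ℝ) (z : Euc d) : ℝ :=
  ‖β.symm z‖ ^ 2 + ε ^ 2

/-- The regularized derivative of the fundamental solution. -/
noncomputable def parH (β : Euc d ≃L[ℝ] Euc d) (ε : ℝ) (k : Fin d) (z : Euc d) : ℝ :=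
  2 * β.symm z k * parP β ε z ^ (-((d : ℝ) / 2))

/-- The regularized second derivatives of the fundamental solution. -/
noncomputable def parN (β : Euc d ≃L[ℝ] Euc d) (ε : ℝ) (j k : Fin d) (z : Euc d) : ℝ :=
  2 * (EuclideanSpace.single j (1 : ℝ) k) * parP β ε z ^ (-((d : ℝ) / 2)) -
    2 * d * (β.symm z j * β.symm z k) * parP β ε z ^ (-((d : ℝ) / 2) - 1)

/-- The approximate identity produced by the operator. -/
noncomputable def parPsi (β : Euc d ≃L[ℝ] Euc d) (ε : ℝ) (z : Euc d) : ℝ :=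
  2 * d * ε ^ 2 * parP β ε z ^ (-((d : ℝ) / 2) - 1)

variable (β : Euc d ≃L[ℝ] Euc d) {ε : ℝ}

lemma symm_parVec (j : Fin d) : β.symm (parVec β j) = EuclideanSpace.single j 1 := by
  simp [parVec]

lemma parP_pos (hε : 0 < ε) (z : Euc d) : 0 < parP β ε z := by
  unfold parP; positivity

lemma hasDerivAt_symm_line (z : Euc d) (j k : Fin d) :
    HasDerivAt (fun t : ℝ => β.symm (z + t • parVec β j) k)
      (EuclideanSpace.single j (1 : ℝ) k) 0 := by
  have h : (fun t : ℝ => β.symm (z + t • parVec β j) k) =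
      fun t : ℝ => β.symm z k + t * EuclideanSpace.single j (1 : ℝ) k := by
    funext t
    rw [map_add, map_smul, symm_parVec]
    simp
  rw [h]
  simpa using ((hasDerivAt_id (0 : ℝ)).mul_const
    (EuclideanSpace.single j (1 : ℝ) k)).const_add (β.symm z k)

lemma hasDerivAt_parP_line (z : Euc d) (j : Fin d) :
    HasDerivAt (fun t : ℝ => parP β ε (z + t • parVec β j)) (2 * β.symm z j) 0 := by
  have h : (fun t : ℝ => parP β ε (z + t • parVec β j)) =
      fun t : ℝ => (‖β.symm z‖ ^ 2 + ε ^ 2) + (2 * β.symm z j * t + t ^ 2) := by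
    funext t
    unfold parP
    rw [map_add, map_smul, symm_parVec, norm_add_sq_real, norm_smul, inner_smul_right,
      EuclideanSpace.inner_single_right]
    simp
    ring
  rw [h]
  have h1 : HasDerivAt (fun t : ℝ => 2 * β.symm z j * t + t ^ 2) (2 * β.symm z j) 0 := by
    have := ((hasDerivAt_id (0 : ℝ)).const_mul (2 * β.symm z j)).add
      ((hasDerivAt_id (0 : ℝ)).pow 2)
    exact this.congr_deriv (by simp)
  exact h1.const_add _

lemma contDiff_symm_apply (k : Fin d) {n : WithTop ℕ∞} :
    ContDiff ℝ n fun z : Euc d => β.symm z k :=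
  ((EuclideanSpace.proj (𝕜 := ℝ) k).comp (β.symm : Euc d →L[ℝ] Euc d)).contDiff

lemma contDiff_parP {n : WithTop ℕ∞} : ContDiff ℝ n (parP β ε) :=
  ((contDiff_norm_sq ℝ).comp β.symm.contDiff).add contDiff_const

lemma contDiff_parP_rpow (hε : 0 < ε) (p : ℝ) {n : WithTop ℕ∞} :
    ContDiff ℝ n fun z => parP β ε z ^ p :=
  (contDiff_parP β).rpow_const_of_ne fun z => (parP_pos β hε z).ne'

lemma contDiff_parH (hε : 0 < ε) (k : Fin d) {n : WithTop ℕ∞} : ContDiff ℝ n (parH β ε k) :=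
  (contDiff_const.mul (contDiff_symm_apply β k)).mul (contDiff_parP_rpow β hε _)

lemma contDiff_parN (hε : 0 < ε) (j k : Fin d) {n : WithTop ℕ∞} :
    ContDiff ℝ n (parN β ε j k) :=
  (contDiff_const.mul (contDiff_parP_rpow β hε _)).sub ((contDiff_const.mul
    ((contDiff_symm_apply β j).mul (contDiff_symm_apply β k))).mul (contDiff_parP_rpow β hε _))

lemma contDiff_parPsi (hε : 0 < ε) {n : WithTop ℕ∞} : ContDiff ℝ n (parPsi β ε) :=
  contDiff_const.mul (contDiff_parP_rpow β hε _)

lemma hasDerivAt_parP_rpow_line (hε : 0 < ε) (p : ℝ) (z : Euc d) (j : Fin d) :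
    HasDerivAt (fun t : ℝ => parP β ε (z + t • parVec β j) ^ p)
      (2 * p * β.symm z j * parP β ε z ^ (p - 1)) 0 := by
  have := (hasDerivAt_parP_line β (ε := ε) z j).rpow_const (p := p)
    (by simpa using Or.inl (parP_pos β hε z).ne')
  exact this.congr_deriv (by simp only [zero_smul, add_zero]; ring)

lemma fderiv_parH (hε : 0 < ε) (j k : Fin d) (z : Euc d) :
    fderiv ℝ (parH β ε k) z (parVec β j) = parN β ε j k z := by
  refine fderiv_apply_eq_of_hasDerivAt_line
    ((contDiff_parH β hε k (n := 1)).differentiable one_ne_zero z) ?_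
  have := ((hasDerivAt_symm_line β z j k).const_mul 2).mul
    (hasDerivAt_parP_rpow_line β hε (-((d : ℝ) / 2)) z j)
  refine this.congr_deriv ?_
  simp only [zero_smul, add_zero]
  unfold parN
  ring

/-- The formula for the pure derivative of the second derivative kernel. -/
noncomputable def parNDeriv (β : Euc d ≃L[ℝ] Euc d) (ε : ℝ) (j k : Fin d) (z : Euc d) : ℝ :=
  -(2 * d * (2 * EuclideanSpace.single j (1 : ℝ) k * β.symm z j + β.symm z k) *
      parP β ε z ^ (-((d : ℝ) / 2) - 1)) +
    2 * d * (d + 2) * (β.symm z j ^ 2 * β.symm z k) * parP β ε z ^ (-((d : ℝ) / 2) - 2)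

lemma fderiv_parN (hε : 0 < ε) (j k : Fin d) (z : Euc d) :
    fderiv ℝ (parN β ε j k) z (parVec β j) = parNDeriv β ε j k z := by
  refine fderiv_apply_eq_of_hasDerivAt_line
    ((contDiff_parN β hε j k (n := 1)).differentiable one_ne_zero z) ?_
  have h1 := (hasDerivAt_parP_rpow_line β hε (-((d : ℝ) / 2)) z j).const_mul
    (2 * (EuclideanSpace.single j (1 : ℝ) k))
  have h2 := (((hasDerivAt_symm_line β z j j).mul (hasDerivAt_symm_line β z j k)).const_mul
    (2 * (d : ℝ))).mul (hasDerivAt_parP_rpow_line β hε (-((d : ℝ) / 2) - 1) z j)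
  refine (h1.sub h2).congr_deriv ?_
  have e : -((d : ℝ) / 2) - 1 - 1 = -((d : ℝ) / 2) - 2 := by ring
  simp only [zero_smul, add_zero, Pi.mul_apply, e]
  have hjj : EuclideanSpace.single j (1 : ℝ) j = 1 := by simp
  unfold parNDeriv
  rw [hjj]
  ring

lemma fderiv_parPsi (hε : 0 < ε) (k : Fin d) (z : Euc d) :
    fderiv ℝ (parPsi β ε) z (parVec β k) =
      -(2 * d * (d + 2) * ε ^ 2 * β.symm z k * parP β ε z ^ (-((d : ℝ) / 2) - 2)) := by
  refine fderiv_apply_eq_of_hasDerivAt_line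
    ((contDiff_parPsi β hε (n := 1)).differentiable one_ne_zero z) ?_
  have h1 := (hasDerivAt_parP_rpow_line β hε (-((d : ℝ) / 2) - 1) z k).const_mul
    (2 * (d : ℝ) * ε ^ 2)
  refine h1.congr_deriv ?_
  have e : -((d : ℝ) / 2) - 1 - 1 = -((d : ℝ) / 2) - 2 := by ring
  rw [e]; ring

lemma sum_parNDeriv (hε : 0 < ε) (k : Fin d) (z : Euc d) :
    ∑ j, parNDeriv β ε j k z = fderiv ℝ (parPsi β ε) z (parVec β k) := by
  rw [fderiv_parPsi β hε]
  have hP := parP_pos β hε z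
  have e : parP β ε z ^ (-((d : ℝ) / 2) - 1) =
      parP β ε z ^ (-((d : ℝ) / 2) - 2) * parP β ε z := by
    rw [← Real.rpow_add_one hP.ne']; congr 1; ring
  have hn : ∑ j, β.symm z j ^ 2 = parP β ε z - ε ^ 2 := by
    unfold parP; rw [EuclideanSpace.real_norm_sq_eq]; ring
  have hδ : ∑ j, EuclideanSpace.single j (1 : ℝ) k * β.symm z j = β.symm z k := by
    simp
  have hc : ∑ _j : Fin d, β.symm z k = d * β.symm z k := by simp
  unfold parNDeriv
  rw [Finset.sum_add_distrib, Finset.sum_neg_distrib, ← Finset.sum_mul, ← Finset.sum_mul,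
    ← Finset.mul_sum, ← Finset.mul_sum, Finset.sum_add_distrib, ← Finset.sum_mul, hn, hc]
  simp_rw [mul_assoc]
  rw [← Finset.mul_sum, hδ, e]
  ring

lemma abs_symm_apply_le (z : Euc d) (k : Fin d) : |β.symm z k| ≤ parP β ε z ^ (1 / 2 : ℝ) := by
  rw [← Real.sqrt_eq_rpow]
  refine Real.le_sqrt_of_sq_le ?_
  have := EuclideanSpace.real_norm_sq_eq (β.symm z)
  have h2 := Finset.single_le_sum (f := fun i => β.symm z i ^ 2) (fun i _ => sq_nonneg _)
    (Finset.mem_univ k)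
  unfold parP
  rw [sq_abs]
  simp only at h2
  nlinarith [sq_nonneg ε]

lemma abs_single_le_one (j k : Fin d) : |EuclideanSpace.single j (1 : ℝ) k| ≤ 1 := by
  by_cases h : k = j <;> simp [h]

lemma abs_parH_le (hε : 0 < ε) (k : Fin d) (z : Euc d) :
    |parH β ε k z| ≤ 2 * parP β ε z ^ (-(((d : ℝ) - 1) / 2)) := by
  have hP := parP_pos β hε z
  unfold parH
  rw [abs_mul, abs_mul, abs_two, abs_of_pos (Real.rpow_pos_of_pos hP _)]
  have e : parP β ε z ^ (-(((d : ℝ) - 1) / 2)) =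
      parP β ε z ^ (1 / 2 : ℝ) * parP β ε z ^ (-((d : ℝ) / 2)) := by
    rw [← Real.rpow_add hP]; congr 1; ring
  rw [e, ← mul_assoc]
  gcongr
  exact abs_symm_apply_le β z k

lemma abs_parN_le (hε : 0 < ε) (j k : Fin d) (z : Euc d) :
    |parN β ε j k z| ≤ (2 + 2 * d) * parP β ε z ^ (-((d : ℝ) / 2)) := by
  have hP := parP_pos β hε z
  have h1 := abs_symm_apply_le β (ε := ε) z j
  have h2 := abs_symm_apply_le β (ε := ε) z k
  have h3 := abs_single_le_one j k
  have e : parP β ε z ^ (-((d : ℝ) / 2)) =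
      parP β ε z ^ (1 / 2 : ℝ) * parP β ε z ^ (1 / 2 : ℝ) * parP β ε z ^ (-((d : ℝ) / 2) - 1) := by
    rw [← Real.rpow_add hP, ← Real.rpow_add hP]; congr 1; ring
  unfold parN
  refine (abs_sub _ _).trans ?_
  simp only [abs_mul, abs_two, Nat.abs_cast]
  rw [abs_of_pos (Real.rpow_pos_of_pos hP _), abs_of_pos (Real.rpow_pos_of_pos hP _), add_mul]
  refine add_le_add ?_ ?_
  · calc _ ≤ 2 * 1 * parP β ε z ^ (-((d : ℝ) / 2)) := by gcongr
      _ = _ := by ring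
  · rw [e]
    set r := parP β ε z ^ (1 / 2 : ℝ) with hr
    have hr0 : 0 ≤ r := by positivity
    calc _ ≤ 2 * d * (r * r) * parP β ε z ^ (-((d : ℝ) / 2) - 1) := by gcongr
      _ = _ := by ring

lemma abs_parNDeriv_le (hε : 0 < ε) (j k : Fin d) (z : Euc d) :
    |parNDeriv β ε j k z| ≤
      (2 * d * 3 + 2 * d * (d + 2)) * parP β ε z ^ (-(((d : ℝ) + 1) / 2)) := by
  have hP := parP_pos β hε z
  have h1 := abs_symm_apply_le β (ε := ε) z j
  have h2 := abs_symm_apply_le β (ε := ε) z k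
  have h3 := abs_single_le_one j k
  set r := parP β ε z ^ (1 / 2 : ℝ) with hr
  have hr0 : 0 ≤ r := by positivity
  have e1 : parP β ε z ^ (-(((d : ℝ) + 1) / 2)) = r * parP β ε z ^ (-((d : ℝ) / 2) - 1) := by
    rw [hr, ← Real.rpow_add hP]; congr 1; ring
  have e2 : parP β ε z ^ (-(((d : ℝ) + 1) / 2)) =
      r * r * r * parP β ε z ^ (-((d : ℝ) / 2) - 2) := by
    rw [hr, ← Real.rpow_add hP, ← Real.rpow_add hP, ← Real.rpow_add hP]; congr 1; ring
  unfold parNDeriv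
  refine (abs_add_le _ _).trans ?_
  rw [abs_neg, add_mul]
  refine add_le_add ?_ ?_
  · rw [e1, abs_mul, abs_mul, abs_of_nonneg (by positivity : (0 : ℝ) ≤ 2 * d),
      abs_of_pos (Real.rpow_pos_of_pos hP _)]
    have : |2 * EuclideanSpace.single j (1 : ℝ) k * β.symm z j + β.symm z k| ≤ 3 * r := by
      refine (abs_add_le _ _).trans ?_
      rw [abs_mul, abs_mul, abs_two]
      calc _ ≤ 2 * 1 * r + r := by gcongr
        _ = _ := by ring
    calc _ ≤ 2 * d * (3 * r) * parP β ε z ^ (-((d : ℝ) / 2) - 1) := by gcongr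
      _ = _ := by ring
  · rw [e2, abs_mul, abs_mul, abs_of_nonneg (by positivity : (0 : ℝ) ≤ 2 * d * (d + 2)),
      abs_of_pos (Real.rpow_pos_of_pos hP _), abs_mul, abs_pow]
    calc _ ≤ 2 * d * (d + 2) * (r ^ 2 * r) * parP β ε z ^ (-((d : ℝ) / 2) - 2) := by gcongr
      _ = _ := by ring

variable {β} {K : ℝ}

lemma add_norm_sq_le_parP (hK : 0 < K) (hβ : ∀ x, ‖β x‖ ≤ K * ‖x‖) (z : Euc d) :
    (K * ε + ‖z‖) ^ 2 / (2 * K ^ 2) ≤ parP β ε z := by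
  have h := hβ (β.symm z)
  rw [β.apply_symm_apply] at h
  unfold parP
  rw [div_le_iff₀ (by positivity)]
  have h2 : ‖z‖ ^ 2 ≤ (K * ‖β.symm z‖) ^ 2 := by gcongr
  nlinarith [sq_nonneg (K * ε - ‖z‖)]

lemma parP_rpow_le (hε : 0 < ε) (hK : 0 < K) (hβ : ∀ x, ‖β x‖ ≤ K * ‖x‖) {s : ℝ} (hs : 0 ≤ s)
    (z : Euc d) : parP β ε z ^ (-(s / 2)) ≤
      (2 * K ^ 2) ^ (s / 2) * (K * ε + ‖z‖) ^ (-s) := by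
  have ht : 0 < K * ε + ‖z‖ := by positivity
  calc _ ≤ ((K * ε + ‖z‖) ^ 2 / (2 * K ^ 2)) ^ (-(s / 2)) :=
        Real.rpow_le_rpow_of_nonpos (by positivity) (add_norm_sq_le_parP hK hβ z) (by linarith)
    _ = _ := by
        rw [Real.div_rpow (by positivity) (by positivity), ← Real.rpow_natCast _ 2,
          ← Real.rpow_mul ht.le, div_eq_mul_inv, ← Real.rpow_neg (by positivity), mul_comm]
        congr 1
        · congr 1; ring
        · congr 1; push_cast; ring

lemma decay_of_abs_le_parP_rpow (hε : 0 < ε) (hK : 0 < K) (hβ : ∀ x, ‖β x‖ ≤ K * ‖x‖)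
    {s : ℝ} (hs : 0 ≤ s) {f : Euc d → ℝ} (hf : Continuous f) {C : ℝ} (hC0 : 0 ≤ C)
    (hC : ∀ z, |f z| ≤ C * parP β ε z ^ (-(s / 2))) : Decay s f := by
  set m := min (K * ε) 1 with hm
  have hm0 : 0 < m := lt_min (by positivity) one_pos
  refine ⟨hf, C * ((2 * K ^ 2) ^ (s / 2) * m ^ (-s)), by positivity, fun z => (hC z).trans ?_⟩
  rw [mul_assoc, mul_assoc]
  refine mul_le_mul_of_nonneg_left ((parP_rpow_le hε hK hβ hs z).trans ?_) hC0
  refine mul_le_mul_of_nonneg_left ?_ (by positivity)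
  rw [← Real.mul_rpow hm0.le (by positivity)]
  refine Real.rpow_le_rpow_of_nonpos (by positivity) ?_ (by linarith)
  have h1 : m ≤ K * ε := min_le_left _ _
  have h2 : m ≤ 1 := min_le_right _ _
  nlinarith [norm_nonneg z]

lemma parPsi_nonneg (hε : 0 < ε) (z : Euc d) : 0 ≤ parPsi β ε z := by
  have := parP_pos β hε z
  unfold parPsi; positivity

lemma decay_parH [NeZero d] (hε : 0 < ε) (hK : 0 < K) (hβ : ∀ x, ‖β x‖ ≤ K * ‖x‖) (k : Fin d) :
    Decay ((d : ℝ) - 1) (parH β ε k) := by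
  have hd : (1 : ℝ) ≤ d := by exact_mod_cast NeZero.one_le
  exact decay_of_abs_le_parP_rpow hε hK hβ (by linarith) (contDiff_parH β hε k (n := 0)).continuous
    (by norm_num) (abs_parH_le β hε k)

lemma decay_parN (hε : 0 < ε) (hK : 0 < K) (hβ : ∀ x, ‖β x‖ ≤ K * ‖x‖) (j k : Fin d) :
    Decay d (parN β ε j k) :=
  decay_of_abs_le_parP_rpow hε hK hβ (Nat.cast_nonneg d)
    (contDiff_parN β hε j k (n := 0)).continuous (by positivity) (abs_parN_le β hε j k)

lemma decay_parNDeriv (hε : 0 < ε) (hK : 0 < K) (hβ : ∀ x, ‖β x‖ ≤ K * ‖x‖) (j k : Fin d) :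
    Decay ((d : ℝ) + 1) (parNDeriv β ε j k) := by
  refine decay_of_abs_le_parP_rpow hε hK hβ (by positivity) ?_ (by positivity)
    (abs_parNDeriv_le β hε j k)
  have h1 := fun i => (contDiff_symm_apply β i (n := 0)).continuous
  have h2 := fun p => (contDiff_parP_rpow β hε p (n := 0)).continuous
  exact ((continuous_const.mul ((continuous_const.mul (h1 j)).add (h1 k))).mul (h2 _)).neg.add
    ((continuous_const.mul (((h1 j).pow 2).mul (h1 k))).mul (h2 _))

lemma decay_parPsi (hε : 0 < ε) (hK : 0 < K) (hβ : ∀ x, ‖β x‖ ≤ K * ‖x‖) :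
    Decay ((d : ℝ) + 2) (parPsi β ε) := by
  refine decay_of_abs_le_parP_rpow (C := 2 * d * ε ^ 2) hε hK hβ (by positivity)
    (contDiff_parPsi β hε (n := 0)).continuous (by positivity) fun z => ?_
  rw [abs_of_nonneg (parPsi_nonneg hε z)]
  unfold parPsi
  apply le_of_eq
  congr 2; ring

lemma decay_fderiv_parPsi (hε : 0 < ε) (hK : 0 < K) (hβ : ∀ x, ‖β x‖ ≤ K * ‖x‖) (k : Fin d) :
    Decay ((d : ℝ) + 1) (fun z => fderiv ℝ (parPsi β ε) z (parVec β k)) := by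
  have h : (fun z => fderiv ℝ (parPsi β ε) z (parVec β k)) =
      fun z => ∑ j, parNDeriv β ε j k z := by
    funext z; rw [sum_parNDeriv β hε]
  rw [h]
  have : ∀ s : Finset (Fin d), Decay ((d : ℝ) + 1) (fun z => ∑ j ∈ s, parNDeriv β ε j k z) := by
    intro s
    induction s using Finset.induction_on with
    | empty => exact ⟨by simpa using continuous_const, 0, le_rfl, by simp⟩
    | insert a s ha ih =>
      simp only [Finset.sum_insert ha]
      exact (decay_parNDeriv hε hK hβ a k).add ih
  exact this _

end Parametrix

section ParametrixEnergy

variable {d : ℕ} {β : Euc d ≃L[ℝ] Euc d} {ε K : ℝ}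

lemma integral_mul_fderiv_sub {f g : Euc d → ℝ} {v y y' : Euc d}
    (hf : Differentiable ℝ f) (hg : Differentiable ℝ g)
    (h1 : Integrable fun x => fderiv ℝ f (x - y) v * g (x - y'))
    (h2 : Integrable fun x => f (x - y) * fderiv ℝ g (x - y') v)
    (h3 : Integrable fun x => f (x - y) * g (x - y')) :
    ∫ x, f (x - y) * fderiv ℝ g (x - y') v = -∫ x, fderiv ℝ f (x - y) v * g (x - y') := by
  have := integral_mul_fderiv_eq_neg_fderiv_mul_of_integrable (μ := (volume : Measure (Euc d)))
    (f := fun x => f (x - y)) (g := fun x => g (x - y')) (v := v)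
    (by simpa only [fderiv_comp_sub] using h1) (by simpa only [fderiv_comp_sub] using h2) h3
    (fun x _ => (hf (x - y)).comp x ((differentiableAt_id).sub_const y))
    (fun x _ => (hg (x - y')).comp x ((differentiableAt_id).sub_const y'))
  simpa only [fderiv_comp_sub] using this

lemma Decay.integrable_mul_sub {s t : ℝ} (hs : 0 ≤ s) (ht : 0 ≤ t) (hst : (d : ℝ) < s + t)
    {f g : Euc d → ℝ} (hf : Decay s f) (hg : Decay t g) (y y' : Euc d) :
    Integrable fun x => f (x - y) * g (x - y') :=
  ((hf.comp_sub hs y).mul (hg.comp_sub ht y')).integrable hst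

lemma decay_parN_of_eq_one (hd : d = 1) (hε : 0 < ε) (hK : 0 < K) (hβ : ∀ x, ‖β x‖ ≤ K * ‖x‖)
    (j k : Fin d) : Decay 3 (parN β ε j k) := by
  subst hd
  refine decay_of_abs_le_parP_rpow (C := 2 * ε ^ 2) hε hK hβ (by norm_num)
    (contDiff_parN β hε j k (n := 0)).continuous (by positivity) fun z => ?_
  have hP := parP_pos β hε z
  have hj : j = 0 := Subsingleton.elim _ _
  have hk : k = 0 := Subsingleton.elim _ _
  subst hj hk
  have hn : β.symm z 0 * β.symm z 0 = parP β ε z - ε ^ 2 := by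
    unfold parP; rw [EuclideanSpace.real_norm_sq_eq]; simp; ring
  have e : parP β ε z ^ (-((1 : ℕ) : ℝ) / 2) = parP β ε z ^ (-(3 : ℝ) / 2) * parP β ε z := by
    rw [← Real.rpow_add_one hP.ne']; congr 1; norm_num
  have h1 : EuclideanSpace.single (0 : Fin 1) (1 : ℝ) 0 = 1 := by simp
  have : parN β ε 0 0 z = 2 * ε ^ 2 * parP β ε z ^ (-(3 / 2) : ℝ) := by
    unfold parN
    rw [hn, h1, show (-(((1 : ℕ) : ℝ) / 2)) = -((1 : ℕ) : ℝ) / 2 by ring, e,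
      show (-((1 : ℕ) : ℝ) / 2 - 1) = -(3 : ℝ) / 2 by norm_num,
      show (-(3 / 2) : ℝ) = -(3 : ℝ) / 2 by norm_num]
    push_cast
    ring
  rw [this, abs_of_nonneg (by positivity)]

lemma integrable_parH_mul_parN [NeZero d] (hε : 0 < ε) (hK : 0 < K) (hβ : ∀ x, ‖β x‖ ≤ K * ‖x‖)
    (i j k : Fin d) (y y' : Euc d) :
    Integrable fun x => parH β ε i (x - y) * parN β ε j k (x - y') := by
  have hd : 1 ≤ d := NeZero.one_le
  have hd' : (1 : ℝ) ≤ d := by exact_mod_cast hd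
  rcases hd.eq_or_lt with h | h
  · refine Decay.integrable_mul_sub (by linarith) (by norm_num) ?_ (decay_parH hε hK hβ i)
      (decay_parN_of_eq_one h.symm hε hK hβ j k) y y'
    linarith
  · have : (1 : ℝ) < d := by exact_mod_cast h
    refine Decay.integrable_mul_sub (by linarith) (by linarith) ?_ (decay_parH hε hK hβ i)
      (decay_parN hε hK hβ j k) y y'
    linarith

lemma parN_energy [NeZero d] (hε : 0 < ε) (hK : 0 < K) (hβ : ∀ x, ‖β x‖ ≤ K * ‖x‖)
    (k : Fin d) (y y' : Euc d) :
    ∑ j, ∫ x, parN β ε j k (x - y) * parN β ε j k (x - y') =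
      ∫ x, parN β ε k k (x - y) * parPsi β ε (x - y') := by
  have hd : (1 : ℝ) ≤ d := by exact_mod_cast NeZero.one_le
  have hH : Differentiable ℝ (parH β ε k) :=
    (contDiff_parH β hε k (n := 1)).differentiable one_ne_zero
  have hHD : ∀ j, Integrable fun x => parH β ε k (x - y) * parNDeriv β ε j k (x - y') := fun j =>
    Decay.integrable_mul_sub (by linarith) (by linarith) (by linarith) (decay_parH hε hK hβ k)
      (decay_parNDeriv hε hK hβ j k) y y'
  have hNN : ∀ j, Integrable fun x => parN β ε j k (x - y) * parN β ε j k (x - y') := fun j =>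
    Decay.integrable_mul_sub (by linarith) (by linarith) (by linarith)
      (decay_parN hε hK hβ j k) (decay_parN hε hK hβ j k) y y'
  have hNP : Integrable fun x => parN β ε k k (x - y) * parPsi β ε (x - y') :=
    Decay.integrable_mul_sub (by linarith) (by linarith) (by linarith)
      (decay_parN hε hK hβ k k) (decay_parPsi hε hK hβ) y y'
  have h1 : ∀ j, ∫ x, parN β ε j k (x - y) * parN β ε j k (x - y') =
      -∫ x, parH β ε k (x - y) * parNDeriv β ε j k (x - y') := by
    intro j
    have := integral_mul_fderiv_sub (v := parVec β j) (y := y) (y' := y') hH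
      ((contDiff_parN β hε j k (n := 1)).differentiable one_ne_zero)
      (by simpa only [fderiv_parH β hε] using hNN j)
      (by simpa only [fderiv_parN β hε] using hHD j)
      (integrable_parH_mul_parN hε hK hβ k j k y y')
    simp only [fderiv_parH β hε, fderiv_parN β hε] at this
    rw [this, neg_neg]
  have h2 := integral_mul_fderiv_sub (v := parVec β k) (y := y) (y' := y') hH
      ((contDiff_parPsi β hε (n := 1)).differentiable one_ne_zero)
      (by simpa only [fderiv_parH β hε] using hNP)
      (Decay.integrable_mul_sub (by linarith) (by linarith) (by linarith)
          (decay_parH hε hK hβ k) (decay_fderiv_parPsi hε hK hβ k) y y')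
      (Decay.integrable_mul_sub (by linarith) (by linarith) (by linarith)
          (decay_parH hε hK hβ k) (decay_parPsi hε hK hβ) y y')
  simp only [fderiv_parH β hε] at h2
  rw [Finset.sum_congr rfl fun j _ => h1 j, Finset.sum_neg_distrib,
    ← integral_finsetSum _ fun j _ => hHD j]
  simp_rw [← Finset.mul_sum, sum_parNDeriv β hε]
  rw [h2, neg_neg]

lemma exists_integral_parPsi_le (d : ℕ) {K : ℝ} (hK : 0 < K) : ∃ A, 0 ≤ A ∧
    ∀ β : Euc d ≃L[ℝ] Euc d, (∀ x, ‖β x‖ ≤ K * ‖x‖) → ∀ ε, 0 < ε → ∫ z, parPsi β ε z ≤ A := by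
  set I := ∫ z : Euc d, (1 + ‖z‖) ^ (-((d : ℝ) + 2)) with hI
  have hI0 : 0 ≤ I := integral_one_add_norm_rpow_neg_nonneg _
  refine ⟨2 * d * ((2 * K ^ 2) ^ (((d : ℝ) + 2) / 2) * (K ^ (-2 : ℝ) * I)), by positivity,
    fun β hβ ε hε => ?_⟩
  have hs : (d : ℝ) < d + 2 := by linarith
  have hKε : 0 < K * ε := by positivity
  calc ∫ z, parPsi β ε z ≤ ∫ z : Euc d, 2 * d * ε ^ 2 * ((2 * K ^ 2) ^ (((d : ℝ) + 2) / 2) *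
          (K * ε + ‖z‖) ^ (-((d : ℝ) + 2))) := by
        refine integral_mono ((decay_parPsi hε hK hβ).integrable hs)
          (((integrable_add_norm_rpow_neg hs hKε).const_mul _).const_mul _) fun z => ?_
        have := parP_rpow_le hε hK hβ (by positivity : 0 ≤ (d : ℝ) + 2) z
        unfold parPsi
        rw [show -((d : ℝ) / 2) - 1 = -(((d : ℝ) + 2) / 2) by ring]
        exact mul_le_mul_of_nonneg_left this (by positivity)
    _ = _ := by
        rw [integral_const_mul, integral_const_mul, integral_add_norm_rpow_neg hKε,
          show (d : ℝ) - (d + 2) = -2 by ring, Real.mul_rpow hK.le hε.le]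
        have : ε ^ (-2 : ℝ) = (ε ^ 2)⁻¹ := by
          rw [Real.rpow_neg hε.le]; norm_cast
        rw [this, ← hI]
        field_simp

end ParametrixEnergy

section ParametrixWeakType

variable {d : ℕ} {β : Euc d ≃L[ℝ] Euc d} {ε K : ℝ}

lemma abs_mul_mul_sub_le {a a' b b' c c' δ κ C : ℝ} (ha' : |a'| ≤ 1) (hb : |b| ≤ 1)
    (hb' : |b'| ≤ 1) (hc : |c| ≤ C) (had : |a - a'| ≤ δ) (hbd : |b - b'| ≤ δ)
    (hcd : |c - c'| ≤ κ) : |a * b * c - a' * b' * c'| ≤ 2 * δ * C + κ := by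
  have hδ : 0 ≤ δ := (abs_nonneg _).trans had
  have e : a * b * c - a' * b' * c' =
      (a - a') * b * c + a' * (b - b') * c + a' * b' * (c - c') := by ring
  rw [e]
  refine (abs_add_three _ _ _).trans ?_
  simp only [abs_mul]
  have h1 : |a - a'| * |b| * |c| ≤ δ * 1 * C := by gcongr
  have h2 : |a'| * |b - b'| * |c| ≤ 1 * δ * C := by gcongr
  have h3 : |a'| * |b'| * |c - c'| ≤ 1 * 1 * κ := by gcongr
  linarith

lemma abs_div_sub_div_le {p p' r r' m Δ : ℝ} (hm : 0 < m) (hr : m ≤ r) (hr' : m ≤ r')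
    (hp' : |p'| ≤ r') (hp : |p - p'| ≤ Δ) (hrr : |r - r'| ≤ Δ) :
    |p / r - p' / r'| ≤ 2 * Δ / m := by
  have h0 : 0 < r := hm.trans_le hr
  have h0' : 0 < r' := hm.trans_le hr'
  have hΔ : 0 ≤ Δ := (abs_nonneg _).trans hp
  have e : p / r - p' / r' = (p - p') / r - p' / r' * (r - r') / r := by field_simp; ring
  rw [e]
  refine (abs_sub _ _).trans ?_
  rw [abs_div, abs_div, abs_mul, abs_div, abs_of_pos h0, abs_of_pos h0']
  have h1 : |p'| / r' ≤ 1 := (div_le_one h0').2 hp'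
  have h2 : |p - p'| / r ≤ Δ / m := by gcongr
  have h3 : |p'| / r' * |r - r'| / r ≤ 1 * Δ / m := by gcongr
  calc _ ≤ Δ / m + 1 * Δ / m := add_le_add h2 h3
    _ = _ := by ring

lemma norm_symm_le_sqrt_parP (β : Euc d ≃L[ℝ] Euc d) (ε : ℝ) (z : Euc d) :
    ‖β.symm z‖ ≤ √(parP β ε z) :=
  Real.le_sqrt_of_sq_le (by unfold parP; nlinarith [sq_nonneg ε])

lemma abs_apply_le_norm (z : Euc d) (k : Fin d) : |z k| ≤ ‖z‖ := by
  simpa using PiLp.norm_apply_le z k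

lemma abs_sqrt_parP_sub_le (hε : 0 < ε) (z z' : Euc d) :
    |√(parP β ε z) - √(parP β ε z')| ≤ ‖β.symm z - β.symm z'‖ := by
  have hr := Real.sqrt_pos.2 (parP_pos β hε z)
  have hr' := Real.sqrt_pos.2 (parP_pos β hε z')
  have h1 := norm_symm_le_sqrt_parP β ε z
  have h2 := norm_symm_le_sqrt_parP β ε z'
  have h3 := abs_norm_sub_norm_le (β.symm z) (β.symm z')
  have s1 := Real.sq_sqrt (parP_pos β hε z).le
  have s2 := Real.sq_sqrt (parP_pos β hε z').le
  have e : (√(parP β ε z) - √(parP β ε z')) * (√(parP β ε z) + √(parP β ε z')) =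
      (‖β.symm z‖ - ‖β.symm z'‖) * (‖β.symm z‖ + ‖β.symm z'‖) := by
    have : parP β ε z - parP β ε z' = ‖β.symm z‖ ^ 2 - ‖β.symm z'‖ ^ 2 := by unfold parP; ring
    nlinarith
  have e' := congrArg abs e
  rw [abs_mul, abs_mul, abs_of_pos (add_pos hr hr'),
    abs_of_nonneg (add_nonneg (norm_nonneg (β.symm z)) (norm_nonneg (β.symm z')))] at e'
  refine le_of_mul_le_mul_right ?_ (add_pos hr hr')
  rw [e']
  gcongr

lemma parN_eq (hε : 0 < ε) (j k : Fin d) (z : Euc d) : parN β ε j k z =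
    2 * EuclideanSpace.single j (1 : ℝ) k * (√(parP β ε z) ^ d)⁻¹ -
      2 * d * ((β.symm z j / √(parP β ε z)) * (β.symm z k / √(parP β ε z)) *
        (√(parP β ε z) ^ d)⁻¹) := by
  have hP := parP_pos β hε z
  have hr := Real.sqrt_pos.2 hP
  have h1 := rpow_neg_half_eq_inv_sqrt_pow hP.le d
  have h2 := rpow_neg_half_eq_inv_sqrt_pow hP.le (d + 2)
  unfold parN
  rw [h1, show -((d : ℝ) / 2) - 1 = -(((d + 2 : ℕ) : ℝ) / 2) by push_cast; ring, h2, pow_add]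
  field_simp

lemma abs_parN_sub_le (hε : 0 < ε) (j k : Fin d) {z z' : Euc d} {m Δ : ℝ} (hm : 0 < m)
    (hz : m ≤ ‖β.symm z‖) (hz' : m ≤ ‖β.symm z'‖) (hΔ : ‖β.symm z - β.symm z'‖ ≤ Δ) :
    |parN β ε j k z - parN β ε j k z'| ≤ (2 * d + 2 * d * (4 + d)) * Δ / m ^ (d + 1) := by
  set r := √(parP β ε z) with hr
  set r' := √(parP β ε z') with hr'
  have h1 := norm_symm_le_sqrt_parP β ε z
  have h2 := norm_symm_le_sqrt_parP β ε z'
  have hrr := (abs_sqrt_parP_sub_le (β := β) hε z z').trans hΔ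
  rw [← hr] at h1 hrr
  rw [← hr'] at h2 hrr
  have hmr := hz.trans h1
  have hmr' := hz'.trans h2
  have hr0 := hm.trans_le hmr
  have hr0' := hm.trans_le hmr'
  have hc := abs_inv_pow_sub_inv_pow_le hm hmr hmr' d
  have hc2 : |(r ^ d)⁻¹ - (r' ^ d)⁻¹| ≤ d * Δ / m ^ (d + 1) := hc.trans (by gcongr)
  have hin : ∀ i (w : Euc d), |β.symm w i| ≤ ‖β.symm w‖ := fun i w => abs_apply_le_norm _ i
  have hle : ∀ i, |β.symm z i / r| ≤ 1 := fun i => by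
    rw [abs_div, abs_of_pos hr0]; exact (div_le_one hr0).2 ((hin i z).trans h1)
  have hle' : ∀ i, |β.symm z' i / r'| ≤ 1 := fun i => by
    rw [abs_div, abs_of_pos hr0']; exact (div_le_one hr0').2 ((hin i z').trans h2)
  have hdiff : ∀ i, |β.symm z i / r - β.symm z' i / r'| ≤ 2 * Δ / m := fun i =>
    abs_div_sub_div_le hm hmr hmr' ((hin i z').trans h2)
      ((abs_apply_le_norm (β.symm z - β.symm z') i).trans hΔ) hrr
  have hC : |(r ^ d)⁻¹| ≤ (m ^ d)⁻¹ := by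
    rw [abs_of_nonneg (by positivity)]; gcongr
  have h3 := abs_mul_mul_sub_le (hle' j) (hle k) (hle' k) hC (hdiff j) (hdiff k) hc2
  have h4 := abs_single_le_one j k
  rw [parN_eq hε, parN_eq hε, ← hr, ← hr']
  set X := β.symm z j / r * (β.symm z k / r) * (r ^ d)⁻¹
  set X' := β.symm z' j / r' * (β.symm z' k / r') * (r' ^ d)⁻¹
  have e : 2 * EuclideanSpace.single j (1 : ℝ) k * (r ^ d)⁻¹ - 2 * d * X -
      (2 * EuclideanSpace.single j (1 : ℝ) k * (r' ^ d)⁻¹ - 2 * d * X') =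
      2 * EuclideanSpace.single j (1 : ℝ) k * ((r ^ d)⁻¹ - (r' ^ d)⁻¹) - 2 * d * (X - X') := by
    ring
  rw [e]
  refine (abs_sub _ _).trans ?_
  rw [abs_mul, abs_mul, abs_mul _ (X - X'), abs_mul, abs_two, Nat.abs_cast]
  calc _ ≤ 2 * 1 * (d * Δ / m ^ (d + 1)) +
        2 * d * (2 * (2 * Δ / m) * (m ^ d)⁻¹ + d * Δ / m ^ (d + 1)) := by gcongr
    _ = _ := by rw [pow_succ]; field_simp; ring

lemma norm_div_le_norm_symm (hK : 0 < K) (hβ : ∀ x, ‖β x‖ ≤ K * ‖x‖) (z : Euc d) :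
    ‖z‖ / K ≤ ‖β.symm z‖ := by
  rw [div_le_iff₀ hK, mul_comm]
  simpa using hβ (β.symm z)

lemma parN_hormander (hε : 0 < ε) (hK : 0 < K) (hβ : ∀ x, ‖β x‖ ≤ K * ‖x‖)
    (hβ' : ∀ x, ‖β.symm x‖ ≤ K * ‖x‖) (j k : Fin d) {x y y' : Euc d}
    (h : 2 * ‖y - y'‖ ≤ ‖x - y‖) : |parN β ε j k (x - y) - parN β ε j k (x - y')| ≤
      (2 * d + 2 * d * (4 + d)) * K * (2 * K) ^ (d + 1) * ‖y - y'‖ / ‖x - y‖ ^ (d + 1) := by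
  rcases (norm_nonneg (x - y)).eq_or_lt with h0 | h0
  · have : y = y' := by
      rw [← sub_eq_zero, ← norm_eq_zero]
      exact le_antisymm (by linarith) (norm_nonneg _)
    simp [this]
  have hm : 0 < ‖x - y‖ / (2 * K) := by positivity
  have h1 : ‖x - y‖ / (2 * K) ≤ ‖x - y‖ / K := by gcongr; linarith
  have h2 : ‖x - y‖ / (2 * K) ≤ ‖x - y'‖ / K := by
    rw [← div_div]
    gcongr
    have := norm_sub_le_norm_sub_add_norm_sub x y' y
    rw [norm_sub_rev y' y] at this
    linarith
  have h3 : ‖β.symm (x - y) - β.symm (x - y')‖ ≤ K * ‖y - y'‖ := by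
    rw [← map_sub, show x - y - (x - y') = y' - y by abel, norm_sub_rev y y']
    exact hβ' _
  refine (abs_parN_sub_le hε j k hm (h1.trans (norm_div_le_norm_symm hK hβ _))
    (h2.trans (norm_div_le_norm_symm hK hβ _)) h3).trans (le_of_eq ?_)
  rw [div_pow]
  field_simp

lemma setIntegral_indicator_mul (s : Set (Euc d)) (hs : MeasurableSet s) (a g : Euc d → ℝ) :
    ∫ y in s, a y * s.indicator g y = ∫ y in s, a y * g y :=
  setIntegral_congr_fun hs fun y hy => by simp only [indicator_of_mem hy]

/-- Weak type bound for the singular integral part of the parametrix. -/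
theorem weak_type_parN [NeZero d] (hK : 0 < K) : ∃ C, 0 < C ∧ ∀ β : Euc d ≃L[ℝ] Euc d,
    (∀ x, ‖β x‖ ≤ K * ‖x‖) → (∀ x, ‖β.symm x‖ ≤ K * ‖x‖) → ∀ ε, 0 < ε → ∀ j k : Fin d,
    ∀ f, BddMeas f → ContinuousOn f (uball d) → ∀ α, 0 < α →
    volume {x ∈ uball d | α < |∫ y in uball d, parN β ε j k (x - y) * f y|} ≤
      ENNReal.ofReal (C / α * ∫ y in uball d, |f y|) := by
  have hd : (1 : ℝ) ≤ d := by exact_mod_cast NeZero.one_le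
  obtain ⟨A, hA0, hA⟩ := exists_integral_parPsi_le d hK
  set B := (2 * d + 2 * d * (4 + d)) * K * (2 * K) ^ (d + 1) with hB
  have hB0 : 0 < B := by positivity
  obtain ⟨C, hC0, hC⟩ := weak_type_one_one (d := d) (A := A ^ 2 + B) (by positivity)
  refine ⟨C, hC0, fun β hβ hβ' ε hε j k => ?_⟩
  have hdec := decay_parN (β := β) hε hK hβ
  refine hC (fun x y => parN β ε j k (x - y)) ?_ ?_ ?_ ?_
  · exact ((hdec j k).1.comp (continuous_fst.sub continuous_snd)).measurable
  · obtain ⟨M, hM⟩ := (hdec j k).exists_bound (Nat.cast_nonneg d)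
    exact ⟨M, fun x y => hM _⟩
  · intro g hg
    have h := integral_convBall_sq_le_of_energy (Nat.cast_nonneg d) (by linarith) (by linarith)
      (fun i => hdec i k) k (decay_parPsi hε hK hβ) (parPsi_nonneg hε)
      (parN_energy hε hK hβ k) (hg.indicator measurableSet_ball)
      (fun y hy => indicator_of_notMem hy g) j
    unfold convBall at h
    simp_rw [setIntegral_indicator_mul _ measurableSet_ball] at h
    have h2 : ∫ y in uball d, (uball d).indicator g y ^ 2 = ∫ y in uball d, g y ^ 2 :=
      setIntegral_congr_fun measurableSet_ball fun y hy => by simp only [indicator_of_mem hy]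
    rw [h2] at h
    refine h.trans (mul_le_mul_of_nonneg_right ?_ (integral_nonneg fun y => sq_nonneg _))
    have := hA β hβ ε hε
    have h0 : 0 ≤ ∫ z, parPsi β ε z := integral_nonneg (parPsi_nonneg hε)
    nlinarith
  · intro x _ y _ y' _ h
    refine (parN_hormander hε hK hβ hβ' j k h).trans ?_
    gcongr
    nlinarith

end ParametrixWeakType

section ParametrixLimit

variable {d : ℕ} {β : Euc d ≃L[ℝ] Euc d} {ε K : ℝ}

lemma parPsi_smul (hε : 0 < ε) (z : Euc d) :
    parPsi β ε (ε • z) = (ε ^ d)⁻¹ * parPsi β 1 z := by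
  have h : parP β ε (ε • z) = ε ^ 2 * parP β 1 z := by
    unfold parP; rw [map_smul, norm_smul, Real.norm_of_nonneg hε.le]; ring
  have hP := parP_pos β one_pos z
  unfold parPsi
  rw [h, Real.mul_rpow (by positivity) hP.le]
  have e : (ε ^ 2) ^ (-((d : ℝ) / 2) - 1) = (ε ^ d)⁻¹ * (ε ^ 2)⁻¹ := by
    rw [← Real.rpow_natCast ε 2, ← Real.rpow_natCast ε d, ← Real.rpow_mul hε.le,
      ← Real.rpow_neg hε.le, ← Real.rpow_neg hε.le, ← Real.rpow_add hε]
    congr 1; push_cast; ring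
  rw [e]
  field_simp

lemma integral_parPsi_sub_mul (hε : 0 < ε) (G : Euc d → ℝ) (x : Euc d) :
    ∫ y, parPsi β ε (x - y) * G y = ∫ z, parPsi β 1 z * G (x - ε • z) := by
  have h1 := integral_sub_left_eq_self (fun w => parPsi β ε w * G (x - w)) volume x
  have h2 := Measure.integral_comp_smul (volume : Measure (Euc d))
    (fun w => parPsi β ε w * G (x - w)) ε
  simp only [sub_sub_cancel] at h1
  rw [h1]
  simp_rw [parPsi_smul hε, mul_assoc] at h2
  rw [integral_const_mul, finrank_euclideanSpace_fin, smul_eq_mul,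
    abs_of_pos (by positivity)] at h2
  exact (mul_left_cancel₀ (by positivity) h2).symm

lemma tendsto_integral_parPsi (hK : 0 < K) (hβ : ∀ x, ‖β x‖ ≤ K * ‖x‖) {G : Euc d → ℝ}
    (hG : BddMeas G) {x : Euc d} (hx : ContinuousAt G x) :
    Filter.Tendsto (fun ε => ∫ y, parPsi β ε (x - y) * G y) (nhdsWithin 0 (Ioi 0))
      (nhds ((∫ z, parPsi β 1 z) * G x)) := by
  have hψ := decay_parPsi (β := β) one_pos hK hβ
  have hI : Integrable (parPsi β 1) := hψ.integrable (by linarith)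
  obtain ⟨hm, M, hM⟩ := hG
  rw [← integral_mul_const]
  have : Filter.Tendsto (fun ε : ℝ => ∫ z, parPsi β 1 z * G (x - ε • z)) (nhdsWithin 0 (Ioi 0))
      (nhds (∫ z, parPsi β 1 z * G x)) := by
    refine tendsto_integral_filter_of_dominated_convergence (fun z => |parPsi β 1 z| * M) ?_ ?_
      (hI.abs.mul_const M) ?_
    · refine Filter.Eventually.of_forall fun ε => ?_
      exact (hψ.1.measurable.mul (hm.comp (measurable_const.sub
        (measurable_id.const_smul ε)))).aestronglyMeasurable
    · refine Filter.Eventually.of_forall fun ε => Filter.Eventually.of_forall fun z => ?_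
      rw [norm_mul]
      exact mul_le_mul_of_nonneg_left (hM _) (abs_nonneg _)
    · refine Filter.Eventually.of_forall fun z => Filter.Tendsto.const_mul _ ?_
      refine hx.tendsto.comp ?_
      have h : Continuous fun ε : ℝ => x - ε • z := by fun_prop
      have := h.tendsto 0
      simp only [zero_smul, sub_zero] at this
      exact this.mono_left nhdsWithin_le_nhds
  refine this.congr' ?_
  filter_upwards [self_mem_nhdsWithin] with ε hε
  exact (integral_parPsi_sub_mul hε G x).symm

lemma exists_le_integral_parPsi (d : ℕ) [NeZero d] {K : ℝ} (hK : 0 < K) : ∃ c, 0 < c ∧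
    ∀ β : Euc d ≃L[ℝ] Euc d, (∀ x, ‖β x‖ ≤ K * ‖x‖) → (∀ x, ‖β.symm x‖ ≤ K * ‖x‖) →
      c ≤ ∫ z, parPsi β 1 z := by
  have hd : 0 < (d : ℝ) := by exact_mod_cast NeZero.pos d
  have hc0 : 0 < 2 * d * (K ^ 2 + 1) ^ (-((d : ℝ) / 2) - 1) := by positivity
  refine ⟨2 * d * (K ^ 2 + 1) ^ (-((d : ℝ) / 2) - 1) * volume.real (uball d),
    mul_pos hc0 volume_real_uball_pos, fun β hβ hβ' => ?_⟩
  have hI : Integrable (parPsi β 1) := (decay_parPsi (β := β) one_pos hK hβ).integrable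
    (by linarith)
  have h1 : ∫ z in uball d, parPsi β 1 z ≤ ∫ z, parPsi β 1 z :=
    setIntegral_le_integral hI (Filter.Eventually.of_forall (parPsi_nonneg one_pos))
  refine le_trans ?_ h1
  have h2 : ∫ _z in uball d, (2 * d * (K ^ 2 + 1) ^ (-((d : ℝ) / 2) - 1)) ≤
      ∫ z in uball d, parPsi β 1 z := by
    refine setIntegral_mono_on (integrable_const _) hI.integrableOn measurableSet_ball
      fun z hz => ?_
    have hz' : ‖z‖ < 1 := by simpa using hz
    unfold parPsi
    rw [one_pow, mul_one]
    refine mul_le_mul_of_nonneg_left ?_ (by positivity)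
    refine Real.rpow_le_rpow_of_nonpos (parP_pos β one_pos z) ?_ (by linarith)
    unfold parP
    have := hβ' z
    have h3 : ‖β.symm z‖ ≤ K := this.trans (by nlinarith)
    have h4 : ‖β.symm z‖ ^ 2 ≤ K ^ 2 := by gcongr
    linarith
  simpa [mul_comm] using h2

end ParametrixLimit

section Corrected

variable {d : ℕ}

/-- The pairing of a point with the direction `parVec β m`. -/
noncomputable def corEta (β : Euc d ≃L[ℝ] Euc d) (m : Fin d) (y : Euc d) : ℝ :=
  inner ℝ y (parVec β m)

/-- The squared distance, corrected by a multiple of the boundary defining function. -/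
noncomputable def corR (β : Euc d ≃L[ℝ] Euc d) (ε c : ℝ) (x y : Euc d) : ℝ :=
  parP β ε (x - y) + c * bdryQ y

/-- The linear factor, corrected by a multiple of the boundary defining function. -/
noncomputable def corL (β : Euc d ≃L[ℝ] Euc d) (k : Fin d) (c' : ℝ) (x y : Euc d) : ℝ :=
  2 * β.symm (x - y) k + c' * bdryQ y

/-- The corrected parametrix. -/
noncomputable def corPhi (β : Euc d ≃L[ℝ] Euc d) (ε c c' : ℝ) (k : Fin d) (x y : Euc d) : ℝ :=
  corR β ε c x y ^ (-((d : ℝ) / 2)) * corL β k c' x y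

/-- First derivatives of `corPhi`. -/
noncomputable def corPhiD (β : Euc d ≃L[ℝ] Euc d) (ε c c' : ℝ) (k m : Fin d) (x y : Euc d) : ℝ :=
  corR β ε c x y ^ (-((d : ℝ) / 2)) *
      (-2 * EuclideanSpace.single m (1 : ℝ) k - 2 * c' * corEta β m y) +
    d * (β.symm (x - y) m + c * corEta β m y) * corR β ε c x y ^ (-((d : ℝ) / 2) - 1) *
      corL β k c' x y

/-- Pure second derivatives of `corPhi`. -/
noncomputable def corPhiDD (β : Euc d ≃L[ℝ] Euc d) (ε c c' : ℝ) (k m : Fin d) (x y : Euc d) : ℝ :=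
  -2 * c' * ‖parVec β m‖ ^ 2 * corR β ε c x y ^ (-((d : ℝ) / 2)) +
    2 * d * (β.symm (x - y) m + c * corEta β m y) * corR β ε c x y ^ (-((d : ℝ) / 2) - 1) *
      (-2 * EuclideanSpace.single m (1 : ℝ) k - 2 * c' * corEta β m y) +
    d * (-1 + c * ‖parVec β m‖ ^ 2) * corR β ε c x y ^ (-((d : ℝ) / 2) - 1) * corL β k c' x y +
    d * (d + 2) * (β.symm (x - y) m + c * corEta β m y) ^ 2 *
      corR β ε c x y ^ (-((d : ℝ) / 2) - 2) * corL β k c' x y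

variable (β : Euc d ≃L[ℝ] Euc d) {ε c c' : ℝ} {x y : Euc d}

lemma hasDerivAt_symm_sub_line (x y : Euc d) (m k : Fin d) :
    HasDerivAt (fun t : ℝ => β.symm (x - (y + t • parVec β m)) k)
      (-EuclideanSpace.single m (1 : ℝ) k) 0 := by
  have h : (fun t : ℝ => β.symm (x - (y + t • parVec β m)) k) =
      fun t : ℝ => β.symm (x - y) k - t * EuclideanSpace.single m (1 : ℝ) k := by
    funext t
    rw [← sub_sub, map_sub, map_smul, symm_parVec]
    simp
  rw [h]
  simpa using ((hasDerivAt_id (0 : ℝ)).mul_const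
    (EuclideanSpace.single m (1 : ℝ) k)).const_sub (β.symm (x - y) k)

lemma hasDerivAt_corEta_line (y : Euc d) (m : Fin d) :
    HasDerivAt (fun t : ℝ => corEta β m (y + t • parVec β m)) (‖parVec β m‖ ^ 2) 0 := by
  have h : (fun t : ℝ => corEta β m (y + t • parVec β m)) =
      fun t : ℝ => corEta β m y + t * ‖parVec β m‖ ^ 2 := by
    funext t
    unfold corEta
    rw [inner_add_left, real_inner_smul_left, real_inner_self_eq_norm_sq]
  rw [h]
  simpa using ((hasDerivAt_id (0 : ℝ)).mul_const (‖parVec β m‖ ^ 2)).const_add (corEta β m y)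

lemma hasDerivAt_parP_sub_line (x y : Euc d) (m : Fin d) :
    HasDerivAt (fun t : ℝ => parP β ε (x - (y + t • parVec β m)))
      (-2 * β.symm (x - y) m) 0 := by
  have h : (fun t : ℝ => parP β ε (x - (y + t • parVec β m))) =
      (fun t : ℝ => parP β ε (x - y + t • parVec β m)) ∘ fun t : ℝ => -t := by
    funext t
    simp only [Function.comp_apply]
    congr 1
    module
  rw [h]
  have h1 := hasDerivAt_parP_line β (ε := ε) (x - y) m
  have h2 : HasDerivAt (fun t : ℝ => -t) (-1) 0 := (hasDerivAt_id (0 : ℝ)).neg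
  refine (HasDerivAt.comp (0 : ℝ) (by simpa using h1) h2).congr_deriv
    (by simp only [map_sub, PiLp.sub_apply]; ring)

lemma hasDerivAt_corR_line (x y : Euc d) (m : Fin d) :
    HasDerivAt (fun t : ℝ => corR β ε c x (y + t • parVec β m))
      (-2 * (β.symm (x - y) m + c * corEta β m y)) 0 := by
  refine ((hasDerivAt_parP_sub_line β x y m).add
    ((hasDerivAt_bdryQ_line y (parVec β m)).const_mul c)).congr_deriv ?_
  unfold corEta; ring

lemma hasDerivAt_corL_line (x y : Euc d) (k m : Fin d) :
    HasDerivAt (fun t : ℝ => corL β k c' x (y + t • parVec β m))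
      (-2 * EuclideanSpace.single m (1 : ℝ) k - 2 * c' * corEta β m y) 0 := by
  refine (((hasDerivAt_symm_sub_line β x y m k).const_mul 2).add
    ((hasDerivAt_bdryQ_line y (parVec β m)).const_mul c')).congr_deriv ?_
  unfold corEta; ring

variable {β}

lemma corR_pos (hε : 0 < ε) (hc : 0 ≤ c) (x : Euc d) {y : Euc d} (hy : y ∈ closedBall 0 1) :
    0 < corR β ε c x y := by
  have hy' : ‖y‖ ≤ 1 := by simpa using hy
  have hq : 0 ≤ bdryQ y := by unfold bdryQ; nlinarith [norm_nonneg y]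
  exact add_pos_of_pos_of_nonneg (parP_pos β hε _) (mul_nonneg hc hq)

lemma hasDerivAt_corR_rpow_line (hR : 0 < corR β ε c x y) (p : ℝ) (m : Fin d) :
    HasDerivAt (fun t : ℝ => corR β ε c x (y + t • parVec β m) ^ p)
      (-2 * p * (β.symm (x - y) m + c * corEta β m y) * corR β ε c x y ^ (p - 1)) 0 := by
  have := (hasDerivAt_corR_line β (ε := ε) (c := c) x y m).rpow_const (p := p)
    (by simpa using Or.inl hR.ne')
  exact this.congr_deriv (by simp only [zero_smul, add_zero]; ring)

lemma hasDerivAt_corPhi_line (hR : 0 < corR β ε c x y) (k m : Fin d) :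
    HasDerivAt (fun t : ℝ => corPhi β ε c c' k x (y + t • parVec β m))
      (corPhiD β ε c c' k m x y) 0 := by
  refine ((hasDerivAt_corR_rpow_line hR _ m).mul
    (hasDerivAt_corL_line β (c' := c') x y k m)).congr_deriv ?_
  simp only [zero_smul, add_zero]
  unfold corPhiD
  ring

lemma hasDerivAt_corPhiD_line (hR : 0 < corR β ε c x y) (k m : Fin d) :
    HasDerivAt (fun t : ℝ => corPhiD β ε c c' k m x (y + t • parVec β m))
      (corPhiDD β ε c c' k m x y) 0 := by
  have hη := hasDerivAt_corEta_line β y m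
  have h1 := (hasDerivAt_corR_rpow_line hR (-((d : ℝ) / 2)) m).mul
    ((hη.const_mul (2 * c')).const_sub (-2 * EuclideanSpace.single m (1 : ℝ) k))
  have h2 := (((((hasDerivAt_symm_sub_line β x y m m).add (hη.const_mul c)).const_mul (d : ℝ)).mul
    (hasDerivAt_corR_rpow_line hR (-((d : ℝ) / 2) - 1) m)).mul
    (hasDerivAt_corL_line β (c' := c') x y k m))
  refine (h1.add h2).congr_deriv ?_
  have e : -((d : ℝ) / 2) - 1 - 1 = -((d : ℝ) / 2) - 2 := by ring
  have hjj : EuclideanSpace.single m (1 : ℝ) m = 1 := by simp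
  simp only [zero_smul, add_zero, Pi.mul_apply, Pi.add_apply, e, hjj]
  unfold corPhiDD
  ring

lemma contDiffOn_corR_rpow (hε : 0 < ε) (hc : 0 ≤ c) (x : Euc d) (p : ℝ) {n : WithTop ℕ∞} :
    ContDiffOn ℝ n (fun y => corR β ε c x y ^ p) (closedBall 0 1) := by
  refine ContDiffOn.rpow_const_of_ne (ContDiff.contDiffOn ?_) fun y hy => (corR_pos hε hc x hy).ne'
  exact ((contDiff_parP β).comp (contDiff_const.sub contDiff_id)).add
    (contDiff_const.mul contDiff_bdryQ)

lemma contDiff_corEta (m : Fin d) {n : WithTop ℕ∞} : ContDiff ℝ n (corEta β m) :=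
  contDiff_id.inner ℝ contDiff_const

lemma contDiff_symm_sub (x : Euc d) (k : Fin d) {n : WithTop ℕ∞} :
    ContDiff ℝ n fun y => β.symm (x - y) k :=
  (contDiff_symm_apply β k).comp (contDiff_const.sub contDiff_id)

lemma contDiff_corL (x : Euc d) (k : Fin d) {n : WithTop ℕ∞} : ContDiff ℝ n (corL β k c' x) :=
  (contDiff_const.mul (contDiff_symm_sub x k)).add (contDiff_const.mul contDiff_bdryQ)

lemma contDiffOn_corPhi (hε : 0 < ε) (hc : 0 ≤ c) (x : Euc d) (k : Fin d) {n : WithTop ℕ∞} :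
    ContDiffOn ℝ n (corPhi β ε c c' k x) (closedBall 0 1) :=
  (contDiffOn_corR_rpow hε hc x _).mul (contDiff_corL x k).contDiffOn

lemma contDiffOn_corPhiD (hε : 0 < ε) (hc : 0 ≤ c) (x : Euc d) (k m : Fin d) {n : WithTop ℕ∞} :
    ContDiffOn ℝ n (corPhiD β ε c c' k m x) (closedBall 0 1) :=
  ((contDiffOn_corR_rpow hε hc x _).mul
    (contDiff_const.sub (contDiff_const.mul (contDiff_corEta m))).contDiffOn).add
  ((((contDiff_const.mul ((contDiff_symm_sub x m).add
    (contDiff_const.mul (contDiff_corEta m)))).contDiffOn).mul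
    (contDiffOn_corR_rpow hε hc x _)).mul (contDiff_corL x k).contDiffOn)

lemma fderiv_corPhi (hε : 0 < ε) (hc : 0 ≤ c) (x : Euc d) {y : Euc d} (hy : y ∈ uball d)
    (k m : Fin d) :
    fderiv ℝ (corPhi β ε c c' k x) y (parVec β m) = corPhiD β ε c c' k m x y :=
  fderiv_apply_eq_of_hasDerivAt_line ((contDiffOn_corPhi hε hc x k).differentiableAt_uball hy)
    (hasDerivAt_corPhi_line (corR_pos hε hc x (ball_subset_closedBall hy)) k m)

lemma fderiv_corPhiD (hε : 0 < ε) (hc : 0 ≤ c) (x : Euc d) {y : Euc d} (hy : y ∈ uball d)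
    (k m : Fin d) :
    fderiv ℝ (corPhiD β ε c c' k m x) y (parVec β m) = corPhiDD β ε c c' k m x y :=
  fderiv_apply_eq_of_hasDerivAt_line ((contDiffOn_corPhiD hε hc x k m).differentiableAt_uball hy)
    (hasDerivAt_corPhiD_line (corR_pos hε hc x (ball_subset_closedBall hy)) k m)

lemma parP_sub_eq_inner (β : Euc d ≃L[ℝ] Euc d) (x y : Euc d) :
    ∑ m, β.symm (x - y) m * corEta β m y = inner ℝ (x - y) y := by
  have h : ∑ m, β.symm (x - y) m • parVec β m = x - y := by
    have h1 : ∑ m, β.symm (x - y) m • EuclideanSpace.single m (1 : ℝ) = β.symm (x - y) := by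
      ext i
      simp [Finset.sum_apply, Pi.single_apply]
    have h2 := congrArg β h1
    simpa [map_sum, parVec] using h2
  conv_rhs => rw [← h]
  rw [sum_inner]
  refine Finset.sum_congr rfl fun m _ => ?_
  rw [real_inner_smul_left, real_inner_comm]
  rfl

/-- The leading error term in `sum_corPhiDD`. -/
noncomputable def corE (β : Euc d ≃L[ℝ] Euc d) (c : ℝ) (x y : Euc d) : ℝ :=
  c * bdryQ x + c * ‖x - y‖ ^ 2 - c ^ 2 * ∑ m, corEta β m y ^ 2

lemma two_mul_inner_sub (x y : Euc d) :
    2 * inner ℝ (x - y) y = bdryQ y - bdryQ x - ‖x - y‖ ^ 2 := by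
  rw [norm_sub_sq_real, inner_sub_left, real_inner_self_eq_norm_sq]
  unfold bdryQ
  ring

lemma sum_sq_corR (β : Euc d ≃L[ℝ] Euc d) (ε c : ℝ) (x y : Euc d) :
    ∑ m, (β.symm (x - y) m + c * corEta β m y) ^ 2 = corR β ε c x y - ε ^ 2 - corE β c x y := by
  have e : ∀ m, (β.symm (x - y) m + c * corEta β m y) ^ 2 = β.symm (x - y) m ^ 2 +
      2 * c * (β.symm (x - y) m * corEta β m y) + c ^ 2 * corEta β m y ^ 2 := fun m => by ring
  simp_rw [e]
  rw [Finset.sum_add_distrib, Finset.sum_add_distrib, ← Finset.mul_sum, ← Finset.mul_sum,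
    parP_sub_eq_inner, ← EuclideanSpace.real_norm_sq_eq]
  have := two_mul_inner_sub x y
  unfold corR corE parP
  linear_combination c * this

lemma sum_corPhiDD (hR : 0 < corR β ε c x y) (k : Fin d) : ∑ m, corPhiDD β ε c c' k m x y =
    -2 * c' * (∑ m, ‖parVec β m‖ ^ 2) * corR β ε c x y ^ (-((d : ℝ) / 2)) +
    (d * c * (∑ m, ‖parVec β m‖ ^ 2) * corL β k c' x y +
      2 * d * (c' * (bdryQ x + ‖x - y‖ ^ 2) - 2 * c * corEta β k y -
        2 * c * c' * ∑ m, corEta β m y ^ 2)) * corR β ε c x y ^ (-((d : ℝ) / 2) - 1) -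
    d * (d + 2) * (corE β c x y + ε ^ 2) * corL β k c' x y *
      corR β ε c x y ^ (-((d : ℝ) / 2) - 2) := by
  have e1 : corR β ε c x y ^ (-((d : ℝ) / 2) - 1) =
      corR β ε c x y ^ (-((d : ℝ) / 2) - 2) * corR β ε c x y := by
    rw [← Real.rpow_add_one hR.ne']; congr 1; ring
  have hsq := sum_sq_corR β ε c x y
  have hcross : ∑ m, (β.symm (x - y) m + c * corEta β m y) *
      (-2 * EuclideanSpace.single m (1 : ℝ) k - 2 * c' * corEta β m y) =
      -2 * β.symm (x - y) k - 2 * c * corEta β k y - c' * (bdryQ y - bdryQ x - ‖x - y‖ ^ 2) -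
        2 * c * c' * ∑ m, corEta β m y ^ 2 := by
    have e : ∀ m, (β.symm (x - y) m + c * corEta β m y) *
      (-2 * EuclideanSpace.single m (1 : ℝ) k - 2 * c' * corEta β m y) =
      -2 * (EuclideanSpace.single m (1 : ℝ) k * β.symm (x - y) m) -
      2 * c * (EuclideanSpace.single m (1 : ℝ) k * corEta β m y) -
      2 * c' * (β.symm (x - y) m * corEta β m y) - 2 * c * c' * corEta β m y ^ 2 :=
      fun m => by ring
    have hδ : ∀ g : Fin d → ℝ, ∑ m, EuclideanSpace.single m (1 : ℝ) k * g m = g k := by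
      intro g; simp
    simp_rw [e]
    rw [Finset.sum_sub_distrib, Finset.sum_sub_distrib, Finset.sum_sub_distrib, ← Finset.mul_sum,
      ← Finset.mul_sum, ← Finset.mul_sum, ← Finset.mul_sum, parP_sub_eq_inner, hδ, hδ]
    linear_combination -c' * two_mul_inner_sub x y
  have e : ∀ m, corPhiDD β ε c c' k m x y =
      (-2 * c' * corR β ε c x y ^ (-((d : ℝ) / 2))) * ‖parVec β m‖ ^ 2 +
      2 * d * corR β ε c x y ^ (-((d : ℝ) / 2) - 1) * ((β.symm (x - y) m + c * corEta β m y) *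
        (-2 * EuclideanSpace.single m (1 : ℝ) k - 2 * c' * corEta β m y)) -
      d * corR β ε c x y ^ (-((d : ℝ) / 2) - 1) * corL β k c' x y +
      d * c * corR β ε c x y ^ (-((d : ℝ) / 2) - 1) * corL β k c' x y * ‖parVec β m‖ ^ 2 +
      d * (d + 2) * corR β ε c x y ^ (-((d : ℝ) / 2) - 2) * corL β k c' x y *
        (β.symm (x - y) m + c * corEta β m y) ^ 2 := fun m => by unfold corPhiDD; ring
  simp_rw [e]
  rw [Finset.sum_add_distrib, Finset.sum_add_distrib, Finset.sum_sub_distrib,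
    Finset.sum_add_distrib, ← Finset.mul_sum, ← Finset.mul_sum, ← Finset.mul_sum,
    ← Finset.mul_sum, ← Finset.mul_sum, hsq, hcross, Finset.sum_const, Finset.card_univ,
    Fintype.card_fin,
    nsmul_eq_mul, e1]
  unfold corL
  ring

end Corrected

section CorrectedBounds

variable {d : ℕ} {β : Euc d ≃L[ℝ] Euc d} {K ε : ℝ} {x y : Euc d}

/-- The normalization of the boundary correction at the pole `x`. -/
noncomputable def corDen (β : Euc d ≃L[ℝ] Euc d) (K : ℝ) (x : Euc d) : ℝ :=
  ∑ m, corEta β m x ^ 2 + bdryQ x / K ^ 2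

/-- The coefficient correcting the squared distance. -/
noncomputable def corC (β : Euc d ≃L[ℝ] Euc d) (K : ℝ) (x : Euc d) : ℝ :=
  bdryQ x / corDen β K x

/-- The coefficient correcting the linear factor. -/
noncomputable def corC' (β : Euc d ≃L[ℝ] Euc d) (K : ℝ) (k : Fin d) (x : Euc d) : ℝ :=
  -2 * corEta β k x / corDen β K x

lemma norm_parVec_le (hβ : ∀ x, ‖β x‖ ≤ K * ‖x‖) (m : Fin d) : ‖parVec β m‖ ≤ K := by
  simpa [parVec] using hβ (EuclideanSpace.single m 1)

lemma abs_corEta_le (hβ : ∀ x, ‖β x‖ ≤ K * ‖x‖) (m : Fin d) (y : Euc d) :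
    |corEta β m y| ≤ K * ‖y‖ := by
  refine (abs_real_inner_le_norm _ _).trans ?_
  rw [mul_comm]
  exact mul_le_mul_of_nonneg_right (norm_parVec_le hβ m) (norm_nonneg _)

lemma abs_corEta_sub_le (hβ : ∀ x, ‖β x‖ ≤ K * ‖x‖) (m : Fin d) (x y : Euc d) :
    |corEta β m x - corEta β m y| ≤ K * ‖x - y‖ := by
  have : corEta β m x - corEta β m y = corEta β m (x - y) := (inner_sub_left _ _ _).symm
  rw [this]
  exact abs_corEta_le hβ m _

lemma norm_sq_le_sum_corEta (hK : 1 ≤ K) (hβ' : ∀ x, ‖β.symm x‖ ≤ K * ‖x‖) (y : Euc d) :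
    ‖y‖ ^ 2 / K ^ 2 ≤ ∑ m, corEta β m y ^ 2 := by
  have h1 := parP_sub_eq_inner β (y + y) y
  rw [add_sub_cancel_right, real_inner_self_eq_norm_sq] at h1
  have h2 := Finset.sum_mul_sq_le_sq_mul_sq Finset.univ (fun m => β.symm y m) fun m => corEta β m y
  simp only [h1] at h2
  rw [← EuclideanSpace.real_norm_sq_eq] at h2
  set S := ∑ m, corEta β m y ^ 2 with hS
  have hS0 : 0 ≤ S := Finset.sum_nonneg fun m _ => sq_nonneg _
  have h3 : ‖β.symm y‖ ^ 2 ≤ (K * ‖y‖) ^ 2 := by gcongr; exact hβ' y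
  rw [div_le_iff₀ (by positivity)]
  rcases (norm_nonneg y).eq_or_lt with h0 | h0
  · rw [← h0]; simpa using by positivity
  · have h4 : (‖y‖ ^ 2) ^ 2 ≤ (K * ‖y‖) ^ 2 * S := h2.trans (by gcongr)
    have h5 : ‖y‖ ^ 2 * ‖y‖ ^ 2 ≤ S * K ^ 2 * ‖y‖ ^ 2 := by linarith
    exact le_of_mul_le_mul_right h5 (by positivity)

lemma inv_sq_le_corDen (hK : 1 ≤ K) (hβ' : ∀ x, ‖β.symm x‖ ≤ K * ‖x‖) (x : Euc d) :
    1 / K ^ 2 ≤ corDen β K x := by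
  have h := norm_sq_le_sum_corEta (β := β) hK hβ' x
  have e : 1 / K ^ 2 = ‖x‖ ^ 2 / K ^ 2 + bdryQ x / K ^ 2 := by unfold bdryQ; ring
  unfold corDen
  linarith

lemma corDen_pos (hK : 1 ≤ K) (hβ' : ∀ x, ‖β.symm x‖ ≤ K * ‖x‖) (x : Euc d) :
    0 < corDen β K x := lt_of_lt_of_le (by positivity) (inv_sq_le_corDen hK hβ' x)

lemma abs_corEta_le_of_mem (hK : 1 ≤ K) (hβ : ∀ x, ‖β x‖ ≤ K * ‖x‖) (m : Fin d)
    (hy : y ∈ uball d) : |corEta β m y| ≤ K := by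
  have : ‖y‖ < 1 := by simpa using hy
  exact (abs_corEta_le hβ m y).trans (by nlinarith)

lemma corDen_le (hK : 1 ≤ K) (hβ : ∀ x, ‖β x‖ ≤ K * ‖x‖) (hx : x ∈ uball d) :
    corDen β K x ≤ (d + 1) * K ^ 2 := by
  have h1 : ∑ m, corEta β m x ^ 2 ≤ ∑ _m : Fin d, K ^ 2 := by
    refine Finset.sum_le_sum fun m _ => ?_
    have := abs_corEta_le_of_mem hK hβ m hx
    rw [← sq_abs]
    gcongr
  have h2 : bdryQ x / K ^ 2 ≤ K ^ 2 := by
    rw [div_le_iff₀ (by positivity)]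
    have h3 : 1 ≤ K ^ 2 := one_le_pow₀ hK
    nlinarith [bdryQ_le_one x]
  have h3 : ∑ _m : Fin d, K ^ 2 = d * K ^ 2 := by simp
  unfold corDen
  linarith

lemma corC_nonneg (hK : 1 ≤ K) (hβ' : ∀ x, ‖β.symm x‖ ≤ K * ‖x‖) (hx : x ∈ uball d) :
    0 ≤ corC β K x := div_nonneg (bdryQ_pos hx).le (corDen_pos hK hβ' x).le

lemma inv_corDen_le (hK : 1 ≤ K) (hβ' : ∀ x, ‖β.symm x‖ ≤ K * ‖x‖) (x : Euc d) :
    (corDen β K x)⁻¹ ≤ K ^ 2 := by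
  have := inv_anti₀ (by positivity) (inv_sq_le_corDen (β := β) hK hβ' x)
  simpa using this

lemma corC_le (hK : 1 ≤ K) (hβ' : ∀ x, ‖β.symm x‖ ≤ K * ‖x‖) (hx : x ∈ uball d) :
    corC β K x ≤ K ^ 2 * bdryQ x := by
  unfold corC
  rw [div_eq_mul_inv, mul_comm]
  exact mul_le_mul_of_nonneg_right (inv_corDen_le hK hβ' x) (bdryQ_pos hx).le

lemma le_corC (hK : 1 ≤ K) (hβ : ∀ x, ‖β x‖ ≤ K * ‖x‖) (hβ' : ∀ x, ‖β.symm x‖ ≤ K * ‖x‖)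
    (hx : x ∈ uball d) : bdryQ x / ((d + 1) * K ^ 2) ≤ corC β K x :=
  div_le_div_of_nonneg_left (bdryQ_pos hx).le (corDen_pos hK hβ' x) (corDen_le hK hβ hx)

lemma abs_corC'_le (hK : 1 ≤ K) (hβ : ∀ x, ‖β x‖ ≤ K * ‖x‖) (hβ' : ∀ x, ‖β.symm x‖ ≤ K * ‖x‖)
    (k : Fin d) (hx : x ∈ uball d) : |corC' β K k x| ≤ 2 * K ^ 3 := by
  unfold corC'
  rw [abs_div, abs_mul, abs_of_pos (corDen_pos hK hβ' x), div_eq_mul_inv, abs_neg, abs_two]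
  calc _ ≤ 2 * K * K ^ 2 := by
        gcongr
        · exact inv_nonneg.2 (corDen_pos hK hβ' x).le
        · exact abs_corEta_le_of_mem hK hβ k hx
        · exact inv_corDen_le hK hβ' x
    _ = _ := by ring

lemma bdryRho_le_corR (hK : 1 ≤ K) (hβ : ∀ x, ‖β x‖ ≤ K * ‖x‖)
    (hβ' : ∀ x, ‖β.symm x‖ ≤ K * ‖x‖) (hx : x ∈ uball d) (hy : y ∈ uball d) :
    bdryRho ε x y / (5 * ((d + 1) * K ^ 2)) ≤ corR β ε (corC β K x) x y := by
  have h1 := norm_div_le_norm_symm (by linarith) hβ (x - y)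
  have h2 := le_corC hK hβ hβ' hx
  have hqx := bdryQ_pos hx
  have hqy := bdryQ_pos hy
  have hQ := abs_bdryQ_sub_le hx hy
  set a := (d + 1) * K ^ 2 with ha
  have hK2 : 1 ≤ K ^ 2 := one_le_pow₀ hK
  have ha1 : K ^ 2 ≤ a := by
    have : (0 : ℝ) ≤ d := Nat.cast_nonneg d
    nlinarith
  have ha0 : 0 < a := by linarith
  have h3 : ‖x - y‖ ^ 2 / a ≤ ‖β.symm (x - y)‖ ^ 2 := by
    calc _ ≤ ‖x - y‖ ^ 2 / K ^ 2 := by gcongr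
      _ = (‖x - y‖ / K) ^ 2 := by rw [div_pow]
      _ ≤ _ := by gcongr
  have h4 : bdryQ x * bdryQ y / a ≤ corC β K x * bdryQ y := by
    calc _ = bdryQ x / a * bdryQ y := by ring
      _ ≤ _ := by gcongr
  have h5 : ε ^ 2 / a ≤ ε ^ 2 := div_le_self (sq_nonneg _) (by linarith)
  have h6 : bdryRho ε x y ≤ 5 * (‖x - y‖ ^ 2 + ε ^ 2 + bdryQ x * bdryQ y) := by
    have : (bdryQ x - bdryQ y) ^ 2 ≤ (2 * ‖x - y‖) ^ 2 := by
      rw [← sq_abs (bdryQ x - bdryQ y)]; gcongr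
    unfold bdryRho
    nlinarith [mul_pos hqx hqy, sq_nonneg ε]
  calc _ ≤ 5 * (‖x - y‖ ^ 2 + ε ^ 2 + bdryQ x * bdryQ y) / (5 * a) := by gcongr
    _ = ‖x - y‖ ^ 2 / a + ε ^ 2 / a + bdryQ x * bdryQ y / a := by field_simp
    _ ≤ _ := by unfold corR parP; linarith

lemma corR_rpow_le (hε : 0 < ε) (hK : 1 ≤ K) (hβ : ∀ x, ‖β x‖ ≤ K * ‖x‖)
    (hβ' : ∀ x, ‖β.symm x‖ ≤ K * ‖x‖) (hx : x ∈ uball d) (hy : y ∈ uball d) (n : ℕ) :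
    corR β ε (corC β K x) x y ^ (-((d : ℝ) / 2) - n) ≤
      (5 * ((d + 1) * K ^ 2)) ^ ((d : ℝ) / 2 + n) *
        (bdryKer ε x y / (√(bdryRho ε x y)) ^ (2 * n)) := by
  have hρ := bdryRho_pos hε x y
  have h := bdryRho_le_corR (ε := ε) hK hβ hβ' hx hy
  have ha : 0 < 5 * ((d + 1 : ℝ) * K ^ 2) := by positivity
  calc _ ≤ (bdryRho ε x y / (5 * ((d + 1) * K ^ 2))) ^ (-((d : ℝ) / 2) - n) :=
        Real.rpow_le_rpow_of_nonpos (by positivity) h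
          (by have : (0 : ℝ) ≤ (d : ℝ) / 2 + n := by positivity
              linarith)
    _ = _ := by
        rw [Real.div_rpow hρ.le ha.le, pow_mul, Real.sq_sqrt hρ.le, div_eq_mul_inv,
          ← Real.rpow_neg ha.le, mul_comm, Real.rpow_sub hρ, Real.rpow_natCast]
        congr 2
        ring

lemma abs_corL_le (hK : 1 ≤ K) (hβ : ∀ x, ‖β x‖ ≤ K * ‖x‖) (hβ' : ∀ x, ‖β.symm x‖ ≤ K * ‖x‖)
    (k : Fin d) (hx : x ∈ uball d) (hy : y ∈ uball d) :
    |corL β k (corC' β K k x) x y| ≤ 4 * K ^ 3 * √(bdryRho ε x y) := by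
  have h1 := (abs_apply_le_norm (β.symm (x - y)) k).trans (hβ' _)
  have h2 := norm_sub_le_sqrt_bdryRho ε x y
  have h3 := bdryQ_le_sqrt_bdryRho ε x y
  have h4 := abs_corC'_le hK hβ hβ' k hx
  set r := √(bdryRho ε x y)
  have hr : 0 ≤ r := (norm_nonneg _).trans h2
  unfold corL
  refine (abs_add_le _ _).trans ?_
  rw [abs_mul, abs_mul, abs_two, abs_of_pos (bdryQ_pos hy)]
  have hK3 : K ≤ K ^ 3 := le_self_pow₀ hK (by norm_num)
  calc _ ≤ 2 * (K * r) + 2 * K ^ 3 * r :=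
        add_le_add (by gcongr; exact h1.trans (by gcongr))
          (mul_le_mul h4 h3 (bdryQ_pos hy).le (by positivity))
    _ ≤ 2 * (K ^ 3 * r) + 2 * K ^ 3 * r := by gcongr
    _ = _ := by ring

lemma bdryQ_le_sqrt_bdryRho_left (ε : ℝ) (x y : Euc d) : bdryQ x ≤ √(bdryRho ε x y) := by
  rw [bdryRho_comm]; exact bdryQ_le_sqrt_bdryRho ε y x

lemma corC_le_sqrt (hK : 1 ≤ K) (hβ' : ∀ x, ‖β.symm x‖ ≤ K * ‖x‖) (hx : x ∈ uball d) :
    corC β K x ≤ K ^ 2 * √(bdryRho ε x y) :=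
  (corC_le hK hβ' hx).trans
    (mul_le_mul_of_nonneg_left (bdryQ_le_sqrt_bdryRho_left ε x y) (by positivity))

lemma abs_corDen_sub_le (hK : 1 ≤ K) (hβ : ∀ x, ‖β x‖ ≤ K * ‖x‖)
    (hx : x ∈ uball d) (hy : y ∈ uball d) :
    |corDen β K x - ∑ m, corEta β m y ^ 2| ≤ (2 * d * K ^ 2 + 1) * √(bdryRho ε x y) := by
  have h2 := norm_sub_le_sqrt_bdryRho ε x y
  have h3 := bdryQ_le_sqrt_bdryRho_left ε x y
  set r := √(bdryRho ε x y)
  have hr : 0 ≤ r := (norm_nonneg _).trans h2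
  have e : corDen β K x - ∑ m, corEta β m y ^ 2 =
      ∑ m, (corEta β m x ^ 2 - corEta β m y ^ 2) + bdryQ x / K ^ 2 := by
    rw [Finset.sum_sub_distrib]; unfold corDen; ring
  have h4 : |∑ m, (corEta β m x ^ 2 - corEta β m y ^ 2)| ≤ ∑ _m : Fin d, 2 * K ^ 2 * r := by
    refine (Finset.abs_sum_le_sum_abs _ _).trans (Finset.sum_le_sum fun m _ => ?_)
    have e2 : corEta β m x ^ 2 - corEta β m y ^ 2 =
      (corEta β m x - corEta β m y) * (corEta β m x + corEta β m y) := by ring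
    rw [e2, abs_mul]
    have h5 := abs_corEta_sub_le hβ m x y
    have h6 := (abs_add_le (corEta β m x) (corEta β m y)).trans
      (add_le_add (abs_corEta_le_of_mem hK hβ m hx) (abs_corEta_le_of_mem hK hβ m hy))
    calc _ ≤ K * r * (K + K) := by
          gcongr
          exact h5.trans (by gcongr)
      _ = _ := by ring
  have h5 : |bdryQ x / K ^ 2| ≤ r := by
    rw [abs_of_nonneg (div_nonneg (bdryQ_pos hx).le (by positivity))]
    exact (div_le_self (bdryQ_pos hx).le (one_le_pow₀ hK)).trans h3
  rw [e]
  refine (abs_add_le _ _).trans ((add_le_add h4 h5).trans (le_of_eq ?_))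
  rw [Finset.sum_const, Finset.card_univ, Fintype.card_fin, nsmul_eq_mul]
  ring

lemma corC_mul_corDen (hK : 1 ≤ K) (hβ' : ∀ x, ‖β.symm x‖ ≤ K * ‖x‖) (x : Euc d) :
    corC β K x * corDen β K x = bdryQ x := div_mul_cancel₀ _ (corDen_pos hK hβ' x).ne'

lemma corC'_mul_corDen (hK : 1 ≤ K) (hβ' : ∀ x, ‖β.symm x‖ ≤ K * ‖x‖) (k : Fin d) (x : Euc d) :
    corC' β K k x * corDen β K x = -2 * corEta β k x := div_mul_cancel₀ _ (corDen_pos hK hβ' x).ne'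

lemma abs_corE_le (hK : 1 ≤ K) (hβ : ∀ x, ‖β x‖ ≤ K * ‖x‖) (hβ' : ∀ x, ‖β.symm x‖ ≤ K * ‖x‖)
    (hx : x ∈ uball d) (hy : y ∈ uball d) : |corE β (corC β K x) x y| ≤
      (K ^ 4 * (2 * d * K ^ 2 + 1) + K ^ 2) * √(bdryRho ε x y) ^ 3 := by
  have h1 := corC_mul_corDen (β := β) hK hβ' x
  have h2 := norm_sub_le_sqrt_bdryRho ε x y
  have h3 := abs_corDen_sub_le (ε := ε) hK hβ hx hy
  have h4 := corC_le_sqrt (ε := ε) (y := y) hK hβ' hx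
  have h5 := corC_nonneg hK hβ' hx
  set r := √(bdryRho ε x y)
  set c := corC β K x
  have hr : 0 ≤ r := (norm_nonneg _).trans h2
  have e : corE β c x y =
      c ^ 2 * (corDen β K x - ∑ m, corEta β m y ^ 2) + c * ‖x - y‖ ^ 2 := by
    unfold corE; rw [← h1]; ring
  rw [e]
  refine (abs_add_le _ _).trans ?_
  rw [abs_mul, abs_mul, abs_of_nonneg h5, abs_of_nonneg (sq_nonneg c),
    abs_of_nonneg (sq_nonneg ‖x - y‖)]
  calc _ ≤ (K ^ 2 * r) ^ 2 * ((2 * d * K ^ 2 + 1) * r) + K ^ 2 * r * r ^ 2 := by gcongr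
    _ = _ := by ring

lemma abs_corMid_le (hK : 1 ≤ K) (hβ : ∀ x, ‖β x‖ ≤ K * ‖x‖) (hβ' : ∀ x, ‖β.symm x‖ ≤ K * ‖x‖)
    (k : Fin d) (hx : x ∈ uball d) (hy : y ∈ uball d) :
    |corC' β K k x * (bdryQ x + ‖x - y‖ ^ 2) - 2 * corC β K x * corEta β k y -
      2 * corC β K x * corC' β K k x * ∑ m, corEta β m y ^ 2| ≤
      (4 * K ^ 3 + 4 * K ^ 5 * (2 * d * K ^ 2 + 1)) * √(bdryRho ε x y) ^ 2 := by
  have h1 := corC_mul_corDen (β := β) hK hβ' x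
  have h1' := corC'_mul_corDen (β := β) hK hβ' k x
  have h2 := norm_sub_le_sqrt_bdryRho ε x y
  have h3 := abs_corDen_sub_le (ε := ε) hK hβ hx hy
  have h4 := corC_le_sqrt (ε := ε) (y := y) hK hβ' hx
  have h5 := corC_nonneg hK hβ' hx
  have h6 := abs_corC'_le hK hβ hβ' k hx
  have h7 := abs_corEta_sub_le hβ k x y
  set r := √(bdryRho ε x y)
  set c := corC β K x
  set c' := corC' β K k x
  have hr : 0 ≤ r := (norm_nonneg _).trans h2
  have e : c' * (bdryQ x + ‖x - y‖ ^ 2) - 2 * c * corEta β k y -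
      2 * c * c' * ∑ m, corEta β m y ^ 2 = c' * ‖x - y‖ ^ 2 +
      2 * c * (corEta β k x - corEta β k y) +
      2 * c * c' * (corDen β K x - ∑ m, corEta β m y ^ 2) := by
    rw [← h1]
    linear_combination (-c) * h1'
  rw [e]
  refine (abs_add_three _ _ _).trans ?_
  simp only [abs_mul, abs_two, abs_of_nonneg h5, abs_of_nonneg (sq_nonneg ‖x - y‖)]
  calc _ ≤ 2 * K ^ 3 * r ^ 2 + 2 * (K ^ 2 * r) * (K * r) +
        2 * (K ^ 2 * r) * (2 * K ^ 3) * ((2 * d * K ^ 2 + 1) * r) := by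
        gcongr
        exact h7.trans (by gcongr)
    _ = _ := by ring

lemma sum_norm_parVec_sq_le (hβ : ∀ x, ‖β x‖ ≤ K * ‖x‖) :
    ∑ m, ‖parVec β m‖ ^ 2 ≤ d * K ^ 2 := by
  calc _ ≤ ∑ _m : Fin d, K ^ 2 := by
        refine Finset.sum_le_sum fun m _ => ?_
        gcongr
        exact norm_parVec_le hβ m
    _ = _ := by simp

end CorrectedBounds

section CorrectedUniform

variable {d : ℕ} {β : Euc d ≃L[ℝ] Euc d} {K ε : ℝ} {x y : Euc d}

/-- A common constant for the powers of `corR`. -/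
noncomputable def corM (d : ℕ) (K : ℝ) : ℝ := (5 * ((d + 1) * K ^ 2)) ^ ((d : ℝ) / 2 + 2)

lemma corM_nonneg (d : ℕ) (K : ℝ) : 0 ≤ corM d K := by unfold corM; positivity

lemma corR_rpow_le_corM (hε : 0 < ε) (hK : 1 ≤ K) (hβ : ∀ x, ‖β x‖ ≤ K * ‖x‖)
    (hβ' : ∀ x, ‖β.symm x‖ ≤ K * ‖x‖) (hx : x ∈ uball d) (hy : y ∈ uball d) {n : ℕ} (hn : n ≤ 2) :
    corR β ε (corC β K x) x y ^ (-((d : ℝ) / 2) - n) ≤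
      corM d K * (bdryKer ε x y / (√(bdryRho ε x y)) ^ (2 * n)) := by
  refine (corR_rpow_le hε hK hβ hβ' hx hy n).trans ?_
  have hk := bdryKer_pos hε x y
  have hK2 : 1 ≤ K ^ 2 := one_le_pow₀ hK
  have hn' : (n : ℝ) ≤ 2 := by exact_mod_cast hn
  refine mul_le_mul_of_nonneg_right (Real.rpow_le_rpow_of_exponent_le ?_ (by linarith))
    (by positivity)
  nlinarith [(Nat.cast_nonneg d : (0 : ℝ) ≤ d)]

lemma abs_corPhi_le (hε : 0 < ε) (hK : 1 ≤ K) (hβ : ∀ x, ‖β x‖ ≤ K * ‖x‖)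
    (hβ' : ∀ x, ‖β.symm x‖ ≤ K * ‖x‖) (k : Fin d) (hx : x ∈ uball d) (hy : y ∈ uball d) :
    |corPhi β ε (corC β K x) (corC' β K k x) k x y| ≤
      4 * K ^ 3 * corM d K * (√(bdryRho ε x y) * bdryKer ε x y) := by
  have hR := corR_pos (β := β) hε (corC_nonneg hK hβ' hx) x (ball_subset_closedBall hy)
  have h0 := corR_rpow_le_corM (n := 0) hε hK hβ hβ' hx hy (by norm_num)
  have hL := abs_corL_le (ε := ε) hK hβ hβ' k hx hy
  simp only [CharP.cast_eq_zero, sub_zero, mul_zero, pow_zero, div_one] at h0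
  unfold corPhi
  rw [abs_mul, abs_of_pos (Real.rpow_pos_of_pos hR _)]
  have := corM_nonneg d K
  have := bdryKer_pos hε x y
  calc _ ≤ corM d K * bdryKer ε x y * (4 * K ^ 3 * √(bdryRho ε x y)) := by gcongr
    _ = _ := by ring

lemma abs_corPhiD_le (hε : 0 < ε) (hK : 1 ≤ K) (hβ : ∀ x, ‖β x‖ ≤ K * ‖x‖)
    (hβ' : ∀ x, ‖β.symm x‖ ≤ K * ‖x‖) (k m : Fin d) (hx : x ∈ uball d) (hy : y ∈ uball d) :
    |corPhiD β ε (corC β K x) (corC' β K k x) k m x y| ≤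
      corM d K * (2 + 4 * K ^ 4 + d * (K + K ^ 3) * (4 * K ^ 3)) * bdryKer ε x y := by
  have hc := corC_nonneg hK hβ' hx
  have hR := corR_pos (β := β) hε hc x (ball_subset_closedBall hy)
  have h0 := corR_rpow_le_corM (n := 0) hε hK hβ hβ' hx hy (by norm_num)
  have h1 := corR_rpow_le_corM (n := 1) hε hK hβ hβ' hx hy (by norm_num)
  have hL := abs_corL_le (ε := ε) hK hβ hβ' k hx hy
  simp only [CharP.cast_eq_zero, sub_zero, mul_zero, pow_zero, div_one] at h0
  simp only [Nat.cast_one, mul_one] at h1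
  have hc1 := corC_le_sqrt (ε := ε) (y := y) hK hβ' hx
  have hc2 := abs_corC'_le hK hβ hβ' k hx
  have he := abs_corEta_le_of_mem hK hβ m hy
  have hM := corM_nonneg d K
  have hk := bdryKer_pos hε x y
  have hz := (abs_apply_le_norm (β.symm (x - y)) m).trans (hβ' _)
  have h2 := norm_sub_le_sqrt_bdryRho ε x y
  have hr : 0 < √(bdryRho ε x y) := Real.sqrt_pos.2 (bdryRho_pos hε x y)
  set r := √(bdryRho ε x y)
  have hd1 : |-2 * EuclideanSpace.single m (1 : ℝ) k - 2 * corC' β K k x * corEta β m y| ≤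
      2 + 4 * K ^ 4 := by
    refine (abs_sub _ _).trans ?_
    rw [abs_mul, abs_mul, abs_mul, abs_neg, abs_two]
    have := abs_single_le_one m k
    calc _ ≤ 2 * 1 + 2 * (2 * K ^ 3) * K := by gcongr
      _ = _ := by ring
  have hd2 : |β.symm (x - y) m + corC β K x * corEta β m y| ≤ (K + K ^ 3) * r := by
    refine (abs_add_le _ _).trans ?_
    rw [abs_mul, abs_of_nonneg hc]
    calc _ ≤ K * r + K ^ 2 * r * K := by
          gcongr
          exact hz.trans (by gcongr)
      _ = _ := by ring
  unfold corPhiD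
  refine (abs_add_le _ _).trans ?_
  simp only [abs_mul, abs_of_pos (Real.rpow_pos_of_pos hR _), Nat.abs_cast]
  calc _ ≤ corM d K * bdryKer ε x y * (2 + 4 * K ^ 4) +
        d * ((K + K ^ 3) * r) * (corM d K * (bdryKer ε x y / r ^ 2)) * (4 * K ^ 3 * r) := by
        gcongr
    _ = _ := by field_simp

set_option maxHeartbeats 1000000 in
lemma abs_sum_corPhiDD_le (hε : 0 < ε) (hK : 1 ≤ K) (hβ : ∀ x, ‖β x‖ ≤ K * ‖x‖)
    (hβ' : ∀ x, ‖β.symm x‖ ≤ K * ‖x‖) (k : Fin d) (hx : x ∈ uball d) (hy : y ∈ uball d) :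
    |∑ m, corPhiDD β ε (corC β K x) (corC' β K k x) k m x y| ≤
      corM d K * (4 * d * K ^ 5 + 4 * d ^ 2 * K ^ 7 +
        2 * d * (4 * K ^ 3 + 4 * K ^ 5 * (2 * d * K ^ 2 + 1)) +
        4 * d * (d + 2) * K ^ 3 * (K ^ 4 * (2 * d * K ^ 2 + 1) + K ^ 2 + 1)) *
        (bdryKer ε x y * (1 + ε ^ 2 / √(bdryRho ε x y) ^ 3)) := by
  have hc := corC_nonneg hK hβ' hx
  have hR := corR_pos (β := β) hε hc x (ball_subset_closedBall hy)
  have h0 := corR_rpow_le_corM (n := 0) hε hK hβ hβ' hx hy (by norm_num)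
  have h1 := corR_rpow_le_corM (n := 1) hε hK hβ hβ' hx hy (by norm_num)
  have h2 := corR_rpow_le_corM (n := 2) hε hK hβ hβ' hx hy (by norm_num)
  have hL := abs_corL_le (ε := ε) hK hβ hβ' k hx hy
  simp only [CharP.cast_eq_zero, sub_zero, mul_zero, pow_zero, div_one] at h0
  simp only [Nat.cast_one, mul_one] at h1
  simp only [Nat.cast_ofNat, Nat.reduceMul] at h2
  have hc1 := corC_le_sqrt (ε := ε) (y := y) hK hβ' hx
  have hc2 := abs_corC'_le hK hβ hβ' k hx
  have hE := abs_corE_le (ε := ε) hK hβ hβ' hx hy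
  have hMid := abs_corMid_le (ε := ε) hK hβ hβ' k hx hy
  have hτ := sum_norm_parVec_sq_le hβ
  have hτ0 : 0 ≤ ∑ m, ‖parVec β m‖ ^ 2 := Finset.sum_nonneg fun m _ => sq_nonneg _
  have hM := corM_nonneg d K
  have hk := bdryKer_pos hε x y
  have hr : 0 < √(bdryRho ε x y) := Real.sqrt_pos.2 (bdryRho_pos hε x y)
  rw [sum_corPhiDD hR k]
  set r := √(bdryRho ε x y)
  set c := corC β K x
  set c' := corC' β K k x
  set τ := ∑ m, ‖parVec β m‖ ^ 2
  set mid := c' * (bdryQ x + ‖x - y‖ ^ 2) - 2 * c * corEta β k y -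
    2 * c * c' * ∑ m, corEta β m y ^ 2
  set ℓ := corL β k c' x y
  set κ := bdryKer ε x y
  set A0 := corR β ε c x y ^ (-((d : ℝ) / 2))
  set A1 := corR β ε c x y ^ (-((d : ℝ) / 2) - 1)
  set A2 := corR β ε c x y ^ (-((d : ℝ) / 2) - 2)
  have hA0 : 0 ≤ A0 := Real.rpow_nonneg hR.le _
  have hA1 : 0 ≤ A1 := Real.rpow_nonneg hR.le _
  have hA2 : 0 ≤ A2 := Real.rpow_nonneg hR.le _
  have e : -2 * c' * τ * A0 + (d * c * τ * ℓ + 2 * d * mid) * A1 -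
      d * (d + 2) * (corE β c x y + ε ^ 2) * ℓ * A2 =
      (-2 * c' * τ * A0 + d * c * τ * ℓ * A1) + 2 * d * mid * A1 -
      d * (d + 2) * (corE β c x y + ε ^ 2) * ℓ * A2 := by ring
  rw [e]
  have b1 : |-2 * c' * τ * A0| ≤ corM d K * (4 * d * K ^ 5) * κ := by
    simp only [abs_mul, abs_neg, abs_two, abs_of_nonneg hA0, abs_of_nonneg hτ0]
    calc _ ≤ 2 * (2 * K ^ 3) * (d * K ^ 2) * (corM d K * κ) := by gcongr
      _ = _ := by ring
  have b2 : |d * c * τ * ℓ * A1| ≤ corM d K * (4 * d ^ 2 * K ^ 7) * κ := by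
    simp only [abs_mul, Nat.abs_cast, abs_of_nonneg hA1, abs_of_nonneg hτ0, abs_of_nonneg hc]
    calc _ ≤ d * (K ^ 2 * r) * (d * K ^ 2) * (4 * K ^ 3 * r) * (corM d K * (κ / r ^ 2)) := by
          gcongr
      _ = _ := by field_simp
  have b3 : |2 * d * mid * A1| ≤
      corM d K * (2 * d * (4 * K ^ 3 + 4 * K ^ 5 * (2 * d * K ^ 2 + 1))) * κ := by
    simp only [abs_mul, abs_two, Nat.abs_cast, abs_of_nonneg hA1]
    calc _ ≤ 2 * d * ((4 * K ^ 3 + 4 * K ^ 5 * (2 * d * K ^ 2 + 1)) * r ^ 2) *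
          (corM d K * (κ / r ^ 2)) := by gcongr
      _ = _ := by field_simp
  have b4 : |d * (d + 2) * (corE β c x y + ε ^ 2) * ℓ * A2| ≤
      corM d K * (4 * d * (d + 2) * K ^ 3) *
        (K ^ 4 * (2 * d * K ^ 2 + 1) + K ^ 2 + ε ^ 2 / r ^ 3) * κ := by
    have hd2 : (0 : ℝ) ≤ d + 2 := by positivity
    simp only [abs_mul, Nat.abs_cast, abs_of_nonneg hA2, abs_of_nonneg hd2]
    have : |corE β c x y + ε ^ 2| ≤ (K ^ 4 * (2 * d * K ^ 2 + 1) + K ^ 2) * r ^ 3 + ε ^ 2 :=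
      (abs_add_le _ _).trans (add_le_add hE (abs_of_nonneg (sq_nonneg ε)).le)
    calc _ ≤ d * (d + 2) * ((K ^ 4 * (2 * d * K ^ 2 + 1) + K ^ 2) * r ^ 3 + ε ^ 2) *
          (4 * K ^ 3 * r) * (corM d K * (κ / r ^ 4)) := by gcongr
      _ = _ := by field_simp
  refine (abs_sub _ _).trans ((add_le_add ((abs_add_le _ _).trans (add_le_add
    ((abs_add_le _ _).trans (add_le_add b1 b2)) b3)) b4).trans ?_)
  set s := ε ^ 2 / r ^ 3
  have hs : 0 ≤ s := by positivity
  set P := K ^ 4 * (2 * d * K ^ 2 + 1) + K ^ 2 with hP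
  have hP0 : 0 ≤ P := by positivity
  set U := 4 * d * K ^ 5 + 4 * d ^ 2 * K ^ 7 +
    2 * d * (4 * K ^ 3 + 4 * K ^ 5 * (2 * d * K ^ 2 + 1)) with hU
  have hU0 : 0 ≤ U := by positivity
  have hV0 : 0 ≤ 4 * d * (d + 2) * K ^ 3 := by positivity
  calc _ = corM d K * (U + 4 * d * (d + 2) * K ^ 3 * (P + s)) * κ := by rw [hU]; ring
    _ ≤ corM d K * (U * (1 + s) + 4 * d * (d + 2) * K ^ 3 * ((P + 1) * (1 + s))) * κ := by
        gcongr
        · nlinarith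
        · nlinarith
    _ = _ := by ring

/-- Uniform bounds for the corrected parametrix and its derivatives. -/
lemma exists_corPhi_bounds (d : ℕ) (hK : 1 ≤ K) : ∃ C : ℝ, 0 < C ∧ ∀ β : Euc d ≃L[ℝ] Euc d,
    (∀ x, ‖β x‖ ≤ K * ‖x‖) → (∀ x, ‖β.symm x‖ ≤ K * ‖x‖) → ∀ ε, 0 < ε → ∀ k,
    ∀ x ∈ uball d, ∀ y ∈ uball d,
    |corPhi β ε (corC β K x) (corC' β K k x) k x y| ≤ C * (√(bdryRho ε x y) * bdryKer ε x y) ∧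
    (∀ m, |corPhiD β ε (corC β K x) (corC' β K k x) k m x y| ≤ C * bdryKer ε x y) ∧
    |∑ m, corPhiDD β ε (corC β K x) (corC' β K k x) k m x y| ≤
      C * (bdryKer ε x y * (1 + ε ^ 2 / √(bdryRho ε x y) ^ 3)) := by
  have hM := corM_nonneg d K
  set C1 := 4 * K ^ 3 * corM d K with hC1
  set C2 := corM d K * (2 + 4 * K ^ 4 + d * (K + K ^ 3) * (4 * K ^ 3)) with hC2
  set C3 := corM d K * (4 * d * K ^ 5 + 4 * d ^ 2 * K ^ 7 +
        2 * d * (4 * K ^ 3 + 4 * K ^ 5 * (2 * d * K ^ 2 + 1)) +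
        4 * d * (d + 2) * K ^ 3 * (K ^ 4 * (2 * d * K ^ 2 + 1) + K ^ 2 + 1)) with hC3
  have h1 : 0 ≤ C1 := by positivity
  have h2 : 0 ≤ C2 := by positivity
  have h3 : 0 ≤ C3 := by positivity
  refine ⟨C1 + C2 + C3 + 1, by positivity, fun β hβ hβ' ε hε k x hx y hy => ?_⟩
  have hk := bdryKer_pos hε x y
  refine ⟨(abs_corPhi_le hε hK hβ hβ' k hx hy).trans ?_,
    fun m => (abs_corPhiD_le hε hK hβ hβ' k m hx hy).trans ?_,
    (abs_sum_corPhiDD_le hε hK hβ hβ' k hx hy).trans ?_⟩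
  all_goals exact mul_le_mul_of_nonneg_right (by linarith) (by positivity)

end CorrectedUniform

section CorrectedIdentity

variable {d : ℕ} {β : Euc d ≃L[ℝ] Euc d} {ε c c' : ℝ}

lemma ContDiffOn.integrableOn_fderiv_mul {w g : Euc d → ℝ}
    (hw : ContDiffOn ℝ 1 w (closedBall 0 1)) (hg : ContinuousOn g (closedBall 0 1)) (v : Euc d) :
    IntegrableOn (fun y => fderiv ℝ w y v * g y) (uball d) := by
  obtain ⟨M, hM⟩ := (isCompact_closedBall (0 : Euc d) 1).exists_bound_of_continuousOn hg
  refine (hw.integrableOn_fderiv_apply v).mul_bdd (c := M)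
    ((hg.mono ball_subset_closedBall).aestronglyMeasurable measurableSet_ball) ?_
  filter_upwards [ae_restrict_mem measurableSet_ball] with y hy
  exact hM y (ball_subset_closedBall hy)

lemma fderiv_const_sub_apply {g : Euc d → ℝ} (x y v : Euc d) (hg : DifferentiableAt ℝ g (x - y)) :
    fderiv ℝ (fun y => g (x - y)) y v = -fderiv ℝ g (x - y) v := by
  have h := hg.hasFDerivAt.comp y ((hasFDerivAt_id y).const_sub x)
  rw [show (fun y => g (x - y)) = g ∘ HSub.hSub x from rfl, h.fderiv]
  simp

/-- The test function attached to the pole `x`. -/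
noncomputable def corTest (β : Euc d ≃L[ℝ] Euc d) (ε c c' : ℝ) (k : Fin d) (x y : Euc d) : ℝ :=
  corPhi β ε c c' k x y - parH β ε k (x - y)

lemma contDiffOn_corTest (hε : 0 < ε) (hc : 0 ≤ c) (x : Euc d) (k : Fin d) {n : WithTop ℕ∞} :
    ContDiffOn ℝ n (corTest β ε c c' k x) (closedBall 0 1) :=
  (contDiffOn_corPhi hε hc x k).sub
    ((contDiff_parH β hε k).comp (contDiff_const.sub contDiff_id)).contDiffOn

lemma corTest_eq_zero (x : Euc d) (k : Fin d) {y : Euc d} (hy : y ∈ sphere (0 : Euc d) 1) :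
    corTest β ε c c' k x y = 0 := by
  have hq : bdryQ y = 0 := by
    unfold bdryQ
    rw [mem_sphere_zero_iff_norm.1 hy]
    norm_num
  unfold corTest corPhi corR corL parH
  simp only [hq, mul_zero, add_zero]
  ring

lemma fderiv_corTest (hε : 0 < ε) (hc : 0 ≤ c) (x : Euc d) {y : Euc d} (hy : y ∈ uball d)
    (k m : Fin d) : fderiv ℝ (corTest β ε c c' k x) y (parVec β m) =
      corPhiD β ε c c' k m x y + parN β ε m k (x - y) := by
  have h1 : DifferentiableAt ℝ (corPhi β ε c c' k x) y :=
    (contDiffOn_corPhi hε hc x k).differentiableAt_uball hy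
  have h2 : DifferentiableAt ℝ (fun y => parH β ε k (x - y)) y :=
    ((contDiff_parH β hε k (n := 1)).comp
      (contDiff_const.sub contDiff_id)).differentiable one_ne_zero y
  have e : corTest β ε c c' k x = corPhi β ε c c' k x - fun y => parH β ε k (x - y) := rfl
  rw [e, fderiv_sub h1 h2, _root_.sub_apply, fderiv_corPhi hε hc x hy,
    fderiv_const_sub_apply _ _ _
      ((contDiff_parH β hε k (n := 1)).differentiable one_ne_zero _),
    fderiv_parH β hε, sub_neg_eq_add]

/-- Green's representation of a regularized directional derivative. -/
lemma C1Zero.integral_parPsi_mul_fderiv [NeZero d] {u : Euc d → ℝ} (hu : C1Zero u) (hε : 0 < ε)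
    (hc : 0 ≤ c) (x : Euc d) (k : Fin d) :
    ∫ y in uball d, fderiv ℝ u y (parVec β k) * parPsi β ε (x - y) =
      (∫ y in uball d, u y * ∑ m, corPhiDD β ε c c' k m x y) +
      ∑ m, ∫ y in uball d, fderiv ℝ u y (parVec β m) *
        fderiv ℝ (corTest β ε c c' k x) y (parVec β m) := by
  have hsub {n : WithTop ℕ∞} : ContDiff ℝ n fun y : Euc d => x - y := contDiff_const.sub contDiff_id
  have hD (m : Fin d) : ContDiffOn ℝ 1 (corPhiD β ε c c' k m x) (closedBall 0 1) :=
    contDiffOn_corPhiD hε hc x k m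
  have hN (m : Fin d) : ContDiffOn ℝ 1 (fun y => parN β ε m k (x - y)) (closedBall 0 1) :=
    ((contDiff_parN β hε m k).comp hsub).contDiffOn
  have hP : ContDiffOn ℝ 1 (fun y => parPsi β ε (x - y)) (closedBall 0 1) :=
    ((contDiff_parPsi β hε).comp hsub).contDiffOn
  have hN' (m : Fin d) (y v : Euc d) := fderiv_const_sub_apply x y v
    ((contDiff_parN β hε m k (n := 1)).differentiable one_ne_zero _)
  have hP' (y v : Euc d) := fderiv_const_sub_apply x y v
    ((contDiff_parPsi β hε (n := 1)).differentiable one_ne_zero _)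
  have h1 (m : Fin d) : ∫ y in uball d, fderiv ℝ u y (parVec β m) *
        fderiv ℝ (corTest β ε c c' k x) y (parVec β m) =
      -(∫ y in uball d, u y * corPhiDD β ε c c' k m x y) +
        ∫ y in uball d, u y * parNDeriv β ε m k (x - y) := by
    have e1 : ∫ y in uball d, u y * corPhiDD β ε c c' k m x y =
        ∫ y in uball d, u y * fderiv ℝ (corPhiD β ε c c' k m x) y (parVec β m) :=
      setIntegral_congr_fun measurableSet_ball fun y hy => by
        simp only [fderiv_corPhiD hε hc x hy]
    have e2 : ∫ y in uball d, u y * parNDeriv β ε m k (x - y) =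
        -∫ y in uball d, u y * fderiv ℝ (fun y => parN β ε m k (x - y)) y (parVec β m) := by
      rw [← integral_neg]
      refine integral_congr_ae (.of_forall fun y => ?_)
      simp only [hN', fderiv_parN β hε]
      ring
    rw [e1, e2, ← hu.integral_fderiv_mul (hD m), ← hu.integral_fderiv_mul (hN m),
      ← integral_add (hu.1.integrableOn_fderiv_mul (hD m).continuousOn _)
        (hu.1.integrableOn_fderiv_mul (hN m).continuousOn _)]
    refine setIntegral_congr_fun measurableSet_ball fun y hy => ?_
    simp only [fderiv_corTest hε hc x hy]
    ring
  have h2 : ∑ m, ∫ y in uball d, u y * parNDeriv β ε m k (x - y) =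
      ∫ y in uball d, fderiv ℝ u y (parVec β k) * parPsi β ε (x - y) := by
    rw [hu.integral_fderiv_mul hP, ← integral_neg, ← integral_finsetSum]
    · refine integral_congr_ae (.of_forall fun y => ?_)
      simp only [hP', ← Finset.mul_sum,
        sum_parNDeriv β hε]
      ring
    · intro m _
      have := (hu.1.integrableOn_mul_fderiv (hN m) (parVec β m)).neg
      refine this.congr (.of_forall fun y => ?_)
      simp only [Pi.neg_apply, hN', fderiv_parN β hε]
      ring
  have h3 : ∫ y in uball d, u y * ∑ m, corPhiDD β ε c c' k m x y =
      ∑ m, ∫ y in uball d, u y * corPhiDD β ε c c' k m x y := by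
    simp only [Finset.mul_sum]
    refine integral_finsetSum _ fun m _ => ?_
    refine (hu.1.integrableOn_mul_fderiv (hD m) (parVec β m)).congr_fun (fun y hy => ?_)
      measurableSet_ball
    simp only [fderiv_corPhiD hε hc x hy]
  simp only [h1, Finset.sum_add_distrib, h2, h3, Finset.sum_neg_distrib]
  ring

end CorrectedIdentity

section CorrectedEstimates

variable {d : ℕ} {K : ℝ}

lemma bddMeas_bdryKer {ε : ℝ} (hε : 0 < ε) (x : Euc d) : BddMeas (bdryKer ε x) :=
  ⟨(measurable_uncurry_bdryKer hε).of_uncurry_left, _, fun y => abs_bdryKer_le hε x y⟩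

lemma BddMeas.integrableOn_mul {g w : Euc d → ℝ} (hg : BddMeas g) (hw : IntegrableOn w (uball d)) :
    IntegrableOn (fun y => g y * w y) (uball d) := by
  obtain ⟨M, hM⟩ := hg.2
  exact hw.bdd_mul (c := M) hg.1.aestronglyMeasurable (.of_forall hM)

lemma ContinuousOn.integrableOn_uball' {w : Euc d → ℝ} (hw : ContinuousOn w (closedBall 0 1)) :
    IntegrableOn w (uball d) :=
  (hw.integrableOn_compact (isCompact_closedBall _ _)).mono_set ball_subset_closedBall

/-- The test function of the corrected parametrix, with the adapted coefficients. -/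
noncomputable def poleTest (β : Euc d ≃L[ℝ] Euc d) (K ε : ℝ) (k : Fin d) (x : Euc d) :
    Euc d → ℝ :=
  corTest β ε (corC β K x) (corC' β K k x) k x

/-- Regularized derivatives are controlled by lower-order terms and the right-hand side. -/
lemma exists_integral_parPsi_fderiv_le [NeZero d] (hK : 1 ≤ K) : ∃ C : ℝ, 0 < C ∧
    ∀ β : Euc d ≃L[ℝ] Euc d, (∀ x, ‖β x‖ ≤ K * ‖x‖) → (∀ x, ‖β.symm x‖ ≤ K * ‖x‖) →
    ∀ ε, 0 < ε → ∀ k, ∀ x ∈ uball d, ∀ u : Euc d → ℝ, C1Zero u →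
    |∫ y in uball d, fderiv ℝ u y (parVec β k) * parPsi β ε (x - y)| ≤
      C * (1 + ε ^ 2 / bdryQ x ^ 3) * (∫ y in uball d, bdryKer ε x y * |u y|) +
      |∑ m, ∫ y in uball d, fderiv ℝ u y (parVec β m) *
        fderiv ℝ (poleTest β K ε k x) y (parVec β m)| := by
  obtain ⟨C, hC, h⟩ := exists_corPhi_bounds d hK
  refine ⟨C, hC, fun β hβ hβ' ε hε k x hx u hu => ?_⟩
  rw [hu.integral_parPsi_mul_fderiv (β := β) (c' := corC' β K k x) hε (corC_nonneg hK hβ' hx) x k]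
  refine (abs_add_le _ _).trans (add_le_add ?_ le_rfl)
  have hq := bdryQ_pos hx
  have hI : IntegrableOn (fun y => bdryKer ε x y * |u y|) (uball d) :=
    (bddMeas_bdryKer hε x).integrableOn_mul (hu.1.continuousOn.integrableOn_uball'.abs)
  rw [← Real.norm_eq_abs, ← integral_const_mul]
  refine norm_integral_le_of_norm_le (hI.const_mul _) ?_
  filter_upwards [ae_restrict_mem measurableSet_ball] with y hy
  obtain ⟨-, -, h3⟩ := h β hβ hβ' ε hε k x hx y hy
  have hk := bdryKer_pos hε x y
  have hr := bdryQ_le_sqrt_bdryRho_left ε x y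
  rw [Real.norm_eq_abs, abs_mul]
  calc _ ≤ |u y| * (C * (bdryKer ε x y * (1 + ε ^ 2 / bdryQ x ^ 3))) := by
        refine mul_le_mul_of_nonneg_left (h3.trans ?_) (abs_nonneg _)
        gcongr
    _ = _ := by ring

/-- The right-hand side in divergence form tested against `poleTest`. -/
lemma exists_sum_integral_mul_fderiv_poleTest_le (d : ℕ) (hK : 1 ≤ K) : ∃ C : ℝ, 0 < C ∧
    ∀ β : Euc d ≃L[ℝ] Euc d, (∀ x, ‖β x‖ ≤ K * ‖x‖) → (∀ x, ‖β.symm x‖ ≤ K * ‖x‖) →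
    ∀ ε, 0 < ε → ∀ k, ∀ x ∈ uball d, ∀ F : Fin d → Euc d → ℝ,
    (∀ m, ContinuousOn (F m) (closedBall 0 1)) →
    |∑ m, ∫ y in uball d, F m y * fderiv ℝ (poleTest β K ε k x) y (parVec β m)| ≤
      C * (∫ y in uball d, bdryKer ε x y * ∑ m, |F m y|) +
      ∑ m, |∫ y in uball d, parN β ε m k (x - y) * F m y| := by
  obtain ⟨C, hC, h⟩ := exists_corPhi_bounds d hK
  refine ⟨C, hC, fun β hβ hβ' ε hε k x hx F hF => ?_⟩
  have hc := corC_nonneg hK hβ' hx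
  have hI (m : Fin d) : IntegrableOn (fun y => bdryKer ε x y * |F m y|) (uball d) :=
    (bddMeas_bdryKer hε x).integrableOn_mul ((hF m).integrableOn_uball'.abs)
  have e (m : Fin d) : ∫ y in uball d, F m y * fderiv ℝ (poleTest β K ε k x) y (parVec β m) =
      (∫ y in uball d, F m y * corPhiD β ε (corC β K x) (corC' β K k x) k m x y) +
      ∫ y in uball d, parN β ε m k (x - y) * F m y := by
    have h1 : IntegrableOn (fun y => F m y *
        corPhiD β ε (corC β K x) (corC' β K k x) k m x y) (uball d) :=
      ((hF m).mul (contDiffOn_corPhiD (n := 0) hε hc x k m).continuousOn).integrableOn_uball'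
    have h2 : IntegrableOn (fun y => parN β ε m k (x - y) * F m y) (uball d) :=
      ((((contDiff_parN β hε m k (n := 0)).continuous.comp
        (continuous_const.sub continuous_id)).continuousOn).mul (hF m)).integrableOn_uball'
    rw [← integral_add h1 h2]
    refine setIntegral_congr_fun measurableSet_ball fun y hy => ?_
    simp only [poleTest, fderiv_corTest hε hc x hy]
    ring
  have e2 : C * (∫ y in uball d, bdryKer ε x y * ∑ m, |F m y|) =
      ∑ m, C * ∫ y in uball d, bdryKer ε x y * |F m y| := by
    simp only [Finset.mul_sum]
    rw [integral_finsetSum _ fun m _ => hI m, Finset.mul_sum]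
  rw [e2, ← Finset.sum_add_distrib]
  refine (Finset.abs_sum_le_sum_abs _ _).trans (Finset.sum_le_sum fun m _ => ?_)
  rw [e]
  refine (abs_add_le _ _).trans (add_le_add ?_ le_rfl)
  rw [← Real.norm_eq_abs, ← integral_const_mul]
  refine norm_integral_le_of_norm_le ((hI m).const_mul _) ?_
  filter_upwards [ae_restrict_mem measurableSet_ball] with y hy
  obtain ⟨-, h2, -⟩ := h β hβ hβ' ε hε k x hx y hy
  rw [Real.norm_eq_abs, abs_mul]
  calc _ ≤ |F m y| * (C * bdryKer ε x y) :=
        mul_le_mul_of_nonneg_left (h2 m) (abs_nonneg _)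
    _ = _ := by ring

/-- A truncated Riesz kernel. -/
noncomputable def rieszCut (d : ℕ) (z : Euc d) : ℝ :=
  (Iio (2 : ℝ)).indicator (fun r => (r ^ (d - 1))⁻¹) ‖z‖

lemma rieszCut_nonneg (z : Euc d) : 0 ≤ rieszCut d z :=
  indicator_apply_nonneg fun _ => inv_nonneg.2 (pow_nonneg (norm_nonneg _) _)

lemma integrable_rieszCut [NeZero d] : Integrable (rieszCut d) := by
  unfold rieszCut
  rw [integrable_fun_norm_addHaar (μ := (volume : Measure (Euc d)))
    (f := (Iio (2 : ℝ)).indicator fun r => (r ^ (d - 1))⁻¹)]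
  have h : IntegrableOn (fun _ : ℝ => (1 : ℝ)) (Ioo 0 2) := by simp
  rw [← integrable_indicator_iff measurableSet_Ioo] at h
  refine h.integrableOn.congr_fun (fun r hr => ?_) measurableSet_Ioi
  have hr0 : (0 : ℝ) < r := hr
  by_cases h2 : r < 2
  · have e1 : r ∈ Ioo (0 : ℝ) 2 := ⟨hr0, h2⟩
    have e2 : r ∈ Iio (2 : ℝ) := h2
    simp only [indicator_of_mem e1, indicator_of_mem e2, finrank_euclideanSpace, Fintype.card_fin,
      smul_eq_mul]
    field_simp
  · have e1 : r ∉ Ioo (0 : ℝ) 2 := fun h => h2 h.2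
    have e2 : r ∉ Iio (2 : ℝ) := h2
    simp only [indicator_of_notMem e1, indicator_of_notMem e2, smul_zero]

lemma rieszCut_sub {x y : Euc d} (hx : x ∈ uball d) (hy : y ∈ uball d) :
    rieszCut d (x - y) = (‖x - y‖ ^ (d - 1))⁻¹ := by
  refine indicator_of_mem ?_ _
  rw [mem_ball_zero_iff] at hx hy
  exact (norm_sub_le x y).trans_lt (by linarith)

lemma sqrt_bdryRho_mul_bdryKer_le [NeZero d] {ε : ℝ} (hε : 0 < ε) {x y : Euc d}
    (hx : x ∈ uball d) (hy : y ∈ uball d) (hxy : x ≠ y) :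
    √(bdryRho ε x y) * bdryKer ε x y ≤ rieszCut d (x - y) := by
  have hρ := bdryRho_pos hε x y
  have hr := Real.sqrt_pos.2 hρ
  have h0 : 0 < ‖x - y‖ := norm_pos_iff.2 (sub_ne_zero.2 hxy)
  rw [rieszCut_sub hx hy]
  unfold bdryKer
  rw [rpow_neg_half_eq_inv_sqrt_pow hρ.le]
  have e : √(bdryRho ε x y) ^ d = √(bdryRho ε x y) * √(bdryRho ε x y) ^ (d - 1) :=
    (mul_pow_sub_one (NeZero.ne d) _).symm
  rw [e, mul_inv, mul_inv_cancel_left₀ hr.ne']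
  exact inv_anti₀ (by positivity) (by gcongr; exact norm_sub_le_sqrt_bdryRho ε x y)

lemma abs_parH_sub_le [NeZero d] (hK : 1 ≤ K) {β : Euc d ≃L[ℝ] Euc d}
    (hβ : ∀ x, ‖β x‖ ≤ K * ‖x‖) {ε : ℝ} (hε : 0 < ε) (k : Fin d) {x y : Euc d}
    (hx : x ∈ uball d) (hy : y ∈ uball d) (hxy : x ≠ y) :
    |parH β ε k (x - y)| ≤ 2 * K ^ (d - 1) * rieszCut d (x - y) := by
  have h0 : 0 < ‖x - y‖ := norm_pos_iff.2 (sub_ne_zero.2 hxy)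
  have hP := parP_pos β hε (x - y)
  refine (abs_parH_le β hε k (x - y)).trans ?_
  have hd : ((d : ℝ) - 1) = ((d - 1 : ℕ) : ℝ) := by
    rw [Nat.cast_sub (NeZero.one_le), Nat.cast_one]
  rw [rieszCut_sub hx hy, hd, rpow_neg_half_eq_inv_sqrt_pow hP.le, mul_assoc]
  refine mul_le_mul_of_nonneg_left ?_ zero_le_two
  have h1 : ‖x - y‖ / K ≤ √(parP β ε (x - y)) := by
    refine (norm_div_le_norm_symm (by linarith) hβ _).trans (Real.le_sqrt_of_sq_le ?_)
    unfold parP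
    nlinarith [sq_nonneg ε]
  calc _ ≤ ((‖x - y‖ / K) ^ (d - 1))⁻¹ := inv_anti₀ (by positivity) (by gcongr)
    _ = _ := by rw [div_pow, inv_div, div_eq_mul_inv]

lemma ae_ne_uball [NeZero d] (x : Euc d) : ∀ᵐ y ∂volume.restrict (uball d), x ≠ y := by
  have : Nontrivial (Euc d) := by
    have : 0 < Module.finrank ℝ (Euc d) := by simpa using NeZero.pos d
    exact Module.nontrivial_of_finrank_pos this
  refine ae_restrict_of_ae ?_
  filter_upwards [(measure_singleton (μ := (volume : Measure (Euc d))) x :)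
    |> compl_mem_ae_iff.2] with y hy h
  exact hy h.symm

lemma integrable_rieszCut_sub [NeZero d] (x : Euc d) : Integrable fun y => rieszCut d (x - y) :=
  integrable_rieszCut.comp_sub_left x

lemma setIntegral_rieszCut_sub_le [NeZero d] (x : Euc d) :
    ∫ y in uball d, rieszCut d (x - y) ≤ ∫ z, rieszCut d z := by
  rw [← integral_sub_left_eq_self (fun z => rieszCut d z) volume x]
  exact setIntegral_le_integral (integrable_rieszCut_sub x) (.of_forall fun y => rieszCut_nonneg _)

/-- A bounded function tested against `poleTest`. -/
lemma exists_integral_mul_poleTest_le [NeZero d] (hK : 1 ≤ K) : ∃ C : ℝ, 0 < C ∧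
    ∀ β : Euc d ≃L[ℝ] Euc d, (∀ x, ‖β x‖ ≤ K * ‖x‖) → (∀ x, ‖β.symm x‖ ≤ K * ‖x‖) →
    ∀ ε, 0 < ε → ∀ k, ∀ x ∈ uball d, ∀ (g : Euc d → ℝ) (M : ℝ), 0 ≤ M →
    (∀ y ∈ uball d, |g y| ≤ M) → |∫ y in uball d, g y * poleTest β K ε k x y| ≤ C * M := by
  obtain ⟨C, hC, h⟩ := exists_corPhi_bounds d hK
  set J := ∫ z, rieszCut d z
  have hJ : 0 ≤ J := integral_nonneg rieszCut_nonneg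
  refine ⟨(C + 2 * K ^ (d - 1)) * J + 1, by positivity, fun β hβ hβ' ε hε k x hx g M hM hg => ?_⟩
  have hb : ‖∫ y in uball d, g y * poleTest β K ε k x y‖ ≤
      ∫ y in uball d, M * (C + 2 * K ^ (d - 1)) * rieszCut d (x - y) := by
    refine norm_integral_le_of_norm_le ((integrable_rieszCut_sub x).integrableOn.const_mul _) ?_
    filter_upwards [ae_restrict_mem measurableSet_ball, ae_ne_uball x] with y hy hxy
    obtain ⟨h1, -, -⟩ := h β hβ hβ' ε hε k x hx y hy
    have h2 := sqrt_bdryRho_mul_bdryKer_le hε hx hy hxy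
    have h3 := abs_parH_sub_le hK hβ hε k hx hy hxy
    have h4 := rieszCut_nonneg (x - y)
    rw [Real.norm_eq_abs, abs_mul, mul_assoc]
    refine mul_le_mul (hg y hy) ?_ (abs_nonneg _) hM
    refine (abs_sub _ _).trans ((add_le_add (h1.trans ?_) h3).trans (add_mul _ _ _).ge)
    gcongr
  rw [integral_const_mul] at hb
  refine hb.trans ?_
  calc _ ≤ M * (C + 2 * K ^ (d - 1)) * J := by
        gcongr
        exact setIntegral_rieszCut_sub_le x
    _ ≤ _ := by linarith

lemma integral_bdryKer_mul_le [NeZero d] {ε : ℝ} (hε : 0 < ε) {x : Euc d} (hx : x ∈ uball d)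
    {w : Euc d → ℝ} {M : ℝ} (hM : 0 ≤ M) (hw : ∀ y ∈ uball d, |w y| ≤ M * bdryQ y) :
    ∫ y in uball d, bdryKer ε x y * |w y| ≤ M * ∫ z, rieszCut d z := by
  have hb : ‖∫ y in uball d, bdryKer ε x y * |w y|‖ ≤
      ∫ y in uball d, M * rieszCut d (x - y) := by
    refine norm_integral_le_of_norm_le ((integrable_rieszCut_sub x).integrableOn.const_mul _) ?_
    filter_upwards [ae_restrict_mem measurableSet_ball, ae_ne_uball x] with y hy hxy
    have h2 := sqrt_bdryRho_mul_bdryKer_le hε hx hy hxy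
    have hk := bdryKer_pos hε x y
    rw [Real.norm_eq_abs, abs_of_nonneg (by positivity)]
    calc _ ≤ bdryKer ε x y * (M * √(bdryRho ε x y)) := by
          gcongr
          exact (hw y hy).trans (by gcongr; exact bdryQ_le_sqrt_bdryRho ε x y)
      _ = M * (√(bdryRho ε x y) * bdryKer ε x y) := by ring
      _ ≤ _ := by gcongr
  rw [integral_const_mul] at hb
  exact (le_abs_self _).trans (hb.trans (by gcongr; exact setIntegral_rieszCut_sub_le x))

end CorrectedEstimates

section CorrectedLimit

variable {d : ℕ} {K : ℝ}

lemma ContDiffOn.bddMeas_indicator_fderiv {w : Euc d → ℝ}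
    (hw : ContDiffOn ℝ 1 w (closedBall 0 1)) (v : Euc d) :
    BddMeas ((uball d).indicator fun y => fderiv ℝ w y v) := by
  obtain ⟨M, h0, hM⟩ := hw.exists_fderiv_bound
  refine ⟨(measurable_fderiv_apply_const ℝ w v).indicator measurableSet_ball, M * ‖v‖,
    fun y => ?_⟩
  by_cases hy : y ∈ uball d
  · rw [indicator_of_mem hy]
    exact ((fderiv ℝ w y).le_opNorm v).trans (mul_le_mul_of_nonneg_right (hM y hy) (norm_nonneg v))
  · rw [indicator_of_notMem hy, abs_zero]
    positivity

lemma ContDiffOn.tendsto_integral_parPsi_fderiv (hK : 0 < K) {β : Euc d ≃L[ℝ] Euc d}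
    (hβ : ∀ x, ‖β x‖ ≤ K * ‖x‖) {w : Euc d → ℝ} (hw : ContDiffOn ℝ 1 w (closedBall 0 1))
    {x : Euc d} (hx : x ∈ uball d) (v : Euc d) :
    Filter.Tendsto (fun ε => ∫ y in uball d, fderiv ℝ w y v * parPsi β ε (x - y))
      (nhdsWithin 0 (Ioi 0)) (nhds ((∫ z, parPsi β 1 z) * fderiv ℝ w x v)) := by
  have hc : ContinuousAt ((uball d).indicator fun y => fderiv ℝ w y v) x := by
    have h1 : ContinuousAt (fun y => fderiv ℝ w y v) x :=
      (hw.continuousOn_fderiv_uball.clm_apply continuousOn_const).continuousAt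
        (isOpen_ball.mem_nhds hx)
    refine h1.congr ?_
    filter_upwards [isOpen_ball.mem_nhds hx] with y hy
    rw [indicator_of_mem hy]
  have h := tendsto_integral_parPsi hK hβ (hw.bddMeas_indicator_fderiv v) hc
  rw [indicator_of_mem hx] at h
  refine h.congr fun ε => ?_
  rw [← integral_indicator measurableSet_ball]
  refine integral_congr_ae (.of_forall fun y => ?_)
  by_cases hy : y ∈ uball d
  · simp only [indicator_of_mem hy, mul_comm]
  · simp only [indicator_of_notMem hy, mul_zero]

/-- Gradient bound for solutions with bounded right-hand side. -/
lemma exists_abs_fderiv_le_of_abs_le [NeZero d] (hK : 1 ≤ K) : ∃ C : ℝ, 0 < C ∧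
    ∀ β : Euc d ≃L[ℝ] Euc d, (∀ x, ‖β x‖ ≤ K * ‖x‖) → (∀ x, ‖β.symm x‖ ≤ K * ‖x‖) →
    ∀ w : Euc d → ℝ, C1Zero w → ∀ (g : Euc d → ℝ) (M N : ℝ), 0 ≤ M → 0 ≤ N →
    (∀ y ∈ uball d, |g y| ≤ M) → (∀ y ∈ uball d, |w y| ≤ N * bdryQ y) →
    (∀ ψ : Euc d → ℝ, C1Zero ψ → ∑ m, ∫ y in uball d, fderiv ℝ w y (parVec β m) *
      fderiv ℝ ψ y (parVec β m) = -∫ y in uball d, g y * ψ y) →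
    ∀ x ∈ uball d, ∀ k, |fderiv ℝ w x (parVec β k)| ≤ C * (M + N) := by
  obtain ⟨C1, hC1, h1⟩ := exists_integral_parPsi_fderiv_le (d := d) hK
  obtain ⟨C2, hC2, h2⟩ := exists_integral_mul_poleTest_le (d := d) hK
  obtain ⟨c, hc, h3⟩ := exists_le_integral_parPsi d (zero_lt_one.trans_le hK)
  set J := ∫ z, rieszCut d z
  have hJ : 0 ≤ J := integral_nonneg rieszCut_nonneg
  refine ⟨(C1 * J + C2) / c, by positivity, fun β hβ hβ' w hw g M N hM hN hg hwN hweak x hx k => ?_⟩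
  have hq := bdryQ_pos hx
  have hlim := (hw.1.tendsto_integral_parPsi_fderiv (zero_lt_one.trans_le hK) hβ hx
    (parVec β k)).abs
  have hlim2 : Filter.Tendsto (fun ε : ℝ => C1 * (1 + ε ^ 2 / bdryQ x ^ 3) * (N * J) + C2 * M)
      (nhdsWithin 0 (Ioi 0)) (nhds (C1 * (1 + 0 ^ 2 / bdryQ x ^ 3) * (N * J) + C2 * M)) := by
    refine Filter.Tendsto.mono_left (Continuous.tendsto (by fun_prop) 0) nhdsWithin_le_nhds
  have hle := le_of_tendsto_of_tendsto hlim hlim2 (by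
    filter_upwards [self_mem_nhdsWithin] with ε hε
    have hε' : (0 : ℝ) < ε := hε
    have hcn := corC_nonneg hK hβ' hx
    have hψ : C1Zero (poleTest β K ε k x) :=
      ⟨contDiffOn_corTest hε' hcn x k, fun y hy => corTest_eq_zero x k hy⟩
    refine (h1 β hβ hβ' ε hε' k x hx w hw).trans (add_le_add ?_ ?_)
    · gcongr
      exact integral_bdryKer_mul_le hε' hx hN hwN
    · rw [hweak _ hψ, abs_neg]
      exact h2 β hβ hβ' ε hε' k x hx g M hM hg)
  rw [abs_mul] at hle
  have h4 := (h3 β hβ hβ').trans (le_abs_self _)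
  have h5 : c * |fderiv ℝ w x (parVec β k)| ≤ C1 * (1 + 0 ^ 2 / bdryQ x ^ 3) * (N * J) + C2 * M :=
    (mul_le_mul_of_nonneg_right h4 (abs_nonneg _)).trans hle
  have e : C1 * (1 + 0 ^ 2 / bdryQ x ^ 3) * (N * J) + C2 * M = C1 * J * N + C2 * M := by
    rw [zero_pow two_ne_zero, zero_div]; ring
  rw [e] at h5
  rw [div_mul_eq_mul_div, le_div_iff₀ hc]
  have p1 : 0 ≤ C1 * J * M := by positivity
  have p2 : 0 ≤ C2 * N := by positivity
  linarith

end CorrectedLimit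

section PolynomialDirichlet

variable {d : ℕ}

/-- The function on Euclidean space defined by a polynomial. -/
noncomputable def polyFun (p : MvPolynomial (Fin d) ℝ) (y : Euc d) : ℝ :=
  MvPolynomial.eval (fun i => y i) p

/-- Directional derivative of polynomials. -/
noncomputable def polyD (v : Euc d) :
    Derivation ℝ (MvPolynomial (Fin d) ℝ) (MvPolynomial (Fin d) ℝ) :=
  MvPolynomial.mkDerivation ℝ fun i => MvPolynomial.C (v i)

/-- The polynomial `1 - |y|²`. -/
noncomputable def polyQ (d : ℕ) : MvPolynomial (Fin d) ℝ := 1 - ∑ i, MvPolynomial.X i ^ 2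

lemma polyFun_polyQ (y : Euc d) : polyFun (polyQ d) y = bdryQ y := by
  simp [polyFun, polyQ, bdryQ, EuclideanSpace.real_norm_sq_eq]

lemma polyFun_mul (p q : MvPolynomial (Fin d) ℝ) (y : Euc d) :
    polyFun (p * q) y = polyFun p y * polyFun q y := map_mul _ _ _

lemma polyFun_sum {ι : Type*} (s : Finset ι) (p : ι → MvPolynomial (Fin d) ℝ) (y : Euc d) :
    polyFun (∑ m ∈ s, p m) y = ∑ m ∈ s, polyFun (p m) y := map_sum _ _ _

lemma hasFDerivAt_coord (y : Euc d) (i : Fin d) :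
    HasFDerivAt (fun y : Euc d => y i) (EuclideanSpace.proj i : Euc d →L[ℝ] ℝ) y :=
  (EuclideanSpace.proj i : Euc d →L[ℝ] ℝ).hasFDerivAt

lemma contDiff_polyFun (p : MvPolynomial (Fin d) ℝ) {n : WithTop ℕ∞} :
    ContDiff ℝ n (polyFun p) := by
  induction p using MvPolynomial.induction_on with
  | C a =>
    have : polyFun (MvPolynomial.C a : MvPolynomial (Fin d) ℝ) = fun _ => a := by
      funext y; simp [polyFun]
    rw [this]; exact contDiff_const
  | add p q hp hq =>
    have : polyFun (p + q) = fun y => polyFun p y + polyFun q y := by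
      funext y; exact map_add _ _ _
    rw [this]; exact hp.add hq
  | mul_X p i hp =>
    have : polyFun (p * MvPolynomial.X i) = fun y => polyFun p y * y i := by
      funext y; simp [polyFun]
    rw [this]
    have h : ContDiff ℝ n fun y : Euc d => y i := by fun_prop
    exact hp.mul h

lemma fderiv_polyFun (p : MvPolynomial (Fin d) ℝ) (y v : Euc d) :
    fderiv ℝ (polyFun p) y v = polyFun (polyD v p) y := by
  have hdiff (p : MvPolynomial (Fin d) ℝ) : DifferentiableAt ℝ (polyFun p) y :=
    (contDiff_polyFun p (n := 1)).differentiable one_ne_zero y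
  induction p using MvPolynomial.induction_on with
  | C a =>
    have : polyFun (MvPolynomial.C a : MvPolynomial (Fin d) ℝ) = fun _ => a := by
      funext y; simp [polyFun]
    rw [this, fderiv_const_apply]
    simp [polyFun, polyD]
  | add p q hp hq =>
    have : polyFun (p + q) = polyFun p + polyFun q := by
      funext y; exact map_add _ _ _
    rw [this, fderiv_add (hdiff p) (hdiff q), _root_.add_apply, hp, hq, map_add]
    exact (map_add _ _ _).symm
  | mul_X p i hp =>
    have : polyFun (p * MvPolynomial.X i) = fun y => polyFun p y * y i := by
      funext y; simp [polyFun]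
    rw [this]
    erw [((hdiff p).hasFDerivAt.mul (hasFDerivAt_coord y i)).fderiv]
    simp only [_root_.add_apply, _root_.smul_apply, smul_eq_mul, hp]
    simp [polyFun, polyD, MvPolynomial.mkDerivation_X]

lemma totalDegree_polyD_le (v : Euc d) (p : MvPolynomial (Fin d) ℝ) :
    (polyD v p).totalDegree ≤ p.totalDegree - 1 := by
  conv_lhs => rw [p.as_sum, map_sum]
  refine (MvPolynomial.totalDegree_finsetSum _ _).trans (Finset.sup_le fun s hs => ?_)
  rw [polyD, MvPolynomial.mkDerivation_monomial]
  refine (MvPolynomial.totalDegree_smul_le _ _).trans ?_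
  refine (MvPolynomial.totalDegree_finsetSum _ _).trans (Finset.sup_le fun i hi => ?_)
  beta_reduce
  rw [smul_eq_mul]
  refine (MvPolynomial.totalDegree_mul _ _).trans ?_
  rw [MvPolynomial.totalDegree_C, add_zero]
  refine (MvPolynomial.totalDegree_monomial_le _ _).trans ?_
  have h1 := MvPolynomial.le_totalDegree hs
  have h2 : (s.sum fun _ e => e) = (s - Finsupp.single i 1).sum (fun _ e => e) + 1 := by
    have h3 : s - Finsupp.single i 1 + Finsupp.single i 1 = s := by
      refine tsub_add_cancel_of_le (Finsupp.single_le_iff.2 ?_)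
      exact Nat.one_le_iff_ne_zero.2 (Finsupp.mem_support_iff.1 hi)
    conv_lhs => rw [← h3]
    rw [Finsupp.sum_add_index' (fun _ => rfl) fun _ _ _ => rfl]
    simp
  have h4 : ((s - Finsupp.single i 1).sum fun _ => id) =
    (s - Finsupp.single i 1).sum fun _ e => e := rfl
  omega

lemma totalDegree_polyQ_le (d : ℕ) : (polyQ d).totalDegree ≤ 2 := by
  refine (MvPolynomial.totalDegree_sub _ _).trans (max_le (by simp) ?_)
  refine (MvPolynomial.totalDegree_finsetSum _ _).trans (Finset.sup_le fun i _ => ?_)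
  exact (MvPolynomial.totalDegree_pow _ _).trans (by simp)

/-- The second-order operator `∑ D_m²` acting on polynomials. -/
noncomputable def polyL (β : Euc d ≃L[ℝ] Euc d) : MvPolynomial (Fin d) ℝ →ₗ[ℝ]
    MvPolynomial (Fin d) ℝ :=
  ∑ m, (polyD (parVec β m)).toLinearMap ∘ₗ (polyD (parVec β m)).toLinearMap

lemma polyL_apply (β : Euc d ≃L[ℝ] Euc d) (p : MvPolynomial (Fin d) ℝ) :
    polyL β p = ∑ m, polyD (parVec β m) (polyD (parVec β m) p) := by
  simp [polyL]

lemma polyL_polyQ (β : Euc d ≃L[ℝ] Euc d) :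
    polyL β (polyQ d) = MvPolynomial.C (-2 * ∑ m, ‖parVec β m‖ ^ 2) := by
  rw [polyL_apply, Finset.mul_sum, map_sum]
  refine Finset.sum_congr rfl fun m _ => ?_
  rw [polyQ, map_sub, map_sum, map_sub, map_sum, EuclideanSpace.real_norm_sq_eq, Finset.mul_sum,
    map_sum]
  simp only [Derivation.map_one_eq_zero, map_zero, zero_sub]
  rw [← Finset.sum_neg_distrib]
  refine Finset.sum_congr rfl fun i _ => ?_
  simp only [polyD, Derivation.leibniz_pow, MvPolynomial.mkDerivation_X, map_nsmul, smul_eq_mul,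
    Derivation.leibniz,  map_mul, map_neg, map_pow]
  simp
  rw [show (MvPolynomial.C 2 : MvPolynomial (Fin d) ℝ) = 2 from map_ofNat _ 2]
  ring

lemma polyFun_line_hasDerivAt (p : MvPolynomial (Fin d) ℝ) (x v : Euc d) (t : ℝ) :
    HasDerivAt (fun t : ℝ => polyFun p (x + t • v)) (polyFun (polyD v p) (x + t • v)) t := by
  have h1 : HasDerivAt (fun t : ℝ => x + t • v) v t := by
    simpa using ((hasDerivAt_id t).smul_const v).const_add x
  have h2 := ((contDiff_polyFun p (n := 1)).differentiable one_ne_zero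
    (x + t • v)).hasFDerivAt.comp_hasDerivAt t h1
  rwa [fderiv_polyFun] at h2

lemma polyD_polyD_nonpos_of_isLocalMax {p : MvPolynomial (Fin d) ℝ} {x : Euc d}
    (hx : IsLocalMax (polyFun p) x) (v : Euc d) : polyFun (polyD v (polyD v p)) x ≤ 0 := by
  by_contra! h
  set f : ℝ → ℝ := fun t => polyFun p (x + t • v) with hf
  have hd1 : deriv f = fun t => polyFun (polyD v p) (x + t • v) :=
    funext fun t => (polyFun_line_hasDerivAt p x v t).deriv
  have hd2 : deriv (deriv f) = fun t => polyFun (polyD v (polyD v p)) (x + t • v) := by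
    rw [hd1]; exact funext fun t => (polyFun_line_hasDerivAt _ x v t).deriv
  have hc : ContinuousAt f 0 := (polyFun_line_hasDerivAt p x v 0).continuousAt
  have hmax : IsLocalMax f 0 := by
    have hl : Filter.Tendsto (fun t : ℝ => x + t • v) (nhds 0) (nhds x) := by
      have : Continuous fun t : ℝ => x + t • v := by fun_prop
      simpa using this.tendsto 0
    filter_upwards [hl.eventually hx] with t ht
    simpa [hf] using ht
  have hmin : IsLocalMin f 0 :=
    isLocalMin_of_deriv_deriv_pos (by rw [hd2]; simpa using h) hmax.deriv_eq_zero hc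
  have he : f =ᶠ[nhds 0] fun _ => f 0 := by
    filter_upwards [hmin, hmax] with t h1 h2
    exact le_antisymm h2 h1
  have h0 : deriv (deriv f) 0 = 0 := by
    rw [(he.deriv).deriv_eq]
    simp
  rw [hd2] at h0
  simp only [zero_smul, add_zero] at h0
  exact h.ne' h0

/-- Weak maximum principle. -/
lemma polyFun_nonpos_of_polyL_pos {β : Euc d ≃L[ℝ] Euc d} {p : MvPolynomial (Fin d) ℝ}
    (hL : ∀ y ∈ uball d, 0 < polyFun (polyL β p) y)
    (h0 : ∀ y ∈ sphere (0 : Euc d) 1, polyFun p y ≤ 0) {y : Euc d} (hy : y ∈ uball d) :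
    polyFun p y ≤ 0 := by
  obtain ⟨x, hx, hmax⟩ := (isCompact_closedBall (0 : Euc d) 1).exists_isMaxOn
    ⟨0, by simp⟩ (contDiff_polyFun p (n := 0)).continuous.continuousOn
  refine (hmax (ball_subset_closedBall hy)).trans ?_
  rcases (mem_closedBall_zero_iff.1 hx).eq_or_lt with h | h
  · exact h0 x (by simpa using h)
  · have hxb : x ∈ uball d := by simpa using h
    have hloc : IsLocalMax (polyFun p) x :=
      hmax.isLocalMax (closedBall_mem_nhds_of_mem hxb)
    have h1 := hL x hxb
    rw [polyL_apply, polyFun_sum] at h1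
    exact absurd (Finset.sum_nonpos fun m _ => polyD_polyD_nonpos_of_isLocalMax hloc (parVec β m))
      h1.not_ge

lemma bdryQ_eq_zero_of_mem_sphere {y : Euc d} (hy : y ∈ sphere (0 : Euc d) 1) : bdryQ y = 0 := by
  unfold bdryQ
  rw [mem_sphere_zero_iff_norm.1 hy]
  norm_num

lemma polyFun_mul_polyQ_le {β : Euc d ≃L[ℝ] Euc d} {p : MvPolynomial (Fin d) ℝ} {M : ℝ}
    (hτ : 0 < ∑ m, ‖parVec β m‖ ^ 2)
    (hL : ∀ y ∈ uball d, -M < polyFun (polyL β (polyQ d * p)) y) {y : Euc d} (hy : y ∈ uball d) :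
    2 * (∑ m, ‖parVec β m‖ ^ 2) * polyFun (polyQ d * p) y ≤ M * bdryQ y := by
  set τ := ∑ m, ‖parVec β m‖ ^ 2 with hτd
  have e (y : Euc d) : polyFun (((2 * τ) • (polyQ d * p)) - M • polyQ d) y =
      2 * τ * polyFun (polyQ d * p) y - M * bdryQ y := by
    rw [← polyFun_polyQ]; simp [polyFun]
  have h := polyFun_nonpos_of_polyL_pos (β := β) (p := ((2 * τ) • (polyQ d * p)) - M • polyQ d)
    (fun y hy => ?_) (fun y hy => ?_) hy
  · rw [e] at h; linarith
  · have e2 : polyFun (polyL β (((2 * τ) • (polyQ d * p)) - M • polyQ d)) y =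
        2 * τ * (polyFun (polyL β (polyQ d * p)) y + M) := by
      rw [map_sub, map_smul, map_smul, polyL_polyQ, ← hτd]
      simp only [polyFun, map_sub, MvPolynomial.smul_eval, MvPolynomial.eval_C]
      ring
    rw [e2]
    have := hL y hy
    exact mul_pos (by linarith) (by linarith)
  · rw [e, polyFun_mul, polyFun_polyQ, bdryQ_eq_zero_of_mem_sphere hy]; simp

lemma abs_polyFun_mul_polyQ_le {β : Euc d ≃L[ℝ] Euc d} {p : MvPolynomial (Fin d) ℝ} {M : ℝ}
    (hτ : 0 < ∑ m, ‖parVec β m‖ ^ 2)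
    (hL : ∀ y ∈ uball d, |polyFun (polyL β (polyQ d * p)) y| ≤ M) {y : Euc d}
    (hy : y ∈ uball d) :
    2 * (∑ m, ‖parVec β m‖ ^ 2) * |polyFun (polyQ d * p) y| ≤ M * bdryQ y := by
  have hQ := bdryQ_pos hy
  have hQ1 := bdryQ_le_one y
  have key (q : MvPolynomial (Fin d) ℝ)
      (hq : ∀ y ∈ uball d, |polyFun (polyL β (polyQ d * q)) y| ≤ M) :
      2 * (∑ m, ‖parVec β m‖ ^ 2) * polyFun (polyQ d * q) y ≤ M * bdryQ y := by
    refine le_of_forall_pos_le_add fun δ hδ => ?_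
    have h := polyFun_mul_polyQ_le (M := M + δ) hτ
      (fun y hy => by have := (abs_le.1 (hq y hy)).1; linarith) hy
    nlinarith
  have hneg : polyFun (polyQ d * -p) y = -polyFun (polyQ d * p) y := by simp [polyFun]
  have h1 := key p hL
  have h2 := key (-p) fun y hy => by
    have : polyFun (polyL β (polyQ d * -p)) y = -polyFun (polyL β (polyQ d * p)) y := by
      rw [mul_neg, map_neg]; simp [polyFun]
    rw [this, abs_neg]; exact hL y hy
  rw [hneg] at h2
  rcases abs_cases (polyFun (polyQ d * p) y) with h | h <;> rw [h.1] <;> linarith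

lemma eq_zero_of_polyFun_eq_zero {p : MvPolynomial (Fin d) ℝ}
    (h : ∀ y ∈ uball d, polyFun p y = 0) : p = 0 := by
  have hδ : (0 : ℝ) < 1 / (d + 1) := by positivity
  refine MvPolynomial.funext_set (fun _ : Fin d => Ioo (0 : ℝ) (1 / (d + 1)))
    (fun _ => Ioo_infinite hδ) fun x hx => ?_
  rw [map_zero]
  refine h (WithLp.toLp 2 x) ?_
  rw [uball, mem_ball_zero_iff, ← abs_norm, ← abs_one, ← sq_lt_sq, EuclideanSpace.real_norm_sq_eq]
  have hb (i : Fin d) : x i ^ 2 ≤ 1 / ((d : ℝ) + 1) := by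
    have h1 := hx i (mem_univ i)
    have h2 : 1 / ((d : ℝ) + 1) ≤ 1 := by
      rw [div_le_one (by positivity)]; linarith [(Nat.cast_nonneg d : (0 : ℝ) ≤ d)]
    nlinarith [h1.1, h1.2]
  calc ∑ i, (WithLp.toLp 2 x : Euc d) i ^ 2 ≤ ∑ _i : Fin d, 1 / ((d : ℝ) + 1) :=
        Finset.sum_le_sum fun i _ => hb i
    _ = d / ((d : ℝ) + 1) := by simp; ring
    _ < 1 ^ 2 := by rw [one_pow, div_lt_one (by positivity)]; linarith

/-- Polynomial solvability of the Dirichlet problem on the ball. -/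
lemma exists_polyL_mul_polyQ_eq {β : Euc d ≃L[ℝ] Euc d} (hτ : 0 < ∑ m, ‖parVec β m‖ ^ 2)
    (g : MvPolynomial (Fin d) ℝ) : ∃ p, polyL β (polyQ d * p) = g := by
  set n := g.totalDegree
  let V := MvPolynomial.restrictTotalDegree (Fin d) ℝ n
  let T₀ : MvPolynomial (Fin d) ℝ →ₗ[ℝ] MvPolynomial (Fin d) ℝ :=
    polyL β ∘ₗ LinearMap.mulLeft ℝ (polyQ d)
  have hT₀ (p : MvPolynomial (Fin d) ℝ) : T₀ p = polyL β (polyQ d * p) := rfl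
  have hmaps : ∀ p ∈ V, T₀ p ∈ V := fun p hp => by
    rw [MvPolynomial.mem_restrictTotalDegree] at hp ⊢
    rw [hT₀, polyL_apply]
    refine (MvPolynomial.totalDegree_finsetSum _ _).trans (Finset.sup_le fun m _ => ?_)
    have h1 := totalDegree_polyD_le (parVec β m) (polyD (parVec β m) (polyQ d * p))
    have h2 := totalDegree_polyD_le (parVec β m) (polyQ d * p)
    have h3 := MvPolynomial.totalDegree_mul (polyQ d) p
    have h4 := totalDegree_polyQ_le d
    omega
  let T : V →ₗ[ℝ] V := T₀.restrict hmaps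
  have hinj : Function.Injective T := by
    rw [← LinearMap.ker_eq_bot, LinearMap.ker_eq_bot']
    intro p hp
    have hp' : polyL β (polyQ d * p) = 0 := by
      have := congrArg Subtype.val hp
      simpa [T, hT₀] using this
    refine Subtype.ext (eq_zero_of_polyFun_eq_zero fun y hy => ?_)
    have h := abs_polyFun_mul_polyQ_le (M := 0) (p := p) hτ
      (fun y _ => by rw [hp']; simp [polyFun]) hy
    rw [zero_mul] at h
    have h0 : |polyFun (polyQ d * (p : MvPolynomial (Fin d) ℝ)) y| ≤ 0 := by
      by_contra! hc
      exact absurd h (not_le.2 (by positivity))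
    rw [abs_nonpos_iff, polyFun_mul, polyFun_polyQ] at h0
    exact (mul_eq_zero.1 h0).resolve_left (bdryQ_pos hy).ne'
  obtain ⟨p, hp⟩ := LinearMap.injective_iff_surjective.1 hinj
    ⟨g, (MvPolynomial.mem_restrictTotalDegree ..).2 le_rfl⟩
  exact ⟨p, congrArg Subtype.val hp⟩

end PolynomialDirichlet

section Duality

variable {d : ℕ} {K : ℝ}

lemma sum_norm_parVec_sq_pos [NeZero d] (β : Euc d ≃L[ℝ] Euc d) :
    0 < ∑ m, ‖parVec β m‖ ^ 2 := by
  refine Finset.sum_pos (fun m _ => ?_) ⟨0, Finset.mem_univ _⟩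
  have h : parVec β m ≠ 0 := by
    rw [parVec, Ne, map_eq_zero_iff β β.injective]
    simp
  positivity

lemma le_sum_norm_parVec_sq [NeZero d] (hK : 0 < K) {β : Euc d ≃L[ℝ] Euc d}
    (hβ' : ∀ x, ‖β.symm x‖ ≤ K * ‖x‖) : (1 / K) ^ 2 ≤ ∑ m, ‖parVec β m‖ ^ 2 := by
  have h := hβ' (parVec β 0)
  rw [symm_parVec] at h
  have h1 : 1 / K ≤ ‖parVec β 0‖ := by
    rw [div_le_iff₀ hK, mul_comm]; simpa using h
  exact (pow_le_pow_left₀ (by positivity) h1 2).trans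
    (Finset.single_le_sum (f := fun m => ‖parVec β m‖ ^ 2) (fun _ _ => by positivity)
      (Finset.mem_univ _))

lemma c1Zero_polyFun_polyQ_mul (p : MvPolynomial (Fin d) ℝ) : C1Zero (polyFun (polyQ d * p)) :=
  ⟨(contDiff_polyFun _).contDiffOn, fun x hx => by
    rw [polyFun_mul, polyFun_polyQ, bdryQ_eq_zero_of_mem_sphere hx, zero_mul]⟩

lemma C1Zero.sum_integral_fderiv_polyFun_mul [NeZero d] (β : Euc d ≃L[ℝ] Euc d)
    (p : MvPolynomial (Fin d) ℝ) {ψ : Euc d → ℝ} (hψ : C1Zero ψ) :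
    ∑ m, ∫ y in uball d, fderiv ℝ (polyFun p) y (parVec β m) * fderiv ℝ ψ y (parVec β m) =
      -∫ y in uball d, polyFun (polyL β p) y * ψ y := by
  have h (m : Fin d) : ∫ y in uball d,
      fderiv ℝ (polyFun p) y (parVec β m) * fderiv ℝ ψ y (parVec β m) =
      -∫ y in uball d, ψ y * polyFun (polyD (parVec β m) (polyD (parVec β m) p)) y := by
    have h1 := hψ.integral_fderiv_mul (ψ := polyFun (polyD (parVec β m) p))
      (contDiff_polyFun _).contDiffOn (parVec β m)
    simp only [fderiv_polyFun] at h1 ⊢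
    rw [← h1]
    exact integral_congr_ae (.of_forall fun y => mul_comm _ _)
  rw [Finset.sum_congr rfl fun m _ => h m, Finset.sum_neg_distrib, ← integral_finsetSum]
  · congr 1
    refine integral_congr_ae (.of_forall fun y => ?_)
    simp only [polyL_apply, polyFun_sum, Finset.sum_mul]
    exact Finset.sum_congr rfl fun m _ => mul_comm _ _
  · intro m _
    exact (hψ.1.continuousOn.mul
      (contDiff_polyFun _ (n := 0)).continuous.continuousOn).integrableOn_uball'

/-- `u` solves `∑ D_m² u = ∑ D_m F_m` weakly, tested against functions which are smooth in the
ball and vanish on its boundary. -/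
def WeakSol (β : Euc d ≃L[ℝ] Euc d) (F : Fin d → Euc d → ℝ) (u : Euc d → ℝ) : Prop :=
  ∀ φ : Euc d → ℝ, ContDiffOn ℝ (⊤ : ℕ∞) φ (uball d) → C1Zero φ →
    ∑ m, ∫ y in uball d, fderiv ℝ u y (parVec β m) * fderiv ℝ φ y (parVec β m) =
      ∑ m, ∫ y in uball d, F m y * fderiv ℝ φ y (parVec β m)

lemma exists_abs_integral_mul_polyFun_le [NeZero d] (hK : 1 ≤ K) : ∃ C : ℝ, 0 < C ∧
    ∀ β : Euc d ≃L[ℝ] Euc d, (∀ x, ‖β x‖ ≤ K * ‖x‖) → (∀ x, ‖β.symm x‖ ≤ K * ‖x‖) →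
    ∀ F : Fin d → Euc d → ℝ, (∀ m, ContinuousOn (F m) (closedBall 0 1)) →
    ∀ u : Euc d → ℝ, C1Zero u → WeakSol β F u →
    ∀ (g : MvPolynomial (Fin d) ℝ) (M : ℝ), 0 ≤ M → (∀ y ∈ uball d, |polyFun g y| ≤ M) →
      |∫ y in uball d, polyFun g y * u y| ≤ C * M * ∑ m, ∫ y in uball d, |F m y| := by
  obtain ⟨C, hC, h⟩ := exists_abs_fderiv_le_of_abs_le (d := d) hK
  have hK0 : 0 < K := by linarith
  refine ⟨C * (1 + K ^ 2), by positivity, fun β hβ hβ' F hF u hu hw g M hM hg => ?_⟩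
  have hτ := sum_norm_parVec_sq_pos β
  obtain ⟨p, hp⟩ := exists_polyL_mul_polyQ_eq hτ g
  have hp0 := c1Zero_polyFun_polyQ_mul p
  have hbd := h β hβ hβ' _ hp0 (polyFun g) M (K ^ 2 * M) hM (by positivity) hg
    (fun y hy => ?_) (fun ψ hψ => by rw [← hp]; exact hψ.sum_integral_fderiv_polyFun_mul β _)
  · have e1 := hu.sum_integral_fderiv_polyFun_mul β (polyQ d * p)
    have e2 := hw _ (contDiff_polyFun _).contDiffOn hp0
    rw [hp] at e1
    have e3 : ∫ y in uball d, polyFun g y * u y =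
        -∑ m, ∫ y in uball d, F m y * fderiv ℝ (polyFun (polyQ d * p)) y (parVec β m) := by
      rw [← e2, ← neg_eq_iff_eq_neg, ← e1]
      exact Finset.sum_congr rfl fun m _ => integral_congr_ae (.of_forall fun y => mul_comm _ _)
    rw [e3, abs_neg, Finset.mul_sum]
    refine (Finset.abs_sum_le_sum_abs _ _).trans (Finset.sum_le_sum fun m _ => ?_)
    rw [← integral_const_mul, ← Real.norm_eq_abs]
    refine norm_integral_le_of_norm_le ((hF m).integrableOn_uball'.abs.const_mul _) ?_
    filter_upwards [ae_restrict_mem measurableSet_ball] with y hy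
    have := hbd y hy m
    rw [norm_mul, Real.norm_eq_abs, Real.norm_eq_abs, mul_comm]
    refine mul_le_mul_of_nonneg_right (this.trans (le_of_eq ?_)) (abs_nonneg _)
    ring
  · have h1 := abs_polyFun_mul_polyQ_le hτ (p := p) (M := M) (by rw [hp]; exact hg) hy
    have h2 := le_sum_norm_parVec_sq hK0 hβ'
    have h3 : (1 / K) ^ 2 * |polyFun (polyQ d * p) y| ≤ M * bdryQ y := by
      refine le_trans ?_ h1
      refine mul_le_mul_of_nonneg_right ?_ (abs_nonneg _)
      linarith
    calc _ = K ^ 2 * ((1 / K) ^ 2 * |polyFun (polyQ d * p) y|) := by field_simp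
      _ ≤ K ^ 2 * (M * bdryQ y) := by gcongr
      _ = _ := by ring

lemma exists_polyFun_near {h : Euc d → ℝ} (hh : ContinuousOn h (closedBall 0 1)) {η : ℝ}
    (hη : 0 < η) :
    ∃ g : MvPolynomial (Fin d) ℝ, ∀ y ∈ closedBall (0 : Euc d) 1, |polyFun g y - h y| ≤ η := by
  let X := closedBall (0 : Euc d) 1
  have : CompactSpace X := isCompact_iff_compactSpace.1 (isCompact_closedBall _ _)
  let co : Fin d → C(X, ℝ) := fun i => ⟨fun x => x.1 i, by fun_prop⟩
  let Φ : MvPolynomial (Fin d) ℝ →ₐ[ℝ] C(X, ℝ) := MvPolynomial.aeval co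
  have hΦ (p : MvPolynomial (Fin d) ℝ) (x : X) : Φ p x = polyFun p x.1 := by
    induction p using MvPolynomial.induction_on with
    | C a => simp [Φ, polyFun]
    | add p q hp hq => simp [polyFun, map_add, hp, hq]
    | mul_X p i hp =>
      rw [map_mul, ContinuousMap.mul_apply, hp, polyFun_mul]
      simp [Φ, polyFun, co]
  have hsep : Φ.range.SeparatesPoints := by
    intro x y hxy
    have : ∃ i, x.1 i ≠ y.1 i := by
      by_contra! hc
      exact hxy (Subtype.ext (PiLp.ext hc))
    obtain ⟨i, hi⟩ := this
    refine ⟨_, ⟨Φ (MvPolynomial.X i), ⟨_, rfl⟩, rfl⟩, ?_⟩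
    beta_reduce
    rw [hΦ, hΦ]
    simpa [polyFun] using hi
  obtain ⟨⟨_, p, rfl⟩, hp⟩ := ContinuousMap.exists_mem_subalgebra_near_continuous_of_separatesPoints
    Φ.range hsep (fun x : X => h x.1) (continuousOn_iff_continuous_domRestrict.1 hh) η hη
  refine ⟨p, fun y hy => ?_⟩
  have := (hp ⟨y, hy⟩).le
  rw [← hΦ p ⟨y, hy⟩]
  exact this

/-- The `L¹` estimate for solutions, by duality. -/
lemma exists_integral_abs_le [NeZero d] (hK : 1 ≤ K) : ∃ C : ℝ, 0 < C ∧
    ∀ β : Euc d ≃L[ℝ] Euc d, (∀ x, ‖β x‖ ≤ K * ‖x‖) → (∀ x, ‖β.symm x‖ ≤ K * ‖x‖) →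
    ∀ F : Fin d → Euc d → ℝ, (∀ m, ContinuousOn (F m) (closedBall 0 1)) →
    ∀ u : Euc d → ℝ, C1Zero u → WeakSol β F u →
      ∫ y in uball d, |u y| ≤ C * ∑ m, ∫ y in uball d, |F m y| := by
  obtain ⟨C, hC, h⟩ := exists_abs_integral_mul_polyFun_le (d := d) hK
  refine ⟨4 * C, by positivity, fun β hβ hβ' F hF u hu hw => ?_⟩
  have hui := hu.1.integrableOn_uball
  have key (δ : ℝ) (hδ : 0 < δ) : (1 / 2) * ∫ y in uball d, |u y| ≤
      C * 2 * (∑ m, ∫ y in uball d, |F m y|) + δ * volume.real (uball d) := by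
    have hpos (y : Euc d) : 0 < |u y| + δ := by positivity
    obtain ⟨g, hg⟩ := exists_polyFun_near (h := fun y => u y / (|u y| + δ)) (η := 1 / 2)
      (hu.1.continuousOn.div (hu.1.continuousOn.abs.add continuousOn_const)
        fun y _ => (hpos y).ne') (by norm_num)
    have hle (y : Euc d) : |u y / (|u y| + δ)| ≤ 1 := by
      rw [abs_div, abs_of_pos (hpos y), div_le_one (hpos y)]; linarith
    have h1 := h β hβ hβ' F hF u hu hw g 2 (by norm_num) fun y hy => by
      have h2 := hg y (ball_subset_closedBall hy)
      have h3 := abs_add_le (polyFun g y - u y / (|u y| + δ)) (u y / (|u y| + δ))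
      rw [sub_add_cancel] at h3
      linarith [hle y]
    have h4 : ∫ y in uball d, ((1 / 2) * |u y| - δ) ≤ ∫ y in uball d, polyFun g y * u y := by
      refine setIntegral_mono_on ((hui.abs.const_mul _).sub
        (integrableOn_const measure_ball_lt_top.ne)) ((contDiff_polyFun g
          (n := 0)).continuous.continuousOn.mul hu.1.continuousOn).integrableOn_uball'
        measurableSet_ball fun y hy => ?_
      have h2 := hg y (ball_subset_closedBall hy)
      have h5 : |u y| - δ ≤ u y / (|u y| + δ) * u y := by
        rw [div_mul_eq_mul_div, le_div_iff₀ (hpos y), ← sq, ← sq_abs]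
        nlinarith [abs_nonneg (u y)]
      have h6 : |(polyFun g y - u y / (|u y| + δ)) * u y| ≤ 1 / 2 * |u y| := by
        rw [abs_mul]; gcongr
      have h7 := (abs_le.1 h6).1
      rw [sub_mul] at h7
      linarith
    rw [integral_sub (hui.abs.const_mul _) (integrableOn_const measure_ball_lt_top.ne),
      integral_const_mul, setIntegral_const, smul_eq_mul] at h4
    have h8 := (le_abs_self _).trans h1
    linarith
  have : (1 / 2) * ∫ y in uball d, |u y| ≤ C * 2 * (∑ m, ∫ y in uball d, |F m y|) := by
    refine le_of_forall_pos_le_add fun e he => ?_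
    have hv : 0 < volume.real (uball d) + 1 := by positivity
    refine (key (e / (volume.real (uball d) + 1)) (by positivity)).trans ?_
    gcongr
    rw [div_mul_eq_mul_div, div_le_iff₀ hv]
    nlinarith
  linarith

end Duality

section Factorization

variable {d : ℕ}

open scoped MatrixOrder in
lemma exists_symm_sqrt {S : Matrix (Fin d) (Fin d) ℝ} (hS : S.PosSemidef) :
    ∃ B : Matrix (Fin d) (Fin d) ℝ, Bᵀ = B ∧ B * B = S := by
  refine ⟨CFC.sqrt S, ?_, CFC.sqrt_mul_sqrt_self S hS.nonneg⟩
  simpa using (CFC.sqrt_nonneg S).posSemidef.1.eq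

lemma mulVec_dotProduct_eq_sum (A : Matrix (Fin d) (Fin d) ℝ) (a b : Fin d → ℝ) :
    (A *ᵥ a) ⬝ᵥ b = ∑ i, ∑ j, A i j * (a j * b i) := by
  simp only [dotProduct, mulVec, Finset.sum_mul, mul_assoc]

lemma mulVec_dotProduct_self_le {A : Matrix (Fin d) (Fin d) ℝ} {L : ℝ}
    (hA : Real.sqrt (∑ i, ∑ j, (A i j) ^ 2) ≤ L) (ξ : Fin d → ℝ) :
    (A *ᵥ ξ) ⬝ᵥ ξ ≤ L * ∑ i, ξ i ^ 2 := by
  have h0 : 0 ≤ L := (Real.sqrt_nonneg _).trans hA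
  have h1 : ∑ i, ∑ j, (A i j) ^ 2 ≤ L ^ 2 := (Real.sqrt_le_left h0).1 hA
  have hs : 0 ≤ ∑ i, ξ i ^ 2 := Finset.sum_nonneg fun i _ => sq_nonneg _
  refine le_of_sq_le_sq ?_ (by positivity)
  rw [mulVec_dotProduct_eq_sum, ← Fintype.sum_prod_type' (f := fun i j => A i j * (ξ j * ξ i))]
  refine (Finset.sum_mul_sq_le_sq_mul_sq _ _ _).trans ?_
  rw [Fintype.sum_prod_type (f := fun p : Fin d × Fin d => A p.1 p.2 ^ 2),
    Fintype.sum_prod_type (f := fun p : Fin d × Fin d => (ξ p.2 * ξ p.1) ^ 2), mul_pow]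
  have h2 : ∑ i, ∑ j, (ξ j * ξ i) ^ 2 = (∑ i, ξ i ^ 2) ^ 2 := by
    rw [sq, Finset.sum_mul_sum]
    exact Finset.sum_congr rfl fun i _ => Finset.sum_congr rfl fun j _ => by ring
  rw [h2]
  gcongr

/-- The symmetric part of an elliptic matrix as `β βᵀ`, with `β` symmetric and invertible. -/
lemma exists_equiv_factor {lam Lam : ℝ} (hlam : 0 < lam) (hLam : 0 < Lam)
    {A : Matrix (Fin d) (Fin d) ℝ} (hA : ∀ ξ : Fin d → ℝ, lam * ∑ i, ξ i ^ 2 ≤ (A *ᵥ ξ) ⬝ᵥ ξ)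
    (hA' : Real.sqrt (∑ i, ∑ j, (A i j) ^ 2) ≤ Lam) :
    ∃ β : Euc d ≃L[ℝ] Euc d, (∀ x, ‖β x‖ ≤ (1 + Lam + 1 / lam) * ‖x‖) ∧
      (∀ x, ‖β.symm x‖ ≤ (1 + Lam + 1 / lam) * ‖x‖) ∧
      ∀ i j, ∑ m, parVec β m i * parVec β m j = (A i j + A j i) / 2 := by
  set S : Matrix (Fin d) (Fin d) ℝ := Matrix.of fun i j => (A i j + A j i) / 2 with hSd
  have hSA (ξ : Fin d → ℝ) : (S *ᵥ ξ) ⬝ᵥ ξ = (A *ᵥ ξ) ⬝ᵥ ξ := by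
    rw [mulVec_dotProduct_eq_sum, mulVec_dotProduct_eq_sum]
    have h1 : ∑ i, ∑ j, A j i * (ξ j * ξ i) = ∑ i, ∑ j, A i j * (ξ j * ξ i) := by
      rw [Finset.sum_comm]
      exact Finset.sum_congr rfl fun i _ => Finset.sum_congr rfl fun j _ => by ring
    have h2 : ∑ i, ∑ j, S i j * (ξ j * ξ i) =
        (∑ i, ∑ j, A i j * (ξ j * ξ i) + ∑ i, ∑ j, A j i * (ξ j * ξ i)) / 2 := by
      rw [← Finset.sum_add_distrib, Finset.sum_div]
      refine Finset.sum_congr rfl fun i _ => ?_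
      rw [← Finset.sum_add_distrib, Finset.sum_div]
      refine Finset.sum_congr rfl fun j _ => ?_
      simp only [hSd, Matrix.of_apply]
      ring
    rw [h2, h1]
    ring
  have hS : S.PosSemidef := by
    refine Matrix.PosSemidef.of_dotProduct_mulVec_nonneg ?_ fun ξ => ?_
    · ext i j
      simp [hSd, add_comm]
    · have h : star ξ ⬝ᵥ S *ᵥ ξ = (S *ᵥ ξ) ⬝ᵥ ξ := by rw [dotProduct_comm]; simp
      rw [h, hSA]
      exact le_trans (mul_nonneg hlam.le (Finset.sum_nonneg fun i _ => sq_nonneg _)) (hA ξ)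
  obtain ⟨B, hBt, hBB⟩ := exists_symm_sqrt hS
  let T : Euc d →L[ℝ] Euc d := Matrix.toEuclideanCLM (n := Fin d) (𝕜 := ℝ) B
  have hT (x : Euc d) (i : Fin d) : T x i = (B *ᵥ x.ofLp) i := by
    rw [← Matrix.ofLp_toEuclideanCLM]
  have hnorm (x : Euc d) : ‖T x‖ ^ 2 = (A *ᵥ x.ofLp) ⬝ᵥ x.ofLp := by
    rw [← hSA, EuclideanSpace.real_norm_sq_eq, ← hBB]
    have h : ∑ i, T x i ^ 2 = (B *ᵥ x.ofLp) ⬝ᵥ (B *ᵥ x.ofLp) :=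
      Finset.sum_congr rfl fun i _ => by rw [hT, sq]
    rw [h, ← Matrix.mulVec_mulVec, dotProduct_mulVec, ← Matrix.mulVec_transpose, hBt]
  have hlow (x : Euc d) : lam * ‖x‖ ^ 2 ≤ ‖T x‖ ^ 2 := by
    rw [hnorm, EuclideanSpace.real_norm_sq_eq]; exact hA _
  have hup (x : Euc d) : ‖T x‖ ^ 2 ≤ Lam * ‖x‖ ^ 2 := by
    rw [hnorm, EuclideanSpace.real_norm_sq_eq]; exact mulVec_dotProduct_self_le hA' _
  have hinj : Function.Injective (T : Euc d →ₗ[ℝ] Euc d) := by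
    rw [← LinearMap.ker_eq_bot, LinearMap.ker_eq_bot']
    intro x hx
    have h1 : T x = 0 := hx
    have h2 := hlow x
    rw [h1, norm_zero] at h2
    have h3 : ‖x‖ ^ 2 ≤ 0 := by
      by_contra! h
      have := mul_pos hlam h
      linarith
    have h4 : ‖x‖ = 0 := by nlinarith [norm_nonneg x]
    simpa using h4
  let β : Euc d ≃L[ℝ] Euc d :=
    (LinearEquiv.ofInjectiveEndo (T : Euc d →ₗ[ℝ] Euc d) hinj).toContinuousLinearEquiv
  have hβT (x : Euc d) : β x = T x := rfl
  have hl : 0 < 1 / lam := by positivity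
  refine ⟨β, fun x => ?_, fun x => ?_, fun i j => ?_⟩
  · refine le_of_sq_le_sq ((hup x).trans ?_) (by positivity)
    rw [mul_pow]
    gcongr
    nlinarith
  · refine le_of_sq_le_sq ?_ (by positivity)
    have h := hlow (β.symm x)
    rw [← hβT, β.apply_symm_apply] at h
    have h1 : ‖β.symm x‖ ^ 2 ≤ 1 / lam * ‖x‖ ^ 2 := by
      rw [div_mul_eq_mul_div, one_mul, le_div_iff₀ hlam]; linarith
    refine h1.trans ?_
    rw [mul_pow]
    gcongr
    nlinarith
  · have hv (m i : Fin d) : parVec β m i = B i m := by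
      rw [parVec, hβT, hT]; simp
    simp only [hv]
    have h : S i j = (A i j + A j i) / 2 := rfl
    rw [← h, ← hBB, Matrix.mul_apply]
    refine Finset.sum_congr rfl fun m _ => ?_
    rw [← Matrix.transpose_apply B m j, hBt]

end Factorization

section WeakFormulation

variable {d : ℕ}

lemma weakSol_of_forall_contDiff [NeZero d] {β : Euc d ≃L[ℝ] Euc d} {F : Fin d → Euc d → ℝ}
    {u : Euc d → ℝ} (hu : ContDiffOn ℝ 1 u (closedBall 0 1))
    (hF : ∀ m, IntegrableOn (F m) (uball d))
    (h : ∀ φ : Euc d → ℝ, ContDiff ℝ (⊤ : ℕ∞) φ → HasCompactSupport φ → tsupport φ ⊆ uball d →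
      ∑ m, ∫ y in uball d, fderiv ℝ u y (parVec β m) * fderiv ℝ φ y (parVec β m) =
        ∑ m, ∫ y in uball d, F m y * fderiv ℝ φ y (parVec β m)) : WeakSol β F u := by
  intro φ hφ hφ0
  have h1 := tendsto_finsetSum Finset.univ fun m _ =>
    hφ0.tendsto_integral_cutoff (hu.integrableOn_fderiv_apply (parVec β m)) (parVec β m)
  have h2 := tendsto_finsetSum Finset.univ fun m _ =>
    hφ0.tendsto_integral_cutoff (hF m) (parVec β m)
  refine tendsto_nhds_unique (h1.congr fun n => ?_) h2
  exact h _ (contDiff_bdryCutoff_mul n hφ) (hasCompactSupport_bdryCutoff_mul n φ)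
    ((tsupport_bdryCutoff_mul_subset n φ).trans (setOf_one_le_mul_bdryQ_subset n))

lemma C1Zero.integral_fderiv_mul_fderiv_comm [NeZero d] {u φ : Euc d → ℝ} (hu : C1Zero u)
    (hφ : ContDiff ℝ (⊤ : ℕ∞) φ) (v w : Euc d) :
    ∫ y in uball d, fderiv ℝ u y v * fderiv ℝ φ y w =
      ∫ y in uball d, fderiv ℝ u y w * fderiv ℝ φ y v := by
  have hd (w : Euc d) : ContDiff ℝ 1 fun y => fderiv ℝ φ y w :=
    (hφ.fderiv_right (m := 1) (by norm_cast)).clm_apply contDiff_const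
  rw [hu.integral_fderiv_mul (hd w).contDiffOn v, hu.integral_fderiv_mul (hd v).contDiffOn w]
  congr 1
  refine integral_congr_ae (.of_forall fun y => ?_)
  have hdd : DifferentiableAt ℝ (fderiv ℝ φ) y :=
    (hφ.fderiv_right (m := 1) (by norm_cast)).differentiable one_ne_zero y
  have he (v w : Euc d) : fderiv ℝ (fun y => fderiv ℝ φ y w) y v =
      fderiv ℝ (fderiv ℝ φ) y v w := by
    rw [fderiv_clm_apply hdd (differentiableAt_const w)]
    simp
  have hs : IsSymmSndFDerivAt ℝ φ y :=
    hφ.contDiffAt.isSymmSndFDerivAt (by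
      rw [minSmoothness_of_isRCLikeNormedField]
      exact WithTop.coe_le_coe.2 (le_top : (2 : ℕ∞) ≤ ⊤))
  simp only [he, hs.eq v w]

lemma fderiv_parVec_eq_sum (β : Euc d ≃L[ℝ] Euc d) (u : Euc d → ℝ) (y : Euc d) (m : Fin d) :
    fderiv ℝ u y (parVec β m) = ∑ i, parVec β m i * fderiv ℝ u y (EuclideanSpace.single i 1) :=
  (fderiv_apply_eq_sum _ _).trans (Finset.sum_congr rfl fun _ _ => mul_comm _ _)

lemma C1Zero.integral_mulVec_grad_dotProduct [NeZero d] {β : Euc d ≃L[ℝ] Euc d}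
    {A : Matrix (Fin d) (Fin d) ℝ}
    (hβA : ∀ i j, ∑ m, parVec β m i * parVec β m j = (A i j + A j i) / 2)
    {u φ : Euc d → ℝ} (hu : C1Zero u) (hφ : ContDiff ℝ (⊤ : ℕ∞) φ) :
    ∫ y in uball d, (A *ᵥ grad u y) ⬝ᵥ grad φ y =
      ∑ m, ∫ y in uball d, fderiv ℝ u y (parVec β m) * fderiv ℝ φ y (parVec β m) := by
  have hφ1 : ContDiffOn ℝ 1 φ (closedBall 0 1) :=
    (hφ.of_le (by norm_cast)).contDiffOn
  have hintegral (v w : Euc d) :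
      IntegrableOn (fun y => fderiv ℝ u y v * fderiv ℝ φ y w) (uball d) :=
    hu.1.integrableOn_fderiv_mul
      ((hφ.continuous_fderiv (by simp)).clm_apply continuous_const).continuousOn v
  set I : Fin d → Fin d → ℝ := fun i j => ∫ y in uball d,
    fderiv ℝ u y (EuclideanSpace.single j 1) * fderiv ℝ φ y (EuclideanSpace.single i 1) with hI
  have hIs (i j : Fin d) : I i j = I j i := hu.integral_fderiv_mul_fderiv_comm hφ _ _
  have hsum (a : Fin d → Fin d → ℝ) : ∫ y in uball d, ∑ i, ∑ j,
      a i j * (fderiv ℝ u y (EuclideanSpace.single j 1) *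
        fderiv ℝ φ y (EuclideanSpace.single i 1)) = ∑ i, ∑ j, a i j * I i j := by
    rw [integral_finsetSum _ fun i _ =>
      integrable_finsetSum _ fun j _ => (hintegral _ _).const_mul _]
    refine Finset.sum_congr rfl fun i _ => ?_
    rw [integral_finsetSum _ fun j _ => (hintegral _ _).const_mul _]
    exact Finset.sum_congr rfl fun j _ => integral_const_mul _ _
  have e1 : ∫ y in uball d, (A *ᵥ grad u y) ⬝ᵥ grad φ y = ∑ i, ∑ j, A i j * I i j := by
    exact (integral_congr_ae (.of_forall fun y => mulVec_dotProduct_eq_sum A _ _)).trans (hsum A)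
  have e2 (m : Fin d) : ∫ y in uball d, fderiv ℝ u y (parVec β m) * fderiv ℝ φ y (parVec β m) =
      ∑ i, ∑ j, parVec β m i * parVec β m j * I i j := by
    rw [← hsum fun i j => parVec β m i * parVec β m j]
    refine integral_congr_ae (.of_forall fun y => ?_)
    beta_reduce
    rw [fderiv_parVec_eq_sum, fderiv_parVec_eq_sum, mul_comm, Finset.sum_mul_sum]
    exact Finset.sum_congr rfl fun i _ => Finset.sum_congr rfl fun j _ => by ring
  rw [e1, Finset.sum_congr rfl fun m _ => e2 m]
  have e3 (i : Fin d) : ∑ m, ∑ j, parVec β m i * parVec β m j * I i j =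
      ∑ j, (A i j + A j i) / 2 * I i j := by
    rw [Finset.sum_comm]
    refine Finset.sum_congr rfl fun j _ => ?_
    rw [← Finset.sum_mul, hβA]
  rw [Finset.sum_comm (s := Finset.univ) (t := Finset.univ)
    (f := fun m i => ∑ j, parVec β m i * parVec β m j * I i j),
    Finset.sum_congr rfl fun i _ => e3 i]
  have e4 : ∑ i, ∑ j, A j i * I i j = ∑ i, ∑ j, A i j * I i j := by
    rw [Finset.sum_comm]
    exact Finset.sum_congr rfl fun i _ => Finset.sum_congr rfl fun j _ => by rw [hIs]
  have e5 : ∑ i, ∑ j, (A i j + A j i) / 2 * I i j =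
      (∑ i, ∑ j, A i j * I i j + ∑ i, ∑ j, A j i * I i j) / 2 := by
    rw [← Finset.sum_add_distrib, Finset.sum_div]
    refine Finset.sum_congr rfl fun i _ => ?_
    rw [← Finset.sum_add_distrib, Finset.sum_div]
    exact Finset.sum_congr rfl fun j _ => by ring
  rw [e5, e4]
  ring

lemma dotProduct_grad_eq_sum (β : Euc d ≃L[ℝ] Euc d) (a : Fin d → ℝ) (φ : Euc d → ℝ)
    (y : Euc d) : a ⬝ᵥ grad φ y =
      ∑ m, β.symm (WithLp.toLp 2 a) m * fderiv ℝ φ y (parVec β m) := by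
  have h1 : (WithLp.toLp 2 a : Euc d) = ∑ m, β.symm (WithLp.toLp 2 a) m • parVec β m := by
    have h2 := congrArg β (EuclideanSpace.basisFun (Fin d) ℝ |>.sum_repr
      (β.symm (WithLp.toLp 2 a))).symm
    rw [map_sum, β.apply_symm_apply] at h2
    simpa [parVec] using h2
  have h3 : fderiv ℝ φ y (WithLp.toLp 2 a) = a ⬝ᵥ grad φ y :=
    (fderiv_apply_eq_sum _ _).trans (Finset.sum_congr rfl fun _ _ => mul_comm _ _)
  rw [← h3]
  conv_lhs => rw [h1]
  simp

end WeakFormulation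

section Assembly

variable {d : ℕ} {K : ℝ}

lemma volume_le_of_forall_eventually_mem {S : Set (Euc d)} {E : ℕ → Set (Euc d)} {b : ENNReal}
    (hS : ∀ x ∈ S, ∀ᶠ n in Filter.atTop, x ∈ E n) (hE : ∀ n, volume (E n) ≤ b) :
    volume S ≤ b := by
  have hsub : S ⊆ ⋃ N, ⋂ n ≥ N, E n := fun x hx => by
    obtain ⟨N, hN⟩ := Filter.eventually_atTop.1 (hS x hx)
    exact mem_iUnion.2 ⟨N, mem_iInter₂.2 hN⟩
  refine (measure_mono hsub).trans ?_
  have hmono : Monotone fun N : ℕ => ⋂ n ≥ N, E n := fun N M hNM =>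
    biInter_subset_biInter_left fun n (hn : M ≤ n) => hNM.trans hn
  rw [hmono.measure_iUnion]
  exact iSup_le fun N => (measure_mono (biInter_subset_of_mem (le_refl N))).trans (hE N)

lemma ContinuousOn.bddMeas_indicator {g : Euc d → ℝ} (hg : ContinuousOn g (closedBall 0 1)) :
    BddMeas ((uball d).indicator g) := by
  obtain ⟨M, hM⟩ := (isCompact_closedBall (0 : Euc d) 1).exists_bound_of_continuousOn hg
  refine ⟨?_, |M|, fun y => ?_⟩
  · classical
    rw [← Set.piecewise_eq_indicator]
    exact (hg.mono ball_subset_closedBall).measurable_piecewise continuousOn_const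
      measurableSet_ball
  · by_cases hy : y ∈ uball d
    · rw [indicator_of_mem hy]
      exact (hM y (ball_subset_closedBall hy)).trans (le_abs_self M)
    · rw [indicator_of_notMem hy, abs_zero]
      exact abs_nonneg M

lemma ContinuousOn.continuousOn_indicator_uball {g : Euc d → ℝ}
    (hg : ContinuousOn g (closedBall 0 1)) : ContinuousOn ((uball d).indicator g) (uball d) :=
  (hg.mono ball_subset_closedBall).congr fun _ hy => indicator_of_mem hy g

lemma c1Zero_poleTest {β : Euc d ≃L[ℝ] Euc d} (hK : 1 ≤ K) (hβ' : ∀ x, ‖β.symm x‖ ≤ K * ‖x‖)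
    {ε : ℝ} (hε : 0 < ε) (k : Fin d) {x : Euc d} (hx : x ∈ uball d) :
    C1Zero (poleTest β K ε k x) :=
  ⟨contDiffOn_corTest hε (corC_nonneg hK hβ' hx) x k, fun _ hy => corTest_eq_zero x k hy⟩

lemma exists_eventually_lt [NeZero d] (hK : 1 ≤ K) : ∃ C : ℝ, 0 < C ∧
    ∀ β : Euc d ≃L[ℝ] Euc d, (∀ x, ‖β x‖ ≤ K * ‖x‖) → (∀ x, ‖β.symm x‖ ≤ K * ‖x‖) →
    ∀ F : Fin d → Euc d → ℝ, (∀ m, ContinuousOn (F m) (closedBall 0 1)) →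
    ∀ u : Euc d → ℝ, C1Zero u → WeakSol β F u →
    ∀ x ∈ uball d, ∀ k a, a < |fderiv ℝ u x (parVec β k)| →
      ∀ᶠ ε in nhdsWithin (0 : ℝ) (Ioi 0),
        a < C * ((∫ y in uball d, bdryKer ε x y * (|u y| + ∑ m, |F m y|)) +
          ∑ m, |∫ y in uball d, parN β ε m k (x - y) * F m y|) := by
  obtain ⟨C1, hC1, h1⟩ := exists_integral_parPsi_fderiv_le (d := d) hK
  obtain ⟨C2, hC2, h2⟩ := exists_sum_integral_mul_fderiv_poleTest_le d hK
  obtain ⟨c, hc, h3⟩ := exists_le_integral_parPsi d (zero_lt_one.trans_le hK)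
  refine ⟨(2 * C1 + C2 + 1) / c, by positivity, fun β hβ hβ' F hF u hu hw x hx k a ha => ?_⟩
  have hlim := (hu.1.tendsto_integral_parPsi_fderiv (zero_lt_one.trans_le hK) hβ hx
    (parVec β k)).abs
  have hlt : c * a < |(∫ z, parPsi β 1 z) * fderiv ℝ u x (parVec β k)| := by
    have h4 := h3 β hβ hβ'
    rw [abs_mul, abs_of_pos (hc.trans_le h4)]
    calc c * a < c * |fderiv ℝ u x (parVec β k)| := by gcongr
      _ ≤ _ := by gcongr
  have hq := bdryQ_pos hx
  have hsm : ∀ᶠ ε in nhdsWithin (0 : ℝ) (Ioi 0), ε ^ 2 < bdryQ x ^ 3 := by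
    have h5 : Filter.Tendsto (fun ε : ℝ => ε ^ 2) (nhdsWithin 0 (Ioi 0)) (nhds (0 ^ 2)) :=
      ((continuous_pow 2).tendsto 0).mono_left nhdsWithin_le_nhds
    exact h5.eventually_lt_const (by rw [zero_pow two_ne_zero]; positivity)
  filter_upwards [hlim.eventually_const_lt hlt, hsm, self_mem_nhdsWithin] with ε h6 h7 h8
  have hε : 0 < ε := h8
  have e1 := h1 β hβ hβ' ε hε k x hx u hu
  have hp := c1Zero_poleTest hK hβ' hε k hx
  have hsmth : ContDiffOn ℝ (⊤ : ℕ∞) (poleTest β K ε k x) (uball d) :=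
    (contDiffOn_corTest hε (corC_nonneg hK hβ' hx) x k).mono ball_subset_closedBall
  rw [hw (poleTest β K ε k x) hsmth hp] at e1
  have e2 := h2 β hβ hβ' ε hε k x hx F hF
  have hkb := bddMeas_bdryKer hε x
  have hFc : ContinuousOn (fun y => ∑ m, |F m y|) (closedBall 0 1) :=
    continuousOn_finsetSum _ fun m _ => (hF m).abs
  have i1 : IntegrableOn (fun y => bdryKer ε x y * |u y|) (uball d) :=
    hkb.integrableOn_mul hu.1.continuousOn.abs.integrableOn_uball'
  have i2 : IntegrableOn (fun y => bdryKer ε x y * ∑ m, |F m y|) (uball d) :=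
    hkb.integrableOn_mul hFc.integrableOn_uball'
  have e3 : ∫ y in uball d, bdryKer ε x y * (|u y| + ∑ m, |F m y|) =
      (∫ y in uball d, bdryKer ε x y * |u y|) +
        ∫ y in uball d, bdryKer ε x y * ∑ m, |F m y| := by
    rw [← integral_add i1 i2]
    simp only [mul_add]
  have p1 : 0 ≤ ∫ y in uball d, bdryKer ε x y * |u y| :=
    integral_nonneg fun y => mul_nonneg (bdryKer_pos hε x y).le (abs_nonneg _)
  have p2 : 0 ≤ ∫ y in uball d, bdryKer ε x y * ∑ m, |F m y| :=
    integral_nonneg fun y => mul_nonneg (bdryKer_pos hε x y).le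
      (Finset.sum_nonneg fun m _ => abs_nonneg _)
  have p3 : 0 ≤ ∑ m, |∫ y in uball d, parN β ε m k (x - y) * F m y| :=
    Finset.sum_nonneg fun m _ => abs_nonneg _
  rw [e3]
  set I1 := ∫ y in uball d, bdryKer ε x y * |u y|
  set I2 := ∫ y in uball d, bdryKer ε x y * ∑ m, |F m y|
  set I3 := ∑ m, |∫ y in uball d, parN β ε m k (x - y) * F m y|
  have h9 : C1 * (1 + ε ^ 2 / bdryQ x ^ 3) * I1 ≤ C1 * 2 * I1 := by
    have : ε ^ 2 / bdryQ x ^ 3 ≤ 1 := (div_le_one (by positivity)).2 h7.le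
    gcongr
    linarith
  have h10 : c * a < (2 * C1 + C2 + 1) * (I1 + I2 + I3) := by
    have : C1 * 2 * I1 + (C2 * I2 + I3) ≤ (2 * C1 + C2 + 1) * (I1 + I2 + I3) := by
      have := mul_nonneg hC1.le p1
      have := mul_nonneg hC1.le p2
      have := mul_nonneg hC1.le p3
      have := mul_nonneg hC2.le p1
      have := mul_nonneg hC2.le p2
      have := mul_nonneg hC2.le p3
      linarith
    linarith
  rw [div_mul_eq_mul_div, lt_div_iff₀ hc]
  linarith

lemma exists_volume_abs_fderiv_parVec_le [NeZero d] (hK : 1 ≤ K) : ∃ C : ℝ, 0 < C ∧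
    ∀ β : Euc d ≃L[ℝ] Euc d, (∀ x, ‖β x‖ ≤ K * ‖x‖) → (∀ x, ‖β.symm x‖ ≤ K * ‖x‖) →
    ∀ F : Fin d → Euc d → ℝ, (∀ m, ContinuousOn (F m) (closedBall 0 1)) →
    ∀ u : Euc d → ℝ, C1Zero u → WeakSol β F u → ∀ k α, 0 < α →
      volume {x ∈ uball d | α < |fderiv ℝ u x (parVec β k)|} ≤
        ENNReal.ofReal (C / α * ∑ m, ∫ y in uball d, |F m y|) := by
  obtain ⟨C, hC, h⟩ := exists_eventually_lt (d := d) hK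
  obtain ⟨C3, hC3, h3⟩ := weak_type_bdryKer (d := d)
  obtain ⟨C4, hC4, h4⟩ := weak_type_parN (d := d) (zero_lt_one.trans_le hK)
  obtain ⟨C5, hC5, h5⟩ := exists_integral_abs_le (d := d) hK
  refine ⟨(C3 * (C5 + 1) + C4) * (C * (d + 1)), by positivity,
    fun β hβ hβ' F hF u hu hw k α hα => ?_⟩
  have hFc : ContinuousOn (fun y => ∑ m, |F m y|) (closedBall 0 1) :=
    continuousOn_finsetSum _ fun m _ => (hF m).abs
  set G : Euc d → ℝ := fun y => |u y| + ∑ m, |F m y| with hGd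
  have hG : ContinuousOn G (closedBall 0 1) := hu.1.continuousOn.abs.add hFc
  set a := α / (C * (d + 1)) with ha
  have ha0 : 0 < a := by positivity
  set ε : ℕ → ℝ := fun n => 1 / ((n : ℝ) + 1) with hεd
  have hε (n : ℕ) : 0 < ε n := by positivity
  have hε1 (n : ℕ) : ε n ≤ 1 := by
    rw [hεd, div_le_one (by positivity)]; linarith [(Nat.cast_nonneg n : (0 : ℝ) ≤ n)]
  have hεlim : Filter.Tendsto ε Filter.atTop (nhdsWithin 0 (Ioi 0)) :=
    tendsto_nhdsWithin_iff.2 ⟨tendsto_one_div_add_atTop_nhds_zero_nat, .of_forall hε⟩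
  set E : ℕ → Set (Euc d) := fun n =>
    {x ∈ uball d | a < |∫ y in uball d, bdryKer (ε n) x y * (uball d).indicator G y|} ∪
    ⋃ m, {x ∈ uball d |
      a < |∫ y in uball d, parN β (ε n) m k (x - y) * (uball d).indicator (F m) y|} with hE
  have hind (g : Euc d → ℝ) : ∫ y in uball d, |(uball d).indicator g y| = ∫ y in uball d, |g y| :=
    setIntegral_congr_fun measurableSet_ball fun y hy => by simp only [indicator_of_mem hy]
  have hGF : ∫ y in uball d, |G y| ≤ (C5 + 1) * ∑ m, ∫ y in uball d, |F m y| := by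
    have e1 : ∫ y in uball d, |G y| = (∫ y in uball d, |u y|) + ∑ m, ∫ y in uball d, |F m y| := by
      rw [← integral_finsetSum _ fun m _ => (hF m).abs.integrableOn_uball',
        ← integral_add hu.1.continuousOn.abs.integrableOn_uball' hFc.integrableOn_uball']
      refine integral_congr_ae (.of_forall fun y => abs_of_nonneg ?_)
      exact add_nonneg (abs_nonneg _) (Finset.sum_nonneg fun m _ => abs_nonneg _)
    rw [e1, add_mul, one_mul]
    exact add_le_add (h5 β hβ hβ' F hF u hu hw) le_rfl
  have hF0 (m : Fin d) : 0 ≤ ∫ y in uball d, |F m y| := integral_nonneg fun y => abs_nonneg _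
  refine volume_le_of_forall_eventually_mem (E := E) (fun x hx => ?_) fun n => ?_
  · filter_upwards [hεlim.eventually (h β hβ hβ' F hF u hu hw x hx.1 k α hx.2)] with n hn
    by_contra hc
    simp only [hE, mem_union, mem_iUnion, not_or, not_exists, Set.mem_ofPred_eq, not_and, not_lt,
      setIntegral_indicator_mul _ measurableSet_ball] at hc
    have c1 := (le_abs_self _).trans (hc.1 hx.1)
    have c2 : ∑ m, |∫ y in uball d, parN β (ε n) m k (x - y) * F m y| ≤ d * a := by
      refine (Finset.sum_le_sum fun m _ => hc.2 m hx.1).trans (le_of_eq ?_)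
      simp
    have c3 : α = C * (a + d * a) := by rw [ha]; field_simp; ring
    have c4 : C * ((∫ y in uball d, bdryKer (ε n) x y * G y) +
        ∑ m, |∫ y in uball d, parN β (ε n) m k (x - y) * F m y|) ≤ C * (a + d * a) := by
      gcongr
    exact absurd hn (not_lt.2 (c4.trans c3.ge))
  · refine (measure_union_le _ _).trans ?_
    have b1 := h3 (ε n) (hε n) (hε1 n) _ hG.bddMeas_indicator hG.continuousOn_indicator_uball a ha0
    have b2 : volume (⋃ m, {x ∈ uball d |
        a < |∫ y in uball d, parN β (ε n) m k (x - y) * (uball d).indicator (F m) y|}) ≤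
        ENNReal.ofReal (C4 / a * ∑ m, ∫ y in uball d, |F m y|) := by
      refine (measure_iUnion_fintype_le _ _).trans ?_
      rw [Finset.mul_sum,
        ENNReal.ofReal_sum_of_nonneg fun m _ => mul_nonneg (by positivity) (hF0 m)]
      refine Finset.sum_le_sum fun m _ => ?_
      rw [← hind]
      exact h4 β hβ hβ' (ε n) (hε n) m k _ (hF m).bddMeas_indicator
        (hF m).continuousOn_indicator_uball a ha0
    refine (add_le_add b1 b2).trans ?_
    rw [hind]
    have hS : 0 ≤ ∑ m, ∫ y in uball d, |F m y| := Finset.sum_nonneg fun m _ => hF0 m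
    rw [← ENNReal.ofReal_add (mul_nonneg (by positivity) (integral_nonneg fun y => abs_nonneg _))
      (mul_nonneg (by positivity) hS)]
    refine ENNReal.ofReal_le_ofReal ?_
    calc _ ≤ C3 / a * ((C5 + 1) * ∑ m, ∫ y in uball d, |F m y|) +
          C4 / a * ∑ m, ∫ y in uball d, |F m y| := by gcongr
      _ = _ := by rw [ha]; field_simp

lemma exists_lt_abs_fderiv_parVec [NeZero d] (hK : 1 ≤ K) {β : Euc d ≃L[ℝ] Euc d}
    (hβ' : ∀ x, ‖β.symm x‖ ≤ K * ‖x‖) {u : Euc d → ℝ} {x : Euc d} {α : ℝ}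
    (h : α < ‖fderiv ℝ u x‖) : ∃ k, α / (K * d) < |fderiv ℝ u x (parVec β k)| := by
  by_contra! hc
  have hd : 0 < (d : ℝ) := by exact_mod_cast NeZero.pos d
  have hKd : 0 < K * d := by positivity
  refine absurd h (not_lt.2 (ContinuousLinearMap.opNorm_le_bound _ ?_ fun v => ?_))
  · have := (abs_nonneg _).trans (hc 0)
    rwa [le_div_iff₀ hKd, zero_mul] at this
  · have h1 : v = ∑ m, β.symm v m • parVec β m := by
      have h2 := congrArg β (EuclideanSpace.basisFun (Fin d) ℝ |>.sum_repr (β.symm v)).symm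
      rw [map_sum, β.apply_symm_apply] at h2
      simpa [parVec] using h2
    have h3 : fderiv ℝ u x v = ∑ m, β.symm v m * fderiv ℝ u x (parVec β m) := by
      conv_lhs => rw [h1]
      simp
    rw [h3, Real.norm_eq_abs]
    refine (Finset.abs_sum_le_sum_abs _ _).trans ?_
    have h4 (m : Fin d) : |β.symm v m * fderiv ℝ u x (parVec β m)| ≤
        K * ‖v‖ * (α / (K * d)) := by
      rw [abs_mul]
      exact mul_le_mul ((abs_apply_le_norm _ m).trans (hβ' v)) (hc m) (abs_nonneg _)
        (by positivity)
    refine (Finset.sum_le_sum fun m _ => h4 m).trans (le_of_eq ?_)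
    simp only [Finset.sum_const, Finset.card_univ, Fintype.card_fin, nsmul_eq_mul]
    field_simp

end Assembly

lemma norm_toLp_two_le {d : ℕ} (a : Fin d → ℝ) : ‖(WithLp.toLp 2 a : Euc d)‖ ≤ d * ‖a‖ := by
  rw [EuclideanSpace.norm_eq]
  refine Real.sqrt_le_iff.2 ⟨by positivity, ?_⟩
  calc ∑ i, ‖a i‖ ^ 2 ≤ ∑ _i : Fin d, ‖a‖ ^ 2 := by
        gcongr with i
        exact norm_le_pi_norm a i
    _ = d * ‖a‖ ^ 2 := by simp
    _ ≤ (d * ‖a‖) ^ 2 := by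
        rw [mul_pow]
        gcongr
        exact_mod_cast Nat.le_self_pow two_ne_zero d

lemma volume_norm_fderiv_le {d : ℕ} [NeZero d] {K : ℝ} (hK : 1 ≤ K) {β : Euc d ≃L[ℝ] Euc d}
    (hβ' : ∀ x, ‖β.symm x‖ ≤ K * ‖x‖) {u : Euc d → ℝ} {α : ℝ} {b : ENNReal}
    (h : ∀ k, volume {x ∈ uball d | α / (K * d) < |fderiv ℝ u x (parVec β k)|} ≤ b) :
    volume {x ∈ uball d | α < ‖fderiv ℝ u x‖} ≤ d * b := by
  calc volume {x ∈ uball d | α < ‖fderiv ℝ u x‖}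
      ≤ volume (⋃ k, {x ∈ uball d | α / (K * d) < |fderiv ℝ u x (parVec β k)|}) := by
        refine measure_mono fun x hx => ?_
        obtain ⟨k, hk⟩ := exists_lt_abs_fderiv_parVec hK hβ' hx.2
        exact mem_iUnion.2 ⟨k, hx.1, hk⟩
    _ ≤ ∑ k, volume {x ∈ uball d | α / (K * d) < |fderiv ℝ u x (parVec β k)|} :=
        measure_iUnion_fintype_le _ _
    _ ≤ ∑ _k : Fin d, b := Finset.sum_le_sum fun k _ => h k
    _ = d * b := by simp

/-- Weak type-(1,1) estimate for the gradient of solutions of the constant-coefficient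
divergence form problem `div(A₀ ∇u) = div f` in `B = B(0,1)`, `u = 0` on `∂B`:
`|{x ∈ B : |∇u(x)| > α}| ≤ (C/α) ∫_B |f|` with `C = C(d,λ,Λ)`. -/
theorem weak11_div_constant_coeff
    (d : ℕ) (hd : 1 ≤ d) (lam Lam : ℝ) (hlam : 0 < lam) (hLam : 0 < Lam) :
    ∃ C : ℝ, 0 < C ∧
      ∀ A₀ : Matrix (Fin d) (Fin d) ℝ,
        (∀ ξ : Fin d → ℝ, lam * ∑ i, ξ i ^ 2 ≤ (A₀ *ᵥ ξ) ⬝ᵥ ξ) →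
        Real.sqrt (∑ i, ∑ j, (A₀ i j) ^ 2) ≤ Lam →
      ∀ f : EuclideanSpace ℝ (Fin d) → Fin d → ℝ, ContDiff ℝ (⊤ : ℕ∞) f →
      ∀ u : EuclideanSpace ℝ (Fin d) → ℝ,
        ContDiffOn ℝ 1 u (closedBall (0 : EuclideanSpace ℝ (Fin d)) 1) →
        (∀ x ∈ sphere (0 : EuclideanSpace ℝ (Fin d)) 1, u x = 0) →
        (∀ φ : EuclideanSpace ℝ (Fin d) → ℝ, ContDiff ℝ (⊤ : ℕ∞) φ → HasCompactSupport φ →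
          tsupport φ ⊆ ball (0 : EuclideanSpace ℝ (Fin d)) 1 →
          ∫ x in ball (0 : EuclideanSpace ℝ (Fin d)) 1, (A₀ *ᵥ grad u x) ⬝ᵥ grad φ x
            = ∫ x in ball (0 : EuclideanSpace ℝ (Fin d)) 1, f x ⬝ᵥ grad φ x) →
      ∀ α : ℝ, 0 < α →
        volume {x ∈ ball (0 : EuclideanSpace ℝ (Fin d)) 1 | α < ‖fderiv ℝ u x‖}
          ≤ ENNReal.ofReal (C / α * ∫ x in ball (0 : EuclideanSpace ℝ (Fin d)) 1, ‖f x‖) := by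
  have : NeZero d := ⟨by omega⟩
  have hd0 : 0 < (d : ℝ) := by exact_mod_cast hd
  set K := 1 + Lam + 1 / lam with hKd
  have hK : 1 ≤ K := by
    have : 0 < 1 / lam := by positivity
    linarith
  obtain ⟨C, hC, hmain⟩ := exists_volume_abs_fderiv_parVec_le (d := d) hK
  refine ⟨d * (C * (K * d) * (d * (K * d))), by positivity,
    fun A hA hA' f hf u hu hu0 hweak α hα => ?_⟩
  obtain ⟨β, hβ, hβ', hβA⟩ := exists_equiv_factor hlam hLam hA hA'
  set F : Fin d → Euc d → ℝ := fun m y => β.symm (WithLp.toLp 2 (f y)) m with hF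
  have hFcont (m : Fin d) : Continuous (F m) := by
    have h1 : Continuous fun y => (WithLp.toLp 2 (f y) : Euc d) :=
      (PiLp.continuous_toLp 2 _).comp hf.continuous
    exact (EuclideanSpace.proj (𝕜 := ℝ) m).continuous.comp (β.symm.continuous.comp h1)
  have hu1 : C1Zero u := ⟨hu, hu0⟩
  have hw : WeakSol β F u := by
    refine weakSol_of_forall_contDiff hu
      (fun m => (hFcont m).continuousOn.integrableOn_uball') fun φ h1 h2 h3 => ?_
    rw [← hu1.integral_mulVec_grad_dotProduct hβA h1, ← integral_finsetSum]
    · refine (hweak φ h1 h2 h3).trans (integral_congr_ae (.of_forall fun y => ?_))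
      exact dotProduct_grad_eq_sum β (f y) φ y
    · exact fun m _ => ((hFcont m).mul ((h1.continuous_fderiv (by simp)).clm_apply
        continuous_const)).continuousOn.integrableOn_uball'
  have hFle (m : Fin d) : ∫ y in uball d, |F m y| ≤ K * d * ∫ y in uball d, ‖f y‖ := by
    rw [← integral_const_mul]
    refine integral_mono (hFcont m).abs.continuousOn.integrableOn_uball'
      (continuous_const.mul hf.continuous.norm).continuousOn.integrableOn_uball' fun y => ?_
    calc |F m y| ≤ K * ‖(WithLp.toLp 2 (f y) : Euc d)‖ := (abs_apply_le_norm _ m).trans (hβ' _)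
      _ ≤ K * (d * ‖f y‖) := by gcongr; exact norm_toLp_two_le _
      _ = K * d * ‖f y‖ := (mul_assoc _ _ _).symm
  have hα' : 0 < α / (K * d) := by positivity
  refine (volume_norm_fderiv_le hK hβ' fun k =>
    hmain β hβ hβ' F (fun m => (hFcont m).continuousOn) u hu1 hw k _ hα').trans ?_
  rw [← ENNReal.ofReal_natCast, ← ENNReal.ofReal_mul hd0.le]
  refine ENNReal.ofReal_le_ofReal ?_
  calc _ ≤ d * (C / (α / (K * d)) * ∑ _m : Fin d, K * d * ∫ y in uball d, ‖f y‖) := by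
        gcongr with m
        exact hFle m
    _ = _ := by
        simp only [Finset.sum_const, Finset.card_univ, Fintype.card_fin, nsmul_eq_mul]
        field_simp
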